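/- Let T be a nondegenerate triangle in ℝ² and let T* be an isosceles right triangle with the same area as T (|T*| = |T|). Then λ₁^{MS}(T) ≥ λ₁^{MS}(T*), and equality holds if and only if T is congruent to T* (i.e., T is itself an isosceles right triangle of that area). -/

import Mathlib

open MeasureTheory Set EuclideanGeometry

noncomputable section

abbrev E2 : Type := EuclideanSpace ℝ (Fin 2)

/-- The Rayleigh quotient of a function `u` on the domain `Ω ⊆ ℝ²`. -/
def rayleigh (Ω : Set E2) (u : E2 → ℝ) : ℝ :=
  (∫ x in Ω, ‖fderiv ℝ u x‖ ^ 2) / (∫ x in Ω, (u x) ^ 2)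

/-- `u` is not almost everywhere zero on `Ω`. -/
def NotAEZero (Ω : Set E2) (u : E2 → ℝ) : Prop :=
  ¬ (∀ᵐ x ∂(volume.restrict Ω), u x = 0)

/-- The first mixed Dirichlet–Neumann eigenvalue of the Laplacian on `Ω`,
with Dirichlet condition on `D` and Neumann condition on the rest of the boundary,
defined variationally. -/
def firstMixedEig (Ω D : Set E2) : ℝ :=
  sInf { r | ∃ u : E2 → ℝ, ContDiff ℝ (⊤ : ℕ∞) u ∧ (∀ x ∈ D, u x = 0) ∧
    NotAEZero Ω u ∧ r = rayleigh Ω u }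

/-- The `k`-th mixed Dirichlet–Neumann eigenvalue of the Laplacian on `Ω`,
with Dirichlet condition on `D`, via the Courant–Fischer min–max principle. -/
def mixedEig (Ω D : Set E2) (k : ℕ) : ℝ :=
  sInf { r | ∃ V : Submodule ℝ (E2 → ℝ), Module.finrank ℝ V = k ∧
    (∀ u ∈ V, ContDiff ℝ (⊤ : ℕ∞) u ∧ ∀ x ∈ D, u x = 0) ∧
    r = sSup { q | ∃ u ∈ V, NotAEZero Ω u ∧ q = rayleigh Ω u } }

/-- The open triangle with vertices `A`, `B`, `C`. -/
def triangleO (A B C : E2) : Set E2 := interior (convexHull ℝ ({A, B, C} : Set E2))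

/-- The area of a plane region. -/
def area2 (s : Set E2) : ℝ := (volume s).toReal

/-- The open rectangle `(0,a) × (0,b)`. -/
def rectO (a b : ℝ) : Set E2 := {p : E2 | p 0 ∈ Ioo 0 a ∧ p 1 ∈ Ioo 0 b}

/-- The closed rectangle `[0,a] × [0,b]`. -/
def rectC (a b : ℝ) : Set E2 := {p : E2 | p 0 ∈ Icc 0 a ∧ p 1 ∈ Icc 0 b}

/-- The two vertical sides of the closed rectangle `[0,a] × [0,b]`. -/
def vSides (a b : ℝ) : Set E2 := {p : E2 | (p 0 = 0 ∨ p 0 = a) ∧ p 1 ∈ Icc 0 b}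

/-- The two horizontal sides of the closed rectangle `[0,a] × [0,b]`. -/
def hSides (a b : ℝ) : Set E2 := {p : E2 | p 0 ∈ Icc 0 a ∧ (p 1 = 0 ∨ p 1 = b)}

/-- `F(y) = Σ_{j=0}^∞ ((y − j²)₊)^{1/2}`. -/
def Ffun (y : ℝ) : ℝ := ∑' j : ℕ, Real.sqrt (max (y - (j : ℝ) ^ 2) 0)

/-- `M`, the inverse function of `F` on `[0,∞)`. -/
def Mfun (x : ℝ) : ℝ := sInf {y : ℝ | 0 ≤ y ∧ x ≤ Ffun y}

/-- The decreasing rearrangement of `ψ`, as a function of half the measure of superlevel sets. -/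
def rear (ψ : ℝ → ℝ) (x : ℝ) : ℝ :=
  sInf {τ : ℝ | 0 ≤ τ ∧ volume {y | τ < ψ y} ≤ ENNReal.ofReal (2 * x)}

section Rearrangement

variable {ψ φ : ℝ → ℝ}

theorem rear_nonneg (ψ : ℝ → ℝ) (x : ℝ) : 0 ≤ rear ψ x :=
  Real.sInf_nonneg fun _ h => h.1

theorem rear_set_bddBelow (ψ : ℝ → ℝ) (x : ℝ) :
    BddBelow {τ : ℝ | 0 ≤ τ ∧ volume {y | τ < ψ y} ≤ ENNReal.ofReal (2 * x)} :=
  ⟨0, fun _ h => h.1⟩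

theorem rear_set_nonempty (hb : BddAbove (range ψ)) (x : ℝ) :
    {τ : ℝ | 0 ≤ τ ∧ volume {y | τ < ψ y} ≤ ENNReal.ofReal (2 * x)}.Nonempty := by
  obtain ⟨b, hb⟩ := hb
  refine ⟨max b 0, le_max_right _ _, ?_⟩
  have : {y | max b 0 < ψ y} = ∅ := by
    ext y
    simp only [mem_ofPred_eq, mem_empty_iff_false, iff_false, not_lt]
    exact (hb ⟨y, rfl⟩).trans (le_max_left _ _)
  rw [this, measure_empty]
  exact zero_le

theorem lt_rear_iff (hb : BddAbove (range ψ)) {τ : ℝ} (hτ : 0 ≤ τ) (x : ℝ) :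
    τ < rear ψ x ↔ ENNReal.ofReal (2 * x) < volume {y | τ < ψ y} := by
  constructor
  · intro h
    by_contra! hc
    exact absurd (csInf_le (rear_set_bddBelow ψ x) ⟨hτ, hc⟩) (not_le.2 h)
  · intro h
    have hU : {y | τ < ψ y} = ⋃ n : ℕ, {y | τ + 1 / ((n : ℝ) + 1) < ψ y} := by
      ext y
      simp only [mem_ofPred_eq, mem_iUnion]
      constructor
      · intro hy
        obtain ⟨n, hn⟩ := exists_nat_one_div_lt (sub_pos.2 hy)
        exact ⟨n, by linarith⟩
      · rintro ⟨n, hn⟩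
        have : (0 : ℝ) < 1 / ((n : ℝ) + 1) := by positivity
        linarith
    have hmono : Monotone fun n : ℕ => {y | τ + 1 / ((n : ℝ) + 1) < ψ y} := by
      intro n m hnm y hy
      simp only [mem_ofPred_eq] at hy ⊢
      have : 1 / ((m : ℝ) + 1) ≤ 1 / ((n : ℝ) + 1) := by
        apply one_div_le_one_div_of_le (by positivity)
        have : (n : ℝ) ≤ m := by exact_mod_cast hnm
        linarith
      linarith
    rw [hU, hmono.measure_iUnion, lt_iSup_iff] at h
    obtain ⟨n, hn⟩ := h
    have hpos : (0 : ℝ) < 1 / ((n : ℝ) + 1) := by positivity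
    have : τ + 1 / ((n : ℝ) + 1) ≤ rear ψ x := by
      apply le_csInf (rear_set_nonempty hb x)
      rintro σ ⟨_, hσ⟩
      by_contra! hc
      refine absurd (hn.trans_le ((measure_mono ?_).trans hσ)) (lt_irrefl _)
      intro y hy
      exact hc.trans hy
    linarith

theorem rear_antitone (hb : BddAbove (range ψ)) : Antitone (rear ψ) := by
  intro x x' h
  by_contra! hc
  rw [lt_rear_iff hb (rear_nonneg _ _)] at hc
  have : rear ψ x < rear ψ x := by
    rw [lt_rear_iff hb (rear_nonneg _ _)]
    exact (ENNReal.ofReal_le_ofReal (by linarith)).trans_lt hc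
  exact lt_irrefl _ this

theorem rear_eq_zero {a x : ℝ} (hs : ∀ y, a ≤ |y| → ψ y ≤ 0) (hx : a ≤ x) : rear ψ x = 0 := by
  refine le_antisymm (csInf_le (rear_set_bddBelow ψ x) ⟨le_rfl, ?_⟩) (rear_nonneg _ _)
  calc volume {y | 0 < ψ y} ≤ volume (Ioo (-a) a) := by
        apply measure_mono
        intro y hy
        rw [mem_Ioo, ← abs_lt]
        by_contra! hc
        exact absurd hy (not_lt.2 (hs y hc))
    _ ≤ ENNReal.ofReal (2 * x) := by
        rw [Real.volume_Ioo]
        exact ENNReal.ofReal_le_ofReal (by linarith)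

theorem rear_le_add (hb : BddAbove (range ψ)) (hb' : BddAbove (range φ)) {δ : ℝ} (hδ : 0 ≤ δ)
    (h : ∀ y, ψ y ≤ φ y + δ) (x : ℝ) : rear ψ x ≤ rear φ x + δ := by
  by_contra! hc
  have h0 := rear_nonneg φ x
  rw [lt_rear_iff hb (by linarith)] at hc
  have : rear φ x < rear φ x := by
    rw [lt_rear_iff hb' h0]
    refine hc.trans_le (measure_mono fun y hy => ?_)
    have := h y
    simp only [mem_ofPred_eq] at hy ⊢
    linarith
  exact lt_irrefl _ this

theorem rear_comp_add (ψ : ℝ → ℝ) (c : ℝ) : rear (fun y => ψ (y + c)) = rear ψ := by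
  funext x
  have : ∀ τ, volume {y | τ < ψ (y + c)} = volume {y | τ < ψ y} := by
    intro τ
    exact measure_preimage_add_right volume c {y | τ < ψ y}
  simp only [rear, this]

theorem lintegral_mul_eq_lintegral_meas {α : Type*} [MeasurableSpace α] (μ : Measure α)
    [SFinite μ] {f g : α → ℝ} (hf : Measurable f) (hg : Measurable g) (hf0 : ∀ x, 0 ≤ f x)
    (hg0 : ∀ x, 0 ≤ g x) :
    ∫⁻ x, ENNReal.ofReal (f x * g x) ∂μ =
      ∫⁻ τ in Ioi (0 : ℝ), ∫⁻ σ in Ioi (0 : ℝ), μ ({x | τ < f x} ∩ {x | σ < g x}) := by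
  have hG : Measurable fun x => ENNReal.ofReal (g x) := hg.ennreal_ofReal
  have h1 : ∫⁻ x, ENNReal.ofReal (f x * g x) ∂μ =
      ∫⁻ x, ENNReal.ofReal (f x) ∂(μ.withDensity fun x => ENNReal.ofReal (g x)) := by
    rw [lintegral_withDensity_eq_lintegral_mul _ hG hf.ennreal_ofReal]
    refine lintegral_congr fun x => ?_
    rw [Pi.mul_apply, mul_comm (f x), ENNReal.ofReal_mul (hg0 x)]
  rw [h1, lintegral_eq_lintegral_meas_lt _ (Filter.Eventually.of_forall hf0) hf.aemeasurable]
  refine lintegral_congr fun τ => ?_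
  have hm : MeasurableSet {x | τ < f x} := measurableSet_lt measurable_const hf
  rw [withDensity_apply _ hm,
    lintegral_eq_lintegral_meas_lt _ (Filter.Eventually.of_forall hg0) hg.aemeasurable]
  refine lintegral_congr fun σ => ?_
  rw [Measure.restrict_apply (measurableSet_lt measurable_const hg), inter_comm]

theorem volume_rear_inter (hb : BddAbove (range ψ)) (hb' : BddAbove (range φ)) {τ σ : ℝ}
    (hτ : 0 ≤ τ) (hσ : 0 ≤ σ) (hf : volume {y | τ < ψ y} ≠ ⊤) :
    volume.restrict (Ioi 0) ({x | τ < rear ψ x} ∩ {x | σ < rear φ x}) =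
      min (volume {y | τ < ψ y}) (volume {y | σ < φ y}) / 2 := by
  set p := volume {y | τ < ψ y} with hp
  set q := volume {y | σ < φ y} with hq
  have hpq : min p q ≠ ⊤ := by simp [hf]
  have : {x | τ < rear ψ x} ∩ {x | σ < rear φ x} ∩ Ioi 0 = Ioo 0 ((min p q).toReal / 2) := by
    ext x
    simp only [mem_inter_iff, mem_ofPred_eq, mem_Ioi, mem_Ioo, lt_rear_iff hb hτ,
      lt_rear_iff hb' hσ, ← lt_min_iff]
    rw [and_comm]
    refine and_congr_right fun hx => ?_
    rw [← ENNReal.ofReal_toReal hpq, ENNReal.ofReal_lt_ofReal_iff_of_nonneg (by linarith),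
      ENNReal.toReal_ofReal ENNReal.toReal_nonneg]
    constructor <;> intro h <;> linarith
  rw [Measure.restrict_apply' measurableSet_Ioi, this, Real.volume_Ioo, sub_zero,
    ENNReal.ofReal_div_of_pos (by norm_num), ENNReal.ofReal_toReal hpq]
  simp

/-- The Hardy–Littlewood inequality. -/
theorem lintegral_mul_le_rear (hψ : Continuous ψ) (hφ : Continuous φ) (hψ0 : ∀ y, 0 ≤ ψ y)
    (hφ0 : ∀ y, 0 ≤ φ y) (hb : BddAbove (range ψ)) (hb' : BddAbove (range φ))
    (hf : volume {y | 0 < ψ y} ≠ ⊤) :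
    (∫⁻ y, ENNReal.ofReal (ψ y * φ y)) / 2 ≤
      ∫⁻ x in Ioi (0 : ℝ), ENNReal.ofReal (rear ψ x * rear φ x) := by
  rw [lintegral_mul_eq_lintegral_meas _ hψ.measurable hφ.measurable hψ0 hφ0,
    lintegral_mul_eq_lintegral_meas _ (rear_antitone hb).measurable (rear_antitone hb').measurable
      (rear_nonneg _) (rear_nonneg _), ENNReal.div_eq_inv_mul,
    ← lintegral_const_mul' _ _ (by simp)]
  refine setLIntegral_mono' measurableSet_Ioi fun τ hτ => ?_
  rw [← lintegral_const_mul' _ _ (by simp)]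
  refine setLIntegral_mono' measurableSet_Ioi fun σ hσ => ?_
  have hτ' : (0 : ℝ) ≤ τ := le_of_lt hτ
  have hσ' : (0 : ℝ) ≤ σ := le_of_lt hσ
  rw [volume_rear_inter hb hb' hτ' hσ'
    (measure_ne_top_of_subset (fun y hy => lt_of_le_of_lt hτ' hy) hf), ENNReal.div_eq_inv_mul]
  gcongr
  exact le_min (measure_mono inter_subset_left) (measure_mono inter_subset_right)

theorem lintegral_sq_rear (hψ : Continuous ψ) (hψ0 : ∀ y, 0 ≤ ψ y) (hb : BddAbove (range ψ))
    (hf : volume {y | 0 < ψ y} ≠ ⊤) :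
    ∫⁻ x in Ioi (0 : ℝ), ENNReal.ofReal (rear ψ x * rear ψ x) =
      (∫⁻ y, ENNReal.ofReal (ψ y * ψ y)) / 2 := by
  rw [lintegral_mul_eq_lintegral_meas _ hψ.measurable hψ.measurable hψ0 hψ0,
    lintegral_mul_eq_lintegral_meas _ (rear_antitone hb).measurable (rear_antitone hb).measurable
      (rear_nonneg _) (rear_nonneg _), ENNReal.div_eq_inv_mul,
    ← lintegral_const_mul' _ _ (by simp)]
  refine setLIntegral_congr_fun measurableSet_Ioi fun τ hτ => ?_
  rw [← lintegral_const_mul' _ _ (by simp)]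
  refine setLIntegral_congr_fun measurableSet_Ioi fun σ hσ => ?_
  have hτ' : (0 : ℝ) ≤ τ := le_of_lt hτ
  have hσ' : (0 : ℝ) ≤ σ := le_of_lt hσ
  rw [volume_rear_inter hb hb hτ' hσ'
    (measure_ne_top_of_subset (fun y hy => lt_of_le_of_lt hτ' hy) hf), ENNReal.div_eq_inv_mul]
  congr 1
  rcases le_total τ σ with h | h
  · have hsub : {y | σ < ψ y} ⊆ {y | τ < ψ y} := fun y hy => lt_of_le_of_lt h hy
    rw [inter_eq_self_of_subset_right hsub, min_eq_right (measure_mono hsub)]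
  · have hsub : {y | τ < ψ y} ⊆ {y | σ < ψ y} := fun y hy => lt_of_le_of_lt h hy
    rw [inter_eq_self_of_subset_left hsub, min_eq_left (measure_mono hsub)]

end Rearrangement

section RearrangementIntegral

variable {ψ φ : ℝ → ℝ}

theorem HasCompactSupport.bddAbove_range_real (hc : HasCompactSupport ψ) (hψ : Continuous ψ) :
    BddAbove (range ψ) :=
  hψ.bddAbove_range_of_hasCompactSupport hc

theorem HasCompactSupport.volume_pos_ne_top (hc : HasCompactSupport ψ) :
    volume {y | 0 < ψ y} ≠ ⊤ := by
  refine measure_ne_top_of_subset ?_ (hc.isCompact.measure_lt_top (μ := volume)).ne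
  intro y hy
  exact subset_tsupport _ (ne_of_gt hy)

theorem integrable_mul_of_hasCompactSupport (hψ : Continuous ψ) (hφ : Continuous φ)
    (hc : HasCompactSupport ψ) : Integrable fun y => ψ y * φ y :=
  (hψ.mul hφ).integrable_of_hasCompactSupport hc.mul_right

theorem integrableOn_rear_sq (hψ : Continuous ψ) (hψ0 : ∀ y, 0 ≤ ψ y)
    (hc : HasCompactSupport ψ) :
    IntegrableOn (fun x => rear ψ x * rear ψ x) (Ioi 0) := by
  have hb := hc.bddAbove_range_real hψ
  have hm := (rear_antitone hb).measurable
  refine ⟨(hm.mul hm).aestronglyMeasurable, ?_⟩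
  rw [hasFiniteIntegral_iff_ofReal
    (Filter.Eventually.of_forall fun x => mul_self_nonneg (rear ψ x)),
    lintegral_sq_rear hψ hψ0 hb hc.volume_pos_ne_top,
    ← ofReal_integral_eq_lintegral_ofReal (integrable_mul_of_hasCompactSupport hψ hψ hc)
      (Filter.Eventually.of_forall fun x => mul_self_nonneg (ψ x))]
  exact ENNReal.div_lt_top ENNReal.ofReal_ne_top (by simp)

theorem integrableOn_rear_mul (hψ : Continuous ψ) (hφ : Continuous φ) (hψ0 : ∀ y, 0 ≤ ψ y)
    (hφ0 : ∀ y, 0 ≤ φ y) (hc : HasCompactSupport ψ) (hc' : HasCompactSupport φ) :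
    IntegrableOn (fun x => rear ψ x * rear φ x) (Ioi 0) := by
  have hm := (rear_antitone (hc.bddAbove_range_real hψ)).measurable
  have hm' := (rear_antitone (hc'.bddAbove_range_real hφ)).measurable
  refine ((integrableOn_rear_sq hψ hψ0 hc).add (integrableOn_rear_sq hφ hφ0 hc')).mono'
    (hm.mul hm').aestronglyMeasurable (Filter.Eventually.of_forall fun x => ?_)
  have h1 := rear_nonneg ψ x
  have h2 := rear_nonneg φ x
  simp only [Real.norm_eq_abs, Pi.add_apply]
  rw [abs_of_nonneg (mul_nonneg h1 h2)]
  nlinarith [sq_nonneg (rear ψ x - rear φ x)]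

theorem integral_rear_sq (hψ : Continuous ψ) (hψ0 : ∀ y, 0 ≤ ψ y) (hc : HasCompactSupport ψ) :
    ∫ x in Ioi 0, rear ψ x * rear ψ x = (∫ y, ψ y * ψ y) / 2 := by
  have hb := hc.bddAbove_range_real hψ
  rw [integral_eq_lintegral_of_nonneg_ae
      (Filter.Eventually.of_forall fun x => mul_self_nonneg (rear ψ x))
      (integrableOn_rear_sq hψ hψ0 hc).aestronglyMeasurable,
    lintegral_sq_rear hψ hψ0 hb hc.volume_pos_ne_top,
    integral_eq_lintegral_of_nonneg_ae
      (Filter.Eventually.of_forall fun x => mul_self_nonneg (ψ x))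
      (integrable_mul_of_hasCompactSupport hψ hψ hc).aestronglyMeasurable, ENNReal.toReal_div]
  simp

theorem integral_mul_le_rear (hψ : Continuous ψ) (hφ : Continuous φ) (hψ0 : ∀ y, 0 ≤ ψ y)
    (hφ0 : ∀ y, 0 ≤ φ y) (hc : HasCompactSupport ψ) (hc' : HasCompactSupport φ) :
    (∫ y, ψ y * φ y) / 2 ≤ ∫ x in Ioi 0, rear ψ x * rear φ x := by
  have hb := hc.bddAbove_range_real hψ
  have hb' := hc'.bddAbove_range_real hφ
  have hI := integrableOn_rear_mul hψ hφ hψ0 hφ0 hc hc'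
  have h := lintegral_mul_le_rear hψ hφ hψ0 hφ0 hb hb' hc.volume_pos_ne_top
  have hn : 0 ≤ᵐ[volume.restrict (Ioi 0)] fun x => rear ψ x * rear φ x :=
    Filter.Eventually.of_forall fun x => mul_nonneg (rear_nonneg ψ x) (rear_nonneg φ x)
  rw [integral_eq_lintegral_of_nonneg_ae hn hI.aestronglyMeasurable,
    integral_eq_lintegral_of_nonneg_ae
      (Filter.Eventually.of_forall fun x => mul_nonneg (hψ0 x) (hφ0 x))
      (integrable_mul_of_hasCompactSupport hψ hφ hc).aestronglyMeasurable]
  have hfin : ∫⁻ x in Ioi (0 : ℝ), ENNReal.ofReal (rear ψ x * rear φ x) ≠ ⊤ :=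
    ((hasFiniteIntegral_iff_ofReal hn).1 hI.2).ne
  have := ENNReal.toReal_mono hfin h
  simpa [ENNReal.toReal_div] using this

/-- Rearrangement does not increase `L²` distances. -/
theorem integral_rear_sub_sq_le (hψ : Continuous ψ) (hφ : Continuous φ) (hψ0 : ∀ y, 0 ≤ ψ y)
    (hφ0 : ∀ y, 0 ≤ φ y) (hc : HasCompactSupport ψ) (hc' : HasCompactSupport φ) :
    ∫ x in Ioi 0, (rear ψ x - rear φ x) ^ 2 ≤ (∫ y, (ψ y - φ y) ^ 2) / 2 := by
  have h1 := integrableOn_rear_sq hψ hψ0 hc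
  have h2 := integrableOn_rear_sq hφ hφ0 hc'
  have h12 := integrableOn_rear_mul hψ hφ hψ0 hφ0 hc hc'
  have k1 := integrable_mul_of_hasCompactSupport hψ hψ hc
  have k2 := integrable_mul_of_hasCompactSupport hφ hφ hc'
  have k12 := integrable_mul_of_hasCompactSupport hψ hφ hc
  have h3 : IntegrableOn (fun x => rear ψ x * rear ψ x + rear φ x * rear φ x) (Ioi 0) := h1.add h2
  have k3 : Integrable (fun y => ψ y * ψ y + φ y * φ y) := k1.add k2
  have e1 : ∫ x in Ioi 0, (rear ψ x - rear φ x) ^ 2 =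
      (∫ x in Ioi 0, rear ψ x * rear ψ x) + (∫ x in Ioi 0, rear φ x * rear φ x)
        - 2 * ∫ x in Ioi 0, rear ψ x * rear φ x := by
    rw [← integral_add h1 h2, ← integral_const_mul, ← integral_sub h3 (h12.const_mul 2)]
    exact integral_congr_ae (Filter.Eventually.of_forall fun x => by simp only; ring)
  have e2 : ∫ y, (ψ y - φ y) ^ 2 =
      (∫ y, ψ y * ψ y) + (∫ y, φ y * φ y) - 2 * ∫ y, ψ y * φ y := by
    rw [← integral_add k1 k2, ← integral_const_mul, ← integral_sub k3 (k12.const_mul 2)]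
    exact integral_congr_ae (Filter.Eventually.of_forall fun x => by simp only; ring)
  rw [e1, e2, integral_rear_sq hψ hψ0 hc, integral_rear_sq hφ hφ0 hc']
  linarith [integral_mul_le_rear hψ hφ hψ0 hφ0 hc hc']

end RearrangementIntegral

/-- `|v|` on `[-a, a]`, extended by zero. -/
def cutAbs (a : ℝ) (v : ℝ → ℝ) (y : ℝ) : ℝ := if |y| ≤ a then |v y| else 0

section PolyaSzego

variable {a : ℝ} {v v' : ℝ → ℝ}

theorem cutAbs_nonneg (a : ℝ) (v : ℝ → ℝ) (y : ℝ) : 0 ≤ cutAbs a v y := by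
  unfold cutAbs; split_ifs <;> positivity

theorem cutAbs_of_le {y : ℝ} (h : |y| ≤ a) : cutAbs a v y = |v y| := if_pos h

theorem cutAbs_of_lt {y : ℝ} (h : a < |y|) : cutAbs a v y = 0 := if_neg (not_le.2 h)

theorem continuous_cutAbs (hv : Continuous v) (h1 : v a = 0) (h2 : v (-a) = 0) :
    Continuous (cutAbs a v) := by
  refine continuous_if_le continuous_abs continuous_const hv.abs.continuousOn
    continuousOn_const ?_
  intro y hy
  rcases eq_or_eq_neg_of_abs_eq hy with h | h <;> simp [h, h1, h2]

theorem hasCompactSupport_cutAbs (a : ℝ) (v : ℝ → ℝ) : HasCompactSupport (cutAbs a v) := by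
  refine HasCompactSupport.intro (isCompact_Icc (a := -a) (b := a)) fun y hy => ?_
  apply cutAbs_of_lt
  by_contra! hc
  exact hy (abs_le.1 hc)

theorem cutAbs_eq_zero (h1 : v a = 0) (h2 : v (-a) = 0) {y : ℝ} (h : a ≤ |y|) :
    cutAbs a v y = 0 := by
  rcases h.lt_or_eq with h | h
  · exact cutAbs_of_lt h
  · rw [cutAbs_of_le h.ge]
    rcases eq_or_eq_neg_of_abs_eq h.symm with h | h <;> simp [h, h1, h2]

theorem exists_crossing {f : ℝ → ℝ} {x₀ b w w' : ℝ} (hxb : x₀ ≤ b) (hf : Continuous f)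
    (hw : w ≤ f x₀) (hw' : f b ≤ w') (h : w' < w) :
    ∃ p q, x₀ ≤ p ∧ p < q ∧ q ≤ b ∧ w ≤ f p ∧ f q ≤ w' ∧ ∀ y ∈ Ioo p q, w' < f y ∧ f y < w := by
  have hc1 : IsCompact {y | y ∈ Icc x₀ b ∧ f y ≤ w'} :=
    isCompact_Icc.inter_right (isClosed_le hf continuous_const)
  obtain ⟨q, ⟨hq, hfq⟩, hqmin⟩ := hc1.exists_isLeast ⟨b, ⟨hxb, le_rfl⟩, hw'⟩
  have hc2 : IsCompact {y | y ∈ Icc x₀ q ∧ w ≤ f y} :=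
    isCompact_Icc.inter_right (isClosed_le continuous_const hf)
  obtain ⟨p, ⟨hp, hfp⟩, hpmax⟩ := hc2.exists_isGreatest ⟨x₀, ⟨le_rfl, hq.1⟩, hw⟩
  have hpq : p < q := by
    rcases hp.2.lt_or_eq with h1 | h1
    · exact h1
    · rw [h1] at hfp
      linarith
  refine ⟨p, q, hp.1, hpq, hq.2, hfp, hfq, fun y hy => ⟨?_, ?_⟩⟩
  · by_contra! hc
    exact absurd (hqmin ⟨⟨hp.1.trans hy.1.le, hy.2.le.trans hq.2⟩, hc⟩) (not_le.2 hy.2)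
  · by_contra! hc
    exact absurd (hpmax ⟨⟨hp.1.trans hy.1.le, hy.2.le⟩, hc⟩) (not_le.2 hy.1)

theorem abs_sub_abs_le_integral (hv : ∀ x, HasDerivAt v (v' x) x) (hc : Continuous v') {p q : ℝ}
    (hpq : p ≤ q) : |(|v p| - |v q|)| ≤ ∫ y in Ioo p q, |v' y| := by
  have h1 : ∫ y in p..q, v' y = v q - v p :=
    intervalIntegral.integral_eq_sub_of_hasDerivAt (fun x _ => hv x) (hc.intervalIntegrable _ _)
  have h2 := intervalIntegral.abs_integral_le_integral_abs (f := v') (μ := volume) hpq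
  rw [h1, intervalIntegral.integral_of_le hpq, integral_Ioc_eq_integral_Ioo] at h2
  refine le_trans ?_ h2
  rw [abs_sub_comm (v q)]
  exact abs_abs_sub_abs_le _ _

theorem le_volume_rear_le {ψ : ℝ → ℝ} (hψ : Continuous ψ) (hb : BddAbove (range ψ))
    (hf : volume {y | 0 < ψ y} ≠ ⊤) {x : ℝ} (hx : 0 < rear ψ x) :
    ENNReal.ofReal (2 * x) ≤ volume {y | rear ψ x ≤ ψ y} := by
  obtain ⟨u, hu, hu', hlim⟩ := exists_seq_strictMono_tendsto' hx
  have hU : {y | rear ψ x ≤ ψ y} = ⋂ n, {y | u n < ψ y} := by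
    ext y
    simp only [mem_ofPred_eq, mem_iInter]
    exact ⟨fun h n => (hu' n).2.trans_le h, fun h => le_of_tendsto' hlim fun n => (h n).le⟩
  have hanti : Antitone fun n => {y | u n < ψ y} := fun n m hnm y hy =>
    lt_of_le_of_lt (hu.monotone hnm) hy
  rw [hU, hanti.measure_iInter (fun n => (measurableSet_lt measurable_const
    hψ.measurable).nullMeasurableSet) ⟨0, measure_ne_top_of_subset
      (fun y hy => (hu' 0).1.trans hy) hf⟩]
  exact le_iInf fun n => ((lt_rear_iff hb (hu' n).1.le x).1 (hu' n).2).le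

theorem volume_rear_le {ψ : ℝ → ℝ} (hb : BddAbove (range ψ)) (x : ℝ) :
    volume {y | rear ψ x < ψ y} ≤ ENNReal.ofReal (2 * x) := by
  by_contra! hc
  exact lt_irrefl _ ((lt_rear_iff hb (rear_nonneg ψ x) x).2 hc)

/-- The band between two values of the rearrangement. -/
def rearBand (a : ℝ) (v : ℝ → ℝ) (x x' : ℝ) : Set ℝ :=
  {y | rear (cutAbs a v) x' < cutAbs a v y ∧ cutAbs a v y < rear (cutAbs a v) x}

theorem rearBand_subset (h1 : v a = 0) (h2 : v (-a) = 0) (x x' : ℝ) :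
    rearBand a v x x' ⊆ Icc (-a) a := by
  intro y hy
  rw [mem_Icc, ← abs_le]
  by_contra! hc
  have h := hy.1
  rw [cutAbs_eq_zero h1 h2 hc.le] at h
  exact absurd h (not_lt.2 (rear_nonneg _ _))

theorem measurableSet_rearBand (hv : Continuous v) (h1 : v a = 0) (h2 : v (-a) = 0) (x x' : ℝ) :
    MeasurableSet (rearBand a v x x') := by
  have := (continuous_cutAbs hv h1 h2).measurable
  exact (measurableSet_lt measurable_const this).inter (measurableSet_lt this measurable_const)

theorem volume_rearBand_le (hv : Continuous v) (h1 : v a = 0) (h2 : v (-a) = 0) {x x' : ℝ}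
    (hx : 0 ≤ x) (hxx : x ≤ x') : volume.real (rearBand a v x x') ≤ 2 * (x' - x) := by
  have hψ := continuous_cutAbs hv h1 h2
  have hcs := hasCompactSupport_cutAbs a v
  have hb := hcs.bddAbove_range_real hψ
  rcases (rear_nonneg (cutAbs a v) x).eq_or_lt with h0 | h0
  · have : rearBand a v x x' = ∅ := by
      ext y
      simp only [rearBand, mem_ofPred_eq, mem_empty_iff_false, iff_false, not_and, not_lt]
      intro _
      rw [← h0]
      exact cutAbs_nonneg _ _ _
    rw [this, measureReal_empty]
    linarith
  have hd : Disjoint (rearBand a v x x') {y | rear (cutAbs a v) x ≤ cutAbs a v y} := by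
    rw [Set.disjoint_left]
    intro y hy hy'
    exact absurd hy.2 (not_lt.2 hy')
  have hm := measure_union hd (measurableSet_le measurable_const hψ.measurable) (μ := volume)
  by_cases hww : rear (cutAbs a v) x ≤ rear (cutAbs a v) x'
  · have : rearBand a v x x' = ∅ := by
      ext y
      simp only [rearBand, mem_ofPred_eq, mem_empty_iff_false, iff_false, not_and, not_lt]
      intro hy
      linarith
    rw [this, measureReal_empty]
    linarith
  have hsub : rearBand a v x x' ∪ {y | rear (cutAbs a v) x ≤ cutAbs a v y} ⊆
      {y | rear (cutAbs a v) x' < cutAbs a v y} := by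
    rintro y (hy | hy)
    · exact hy.1
    · exact lt_of_lt_of_le (not_le.1 hww) hy
  have h3 := (measure_mono (μ := volume) hsub).trans (volume_rear_le hb x')
  have h4 := le_volume_rear_le hψ hb hcs.volume_pos_ne_top h0
  rw [hm] at h3
  have h5 : volume (rearBand a v x x') + ENNReal.ofReal (2 * x) ≤ ENNReal.ofReal (2 * x') :=
    (add_le_add_right h4 _).trans h3
  have hfin : volume (rearBand a v x x') ≠ ⊤ :=
    ne_top_of_le_ne_top ENNReal.ofReal_ne_top (le_self_add.trans h5)
  have h6 := ENNReal.toReal_mono ENNReal.ofReal_ne_top h5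
  rw [ENNReal.toReal_add hfin ENNReal.ofReal_ne_top, ENNReal.toReal_ofReal (by linarith),
    ENNReal.toReal_ofReal (by linarith)] at h6
  simp only [Measure.real]
  linarith

theorem two_mul_rear_sub_le_integral (ha : 0 ≤ a) (hv : ∀ x, HasDerivAt v (v' x) x)
    (hc : Continuous v') (h1 : v a = 0) (h2 : v (-a) = 0) {x x' : ℝ}
    (hw : rear (cutAbs a v) x' < rear (cutAbs a v) x) :
    2 * (rear (cutAbs a v) x - rear (cutAbs a v) x') ≤ ∫ y in rearBand a v x x', |v' y| := by
  have hvc : Continuous v := continuous_iff_continuousAt.2 fun x => (hv x).continuousAt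
  have hψ := continuous_cutAbs hvc h1 h2
  have hcs := hasCompactSupport_cutAbs a v
  have hb := hcs.bddAbove_range_real hψ
  have hw0 := rear_nonneg (cutAbs a v) x'
  obtain ⟨x₀, hx₀⟩ : ∃ x₀, rear (cutAbs a v) x ≤ cutAbs a v x₀ := by
    obtain ⟨y₀, hy₀⟩ := hψ.exists_forall_ge_of_hasCompactSupport hcs
    refine ⟨y₀, ?_⟩
    by_contra! hlt
    rw [lt_rear_iff hb (cutAbs_nonneg _ _ _)] at hlt
    have : {y | cutAbs a v y₀ < cutAbs a v y} = ∅ := by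
      ext y
      simpa using hy₀ y
    rw [this, measure_empty] at hlt
    exact not_lt_zero hlt
  have hx₀a : |x₀| ≤ a := by
    by_contra! hlt
    rw [cutAbs_of_lt hlt] at hx₀
    linarith
  rw [abs_le] at hx₀a
  have hzero : ∀ y, |y| = a → cutAbs a v y = 0 := fun y hy => cutAbs_eq_zero h1 h2 hy.ge
  obtain ⟨p, q, hp, hpq, hq, hfp, hfq, hin⟩ := exists_crossing hx₀a.2 hψ hx₀
    ((hzero a (abs_of_nonneg ha)).le.trans hw0) hw
  obtain ⟨p', q', hp', hpq', hq', hfp', hfq', hin'⟩ := exists_crossing (x₀ := -x₀) (b := a)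
    (f := fun y => cutAbs a v (-y)) (by linarith) (hψ.comp continuous_neg) (by simpa using hx₀)
    ((hzero (-a) (by rw [abs_neg, abs_of_nonneg ha])).le.trans hw0) hw
  have hsub : Ioo (-q') (-p') ∪ Ioo p q ⊆ rearBand a v x x' := by
    rintro y (hy | hy)
    · have := hin' (-y) ⟨by linarith [hy.2], by linarith [hy.1]⟩
      simpa [rearBand] using this
    · exact hin y hy
  have hintg : ∀ s ⊆ Icc (-a) a, IntegrableOn (fun y => |v' y|) s := fun s hs =>
    (hc.abs.continuousOn.integrableOn_compact isCompact_Icc).mono_set hs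
  have hd : Disjoint (Ioo (-q') (-p')) (Ioo p q) := by
    rw [Set.disjoint_left]
    intro y hy hy'
    linarith [hy.2, hy'.1]
  have hB := rearBand_subset h1 h2 x x'
  have e1 := setIntegral_union hd measurableSet_Ioo
    (hintg _ ((subset_union_left.trans hsub).trans hB))
    (hintg _ ((subset_union_right.trans hsub).trans hB))
  have e2 : ∫ y in Ioo (-q') (-p') ∪ Ioo p q, |v' y| ≤ ∫ y in rearBand a v x x', |v' y| :=
    setIntegral_mono_set (hintg _ hB) (Filter.Eventually.of_forall fun y => abs_nonneg _)
      (Filter.Eventually.of_forall hsub)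
  have e3 := (le_abs_self _).trans (abs_sub_abs_le_integral hv hc hpq.le)
  have e4 := (neg_le_abs _).trans (abs_sub_abs_le_integral hv hc (neg_le_neg hpq'.le))
  rw [cutAbs_of_le (abs_le.2 ⟨by linarith, by linarith⟩)] at hfp hfq
  rw [cutAbs_of_le (abs_le.2 ⟨by linarith, by linarith⟩)] at hfp' hfq'
  linarith

theorem rear_sub_le_of_band (ha : 0 ≤ a) (hv : ∀ x, HasDerivAt v (v' x) x)
    (hc : Continuous v') (h1 : v a = 0) (h2 : v (-a) = 0) {x x' κ : ℝ} (hx : 0 ≤ x)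
    (hxx : x ≤ x') (hκ : 0 ≤ κ) :
    2 * κ * (rear (cutAbs a v) x - rear (cutAbs a v) x') ≤
      κ ^ 2 * (x' - x) + (∫ y in rearBand a v x x', v' y ^ 2) / 2 := by
  have hvc : Continuous v := continuous_iff_continuousAt.2 fun x => (hv x).continuousAt
  have hS : 0 ≤ ∫ y in rearBand a v x x', v' y ^ 2 :=
    integral_nonneg fun y => sq_nonneg _
  rcases le_or_gt (rear (cutAbs a v) x) (rear (cutAbs a v) x') with h | h
  · have : 2 * κ * (rear (cutAbs a v) x - rear (cutAbs a v) x') ≤ 0 :=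
      mul_nonpos_of_nonneg_of_nonpos (by positivity) (by linarith)
    have := mul_nonneg (sq_nonneg κ) (sub_nonneg.2 hxx)
    linarith
  have hB := rearBand_subset h1 h2 x x'
  have hintg : ∀ f : ℝ → ℝ, Continuous f → IntegrableOn f (rearBand a v x x') := fun f hf =>
    (hf.continuousOn.integrableOn_compact isCompact_Icc).mono_set hB
  have k1 := two_mul_rear_sub_le_integral ha hv hc h1 h2 h
  have k2 : ∫ y in rearBand a v x x', κ * |v' y| ≤
      ∫ y in rearBand a v x x', (κ ^ 2 / 2 + v' y ^ 2 / 2) := by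
    refine integral_mono (hintg _ (by fun_prop)) (hintg _ (by fun_prop)) fun y => ?_
    simp only
    nlinarith [sq_nonneg (κ - |v' y|), sq_abs (v' y)]
  rw [integral_const_mul, integral_add (hintg _ (by fun_prop)) (hintg _ (by fun_prop)),
    setIntegral_const, integral_div, smul_eq_mul] at k2
  have k3 := volume_rearBand_le hvc h1 h2 hx hxx
  have k4 := mul_le_mul_of_nonneg_left k1 hκ
  have k5 := mul_le_mul_of_nonneg_right k3 (show 0 ≤ κ ^ 2 / 2 by positivity)
  nlinarith

/-- The part of the Dirichlet energy of `v` carried by a superlevel set. -/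
def rearEnergy (a : ℝ) (v v' : ℝ → ℝ) (x : ℝ) : ℝ :=
  (∫ y in Icc (-a) a ∩ {y | rear (cutAbs a v) x ≤ cutAbs a v y}, v' y ^ 2) / 2

theorem rearEnergy_nonneg (x : ℝ) : 0 ≤ rearEnergy a v v' x :=
  div_nonneg (integral_nonneg fun y => sq_nonneg _) (by norm_num)

theorem rearEnergy_le (ha : 0 ≤ a) (hc : Continuous v') (x : ℝ) :
    rearEnergy a v v' x ≤ (∫ y in -a..a, v' y ^ 2) / 2 := by
  unfold rearEnergy
  rw [intervalIntegral.integral_of_le (by linarith), ← integral_Icc_eq_integral_Ioc]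
  refine div_le_div_of_nonneg_right ?_ (by norm_num)
  exact setIntegral_mono_set ((hc.pow 2).continuousOn.integrableOn_compact (μ := volume)
    isCompact_Icc)
    (Filter.Eventually.of_forall fun y => sq_nonneg _)
    (Filter.Eventually.of_forall inter_subset_left)

/-- Pólya–Szegő inequality, in incremental form. -/
theorem two_mul_rear_sub_le (ha : 0 ≤ a) (hv : ∀ x, HasDerivAt v (v' x) x)
    (hc : Continuous v') (h1 : v a = 0) (h2 : v (-a) = 0) {x x' κ : ℝ} (hx : 0 ≤ x)
    (hxx : x ≤ x') (hκ : 0 ≤ κ) :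
    2 * κ * (rear (cutAbs a v) x - rear (cutAbs a v) x') ≤
      κ ^ 2 * (x' - x) + (rearEnergy a v v' x' - rearEnergy a v v' x) := by
  refine (rear_sub_le_of_band ha hv hc h1 h2 hx hxx hκ).trans ?_
  have hvc : Continuous v := continuous_iff_continuousAt.2 fun x => (hv x).continuousAt
  have hψ := continuous_cutAbs hvc h1 h2
  have hb := (hasCompactSupport_cutAbs a v).bddAbove_range_real hψ
  have hintg : ∀ s ⊆ Icc (-a) a, IntegrableOn (fun y => v' y ^ 2) s := fun s hs =>
    ((hc.pow 2).continuousOn.integrableOn_compact isCompact_Icc).mono_set hs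
  have hd : Disjoint (rearBand a v x x')
      (Icc (-a) a ∩ {y | rear (cutAbs a v) x ≤ cutAbs a v y}) := by
    rw [Set.disjoint_left]
    intro y hy hy'
    exact absurd hy.2 (not_lt.2 hy'.2)
  have hB := rearBand_subset h1 h2 x x'
  have e1 := setIntegral_union hd
    (measurableSet_Icc.inter (measurableSet_le measurable_const hψ.measurable))
    (hintg _ hB) (hintg _ inter_subset_left)
  have e2 : ∫ y in rearBand a v x x' ∪ Icc (-a) a ∩ {y | rear (cutAbs a v) x ≤ cutAbs a v y},
      v' y ^ 2 ≤ ∫ y in Icc (-a) a ∩ {y | rear (cutAbs a v) x' ≤ cutAbs a v y}, v' y ^ 2 := by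
    refine setIntegral_mono_set (hintg _ inter_subset_left)
      (Filter.Eventually.of_forall fun y => sq_nonneg _) (Filter.Eventually.of_forall ?_)
    rintro y (hy | hy)
    · exact ⟨hB hy, hy.1.le⟩
    · exact ⟨hy.1, (rear_antitone hb hxx).trans hy.2⟩
  unfold rearEnergy
  linarith

theorem rear_sub_le_mul (ha : 0 ≤ a) (hv : ∀ x, HasDerivAt v (v' x) x)
    (hc : Continuous v') (h1 : v a = 0) (h2 : v (-a) = 0) {x x' L : ℝ} (hx : 0 ≤ x)
    (hxx : x ≤ x') (hL : 0 < L) (hvL : ∀ y ∈ Icc (-a) a, |v' y| ≤ L) :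
    rear (cutAbs a v) x - rear (cutAbs a v) x' ≤ L * (x' - x) := by
  have hvc : Continuous v := continuous_iff_continuousAt.2 fun x => (hv x).continuousAt
  have k1 := rear_sub_le_of_band ha hv hc h1 h2 hx hxx hL.le
  have hB := rearBand_subset h1 h2 x x'
  have k2 : ∫ y in rearBand a v x x', v' y ^ 2 ≤ ∫ y in rearBand a v x x', L ^ 2 := by
    refine setIntegral_mono_on
      (((hc.pow 2).continuousOn.integrableOn_compact isCompact_Icc).mono_set hB)
      ((continuous_const.continuousOn.integrableOn_compact (μ := volume)
        isCompact_Icc).mono_set hB)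
      (measurableSet_rearBand hvc h1 h2 _ _) fun y hy => ?_
    rw [← sq_abs]
    exact pow_le_pow_left₀ (abs_nonneg _) (hvL y (hB hy)) 2
  rw [setIntegral_const, smul_eq_mul] at k2
  have k3 := mul_le_mul_of_nonneg_right (volume_rearBand_le hvc h1 h2 hx hxx) (sq_nonneg L)
  have k4 : L * (rear (cutAbs a v) x - rear (cutAbs a v) x') ≤ L * (L * (x' - x)) := by
    nlinarith
  exact le_of_mul_le_mul_left k4 hL

end PolyaSzego

section Increments

theorem sub_le_integral_of_local {φ g : ℝ → ℝ} {a b : ℝ} (hab : a ≤ b)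
    (hg : ContinuousOn g (Icc a b))
    (h : ∀ ε > 0, ∃ δ > 0, ∀ s s', a ≤ s → s ≤ s' → s' ≤ b → s' - s ≤ δ →
      φ s' - φ s ≤ (g s + ε) * (s' - s)) :
    φ b - φ a ≤ ∫ s in a..b, g s := by
  have hII : ∀ {s s'}, a ≤ s → s ≤ s' → s' ≤ b → IntervalIntegrable g volume s s' :=
    fun h1 h2 h3 => (hg.mono (Icc_subset_Icc h1 h3)).intervalIntegrable_of_Icc h2
  have huc := isCompact_Icc.uniformContinuousOn_of_continuous hg
  rw [Metric.uniformContinuousOn_iff_le] at huc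
  have key : ∀ ε > 0, φ b - φ a ≤ (∫ s in a..b, g s) + 2 * ε * (b - a) := by
    intro ε hε
    obtain ⟨δ₁, hδ₁, h1⟩ := h ε hε
    obtain ⟨δ₂, hδ₂, h2⟩ := huc ε hε
    have hδ : 0 < min δ₁ δ₂ := lt_min hδ₁ hδ₂
    have step : ∀ s s', a ≤ s → s ≤ s' → s' ≤ b → s' - s ≤ min δ₁ δ₂ →
        φ s' - φ s ≤ (∫ t in s..s', g t) + 2 * ε * (s' - s) := by
      intro s s' hs hss hs' hd
      have k1 := h1 s s' hs hss hs' (hd.trans (min_le_left _ _))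
      have k2 : ∫ t in s..s', (g s - ε) ≤ ∫ t in s..s', g t := by
        refine intervalIntegral.integral_mono_on hss intervalIntegrable_const
          (hII hs hss hs') fun t ht => ?_
        have := h2 s ⟨hs, hss.trans hs'⟩ t ⟨hs.trans ht.1, ht.2.trans hs'⟩ (by
          rw [Real.dist_eq, abs_sub_comm, abs_of_nonneg (by linarith [ht.1])]
          linarith [ht.2, min_le_right δ₁ δ₂])
        rw [Real.dist_eq] at this
        linarith [le_abs_self (g s - g t)]
      rw [intervalIntegral.integral_const, smul_eq_mul] at k2
      nlinarith
    have iter : ∀ n : ℕ, ∀ s, a ≤ s → s ≤ b → b - s ≤ n * min δ₁ δ₂ →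
        φ b - φ s ≤ (∫ t in s..b, g t) + 2 * ε * (b - s) := by
      intro n
      induction n with
      | zero =>
        intro s _ hsb hd
        have : s = b := by
          simp only [Nat.cast_zero, zero_mul] at hd
          linarith
        simp [this]
      | succ n ih =>
        intro s hs hsb hd
        push_cast at hd
        rcases le_total b (s + min δ₁ δ₂) with hc | hc
        · exact step s b hs hsb le_rfl (by linarith)
        · have k1 := step s (s + min δ₁ δ₂) hs (by linarith) hc (by linarith)
          have k2 := ih (s + min δ₁ δ₂) (by linarith) hc (by linarith)
          have k3 := intervalIntegral.integral_add_adjacent_intervals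
            (hII hs (by linarith) hc) (hII (s := s + min δ₁ δ₂) (by linarith) hc le_rfl)
          linarith
    obtain ⟨n, hn⟩ := exists_nat_ge ((b - a) / min δ₁ δ₂)
    exact iter n a le_rfl hab ((div_le_iff₀ hδ).1 hn)
  by_contra! hc
  rcases hab.eq_or_lt with h0 | h0
  · subst h0
    have := key 1 one_pos
    linarith
  · have := key ((φ b - φ a - ∫ s in a..b, g s) / (4 * (b - a)))
      (div_pos (by linarith) (by linarith))
    have hne : b - a ≠ 0 := by linarith
    have e : 2 * ((φ b - φ a - ∫ s in a..b, g s) / (4 * (b - a))) * (b - a) =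
      (φ b - φ a - ∫ s in a..b, g s) / 2 := by
      field_simp
      ring
    linarith

theorem exists_uniform_deriv {R R' : ℝ → ℝ} {a b : ℝ}
    (hR : ∀ x ∈ Icc a b, HasDerivAt R (R' x) x) (hR' : ContinuousOn R' (Icc a b)) {ε : ℝ}
    (hε : 0 < ε) :
    ∃ δ > 0, ∀ s s', a ≤ s → s ≤ s' → s' ≤ b → s' - s ≤ δ →
      |R s' - R s - R' s * (s' - s)| ≤ ε * (s' - s) := by
  have huc := isCompact_Icc.uniformContinuousOn_of_continuous hR'
  rw [Metric.uniformContinuousOn_iff_le] at huc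
  obtain ⟨δ, hδ, h⟩ := huc ε hε
  refine ⟨δ, hδ, fun s s' hs hss hs' hd => ?_⟩
  have := (convex_Icc s s').norm_image_sub_le_of_norm_hasDerivWithin_le
    (f := fun x => R x - R' s * x) (f' := fun x => R' x - R' s) (C := ε) (x := s) (y := s')
    (fun x hx => by
      have := (hR x ⟨hs.trans hx.1, hx.2.trans hs'⟩).sub ((hasDerivAt_id x).const_mul (R' s))
      rw [mul_one] at this
      exact this.hasDerivWithinAt)
    (fun x hx => by
      have := h x ⟨hs.trans hx.1, hx.2.trans hs'⟩ s ⟨hs, hss.trans hs'⟩ (by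
        rw [Real.dist_eq, abs_of_nonneg (by linarith [hx.1])]
        linarith [hx.2])
      rwa [Real.dist_eq] at this)
    ⟨le_rfl, hss⟩ ⟨hss, le_rfl⟩
  rw [Real.norm_eq_abs, Real.norm_eq_abs, abs_of_nonneg (sub_nonneg.2 hss)] at this
  convert this using 2
  ring

theorem exists_abs_le_of_continuousOn {f : ℝ → ℝ} {a b : ℝ} (hf : ContinuousOn f (Icc a b)) :
    ∃ B > 0, ∀ x ∈ Icc a b, |f x| ≤ B := by
  obtain ⟨B, hB⟩ := isCompact_Icc.exists_bound_of_continuousOn hf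
  exact ⟨max B 1, by positivity, fun x hx => (hB x hx).trans (le_max_left _ _)⟩

theorem neg_integral_rear_le {a : ℝ} {v v' R R' : ℝ → ℝ} (ha : 0 ≤ a)
    (hv : ∀ x, HasDerivAt v (v' x) x) (hc : Continuous v') (h1 : v a = 0) (h2 : v (-a) = 0)
    (hR : ∀ x ∈ Icc 0 a, HasDerivAt R (R' x) x) (hR' : ContinuousOn R' (Icc 0 a))
    (hR0 : R 0 = 0) (hRn : ∀ x ∈ Icc 0 a, R x ≤ 0) :
    -∫ x in 0..a, (R' x + R x ^ 2) * rear (cutAbs a v) x ^ 2 ≤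
      (∫ y in -a..a, v' y ^ 2) / 2 := by
  have hvc : Continuous v := continuous_iff_continuousAt.2 fun x => (hv x).continuousAt
  have hψ := continuous_cutAbs hvc h1 h2
  have hb := (hasCompactSupport_cutAbs a v).bddAbove_range_real hψ
  have hanti := rear_antitone hb
  have hn := rear_nonneg (cutAbs a v)
  set w := rear (cutAbs a v) with hw
  have hRc : ContinuousOn R (Icc 0 a) := fun x hx => (hR x hx).continuousAt.continuousWithinAt
  have hwc : ContinuousOn w (Icc 0 a) := by
    obtain ⟨L, hL, hvL⟩ := exists_abs_le_of_continuousOn (a := -a) (b := a) hc.continuousOn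
    have : LipschitzOnWith L.toNNReal w (Icc 0 a) := by
      refine LipschitzOnWith.of_le_add_mul' L fun x hx y hy => ?_
      rcases le_total x y with hxy | hxy
      · have := rear_sub_le_mul ha hv hc h1 h2 hx.1 hxy hL hvL
        rw [Real.dist_eq, abs_sub_comm, abs_of_nonneg (sub_nonneg.2 hxy)]
        linarith
      · have := hanti hxy
        have := mul_nonneg hL.le (dist_nonneg (x := x) (y := y))
        linarith
    exact this.continuousOn
  have hg : ContinuousOn (fun x => (R' x + R x ^ 2) * w x ^ 2) (Icc 0 a) :=
    (hR'.add (hRc.pow 2)).mul (hwc.pow 2)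
  have main := sub_le_integral_of_local (φ := fun x => R x * w x ^ 2 - rearEnergy a v v' x) ha hg ?_
  · have e1 : w a = 0 := rear_eq_zero (fun y hy => (cutAbs_eq_zero h1 h2 hy).le) le_rfl
    have e2 := rearEnergy_le (v := v) ha hc a
    have e3 := rearEnergy_nonneg (a := a) (v := v) (v' := v') 0
    simp only [e1, hR0] at main
    linarith
  intro ε hε
  have hη : 0 < ε / (2 * w 0 ^ 2 + 1) := by positivity
  obtain ⟨δ₁, hδ₁, k1⟩ := exists_uniform_deriv hR hR' hη
  have huc := isCompact_Icc.uniformContinuousOn_of_continuous (hRc.pow 2)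
  rw [Metric.uniformContinuousOn_iff_le] at huc
  obtain ⟨δ₂, hδ₂, k2⟩ := huc _ hη
  refine ⟨min δ₁ δ₂, lt_min hδ₁ hδ₂, fun x x' hx hxx hx' hd => ?_⟩
  have l1 := (le_abs_self _).trans (k1 x x' hx hxx hx' (hd.trans (min_le_left _ _)))
  have l2 := k2 x' ⟨hx.trans hxx, hx'⟩ x ⟨hx, hxx.trans hx'⟩ (by
    rw [Real.dist_eq, abs_of_nonneg (sub_nonneg.2 hxx)]
    exact hd.trans (min_le_right _ _))
  rw [Real.dist_eq] at l2
  have l2 := (le_abs_self _).trans l2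
  have hρ := hRn x' ⟨hx.trans hxx, hx'⟩
  have l3 := two_mul_rear_sub_le ha hv hc h1 h2 hx hxx
    (mul_nonneg (neg_nonneg.2 hρ) (hn x))
  rw [← hw] at l3
  have hww := hanti hxx
  have hw0 := hanti hx
  have l4 : R x' * (w x' ^ 2 - w x ^ 2) ≤ 2 * (-R x' * w x) * (w x - w x') := by
    have : 0 ≤ -R x' * ((w x - w x') * (w x - w x')) := by
      have := mul_self_nonneg (w x - w x')
      nlinarith
    nlinarith
  have hsq : w x ^ 2 ≤ w 0 ^ 2 := pow_le_pow_left₀ (hn x) hw0 2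
  have hΔ : 0 ≤ x' - x := sub_nonneg.2 hxx
  have l5 := mul_le_mul_of_nonneg_right l1 (sq_nonneg (w x))
  have l6 := mul_le_mul_of_nonneg_right l2 (mul_nonneg (sq_nonneg (w x)) hΔ)
  have l7 : 2 * (ε / (2 * w 0 ^ 2 + 1)) * w x ^ 2 ≤ ε := by
    calc 2 * (ε / (2 * w 0 ^ 2 + 1)) * w x ^ 2 ≤ 2 * (ε / (2 * w 0 ^ 2 + 1)) * w 0 ^ 2 := by
          gcongr
      _ = ε * (2 * w 0 ^ 2 / (2 * w 0 ^ 2 + 1)) := by ring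
      _ ≤ ε * 1 := by
          gcongr
          rw [div_le_one (by positivity)]
          linarith
      _ = ε := mul_one _
  have l8 := mul_le_mul_of_nonneg_right l7 hΔ
  simp only [Pi.pow_apply] at l6
  set η := ε / (2 * w 0 ^ 2 + 1)
  calc R x' * w x' ^ 2 - rearEnergy a v v' x' - (R x * w x ^ 2 - rearEnergy a v v' x)
      = (R x' - R x - R' x * (x' - x)) * w x ^ 2 + R' x * w x ^ 2 * (x' - x)
        + R x' * (w x' ^ 2 - w x ^ 2) - (rearEnergy a v v' x' - rearEnergy a v v' x) := by ring
    _ ≤ ((R' x + R x ^ 2) * w x ^ 2 + ε) * (x' - x) := by nlinarith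

end Increments

/-- `v` is a `C¹` function with partial derivatives `vx`, `vs`, vanishing on the two sides
`x = ± s` of the triangle `|x| < s < 1`. -/
structure WedgeFun (v vx vs : ℝ → ℝ → ℝ) : Prop where
  deriv : ∀ x s, HasFDerivAt (fun p : ℝ × ℝ => v p.1 p.2)
    (vx x s • ContinuousLinearMap.fst ℝ ℝ ℝ + vs x s • ContinuousLinearMap.snd ℝ ℝ ℝ) (x, s)
  cont_x : Continuous fun p : ℝ × ℝ => vx p.1 p.2
  cont_s : Continuous fun p : ℝ × ℝ => vs p.1 p.2
  right : ∀ s ∈ Icc (0 : ℝ) 1, v s s = 0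
  left : ∀ s ∈ Icc (0 : ℝ) 1, v (-s) s = 0

namespace WedgeFun

variable {v vx vs : ℝ → ℝ → ℝ} (hv : WedgeFun v vx vs)
include hv

theorem cont : Continuous fun p : ℝ × ℝ => v p.1 p.2 :=
  continuous_iff_continuousAt.2 fun p => (hv.deriv p.1 p.2).continuousAt

theorem line (t x s θ : ℝ) :
    HasDerivAt (fun θ => v (x + t * θ) (s + θ)) (vs (x + t * θ) (s + θ) + t * vx (x + t * θ) (s + θ))
      θ := by
  have h1 : HasDerivAt (fun θ : ℝ => (x + t * θ, s + θ)) (t, 1) θ := by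
    refine HasDerivAt.prodMk ?_ ((hasDerivAt_id θ).const_add s)
    simpa using ((hasDerivAt_id θ).const_mul t).const_add x
  have := (hv.deriv (x + t * θ) (s + θ)).comp_hasDerivAt θ h1
  simp at this
  rw [add_comm (vs _ _), mul_comm t (vx _ _)]
  exact this

theorem dx (x s : ℝ) : HasDerivAt (fun x => v x s) (vx x s) x := by
  have h1 : HasDerivAt (fun x : ℝ => (x, s)) (1, 0) x :=
    (hasDerivAt_id x).prodMk (hasDerivAt_const x s)
  have := (hv.deriv x s).comp_hasDerivAt x h1
  simp at this
  exact this

theorem ds (x s : ℝ) : HasDerivAt (fun s => v x s) (vs x s) s := by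
  have h1 : HasDerivAt (fun s : ℝ => (x, s)) (0, 1) s :=
    (hasDerivAt_const s x).prodMk (hasDerivAt_id s)
  have := (hv.deriv x s).comp_hasDerivAt s h1
  simp at this
  exact this

theorem cont_slice (s : ℝ) : Continuous fun x => v x s :=
  hv.cont.comp (by fun_prop : Continuous fun x : ℝ => (x, s))

theorem cont_slice_x (s : ℝ) : Continuous fun x => vx x s :=
  hv.cont_x.comp (by fun_prop : Continuous fun x : ℝ => (x, s))

theorem zero_abs {z : ℝ} (hz : |z| ≤ 1) : v z |z| = 0 := by
  rcases le_total 0 z with h | h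
  · rw [abs_of_nonneg h] at hz ⊢
    exact hv.right z ⟨h, hz⟩
  · rw [abs_of_nonpos h] at hz ⊢
    simpa using hv.left (-z) ⟨by linarith, hz⟩

theorem exists_bound : ∃ L > 0, ∀ x s, |x| ≤ 1 → s ∈ Icc (0 : ℝ) 1 →
    |vx x s| ≤ L ∧ |vs x s| ≤ L := by
  have hK : IsCompact (Icc (-1 : ℝ) 1 ×ˢ Icc (0 : ℝ) 1) := isCompact_Icc.prod isCompact_Icc
  obtain ⟨B₁, h1⟩ := hK.exists_bound_of_continuousOn hv.cont_x.continuousOn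
  obtain ⟨B₂, h2⟩ := hK.exists_bound_of_continuousOn hv.cont_s.continuousOn
  refine ⟨max (max B₁ B₂) 1, by positivity, fun x s hx hs => ⟨?_, ?_⟩⟩
  · exact (h1 (x, s) ⟨abs_le.1 hx, hs⟩).trans ((le_max_left _ _).trans (le_max_left _ _))
  · exact (h2 (x, s) ⟨abs_le.1 hx, hs⟩).trans ((le_max_right _ _).trans (le_max_left _ _))

omit hv in
theorem _root_.abs_sub_le_of_deriv {f f' : ℝ → ℝ} {a b C x y : ℝ}
    (hf : ∀ z ∈ Icc a b, HasDerivAt f (f' z) z)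
    (hC : ∀ z ∈ Icc a b, |f' z| ≤ C) (hx : x ∈ Icc a b) (hy : y ∈ Icc a b) :
    |f y - f x| ≤ C * |y - x| :=
  (convex_Icc a b).norm_image_sub_le_of_norm_hasDerivWithin_le
    (fun z hz => (hf z hz).hasDerivWithinAt) hC hx hy

theorem lipschitz {L : ℝ}
    (hL : ∀ x s, |x| ≤ 1 → s ∈ Icc (0 : ℝ) 1 → |vx x s| ≤ L ∧ |vs x s| ≤ L) {x x' s s' : ℝ}
    (hx : |x| ≤ 1) (hx' : |x'| ≤ 1) (hs : s ∈ Icc (0 : ℝ) 1) (hs' : s' ∈ Icc (0 : ℝ) 1) :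
    |v x' s' - v x s| ≤ L * (|x' - x| + |s' - s|) := by
  have h1 := abs_sub_le_of_deriv (fun z _ => hv.dx z s)
    (fun z hz => (hL z s (abs_le.2 hz) hs).1) (abs_le.1 hx) (abs_le.1 hx')
  have h2 := abs_sub_le_of_deriv (fun z _ => hv.ds x' z)
    (fun z hz => (hL x' z hx' hz).2) hs hs'
  calc |v x' s' - v x s| ≤ |v x' s' - v x' s| + |v x' s - v x s| := abs_sub_le _ _ _
    _ ≤ L * (|x' - x| + |s' - s|) := by linarith

theorem cutAbs_eq {s : ℝ} (hs : s ∈ Icc (0 : ℝ) 1) (y : ℝ) :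
    cutAbs s (fun x => v x s) y =
      |v (max (-1) (min y 1)) (max s |max (-1) (min y 1)|)| := by
  rcases le_or_gt |y| s with h | h
  · have hy := abs_le.1 (h.trans hs.2)
    rw [cutAbs_of_le h, min_eq_left hy.2, max_eq_right hy.1, max_eq_left h]
  · have hc : |max (-1) (min y 1)| ≤ 1 :=
      abs_le.2 ⟨le_max_left _ _, max_le (by norm_num) (min_le_right _ _)⟩
    have hsc : s ≤ |max (-1) (min y 1)| := by
      have := hs.2
      rcases le_total y 1 with h1 | h1
      · rcases le_total (-1) y with h2 | h2
        · rw [min_eq_left h1, max_eq_right h2]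
          exact h.le
        · rw [min_eq_left h1, max_eq_left h2]
          simpa using this
      · rw [min_eq_right h1, max_eq_right (by norm_num)]
        simpa using this
    rw [cutAbs_of_lt h, max_eq_right hsc, hv.zero_abs hc, abs_zero]

theorem cutAbs_lipschitz {L : ℝ} (hL0 : 0 ≤ L)
    (hL : ∀ x s, |x| ≤ 1 → s ∈ Icc (0 : ℝ) 1 → |vx x s| ≤ L ∧ |vs x s| ≤ L) {s s' : ℝ}
    (hs : s ∈ Icc (0 : ℝ) 1) (hs' : s' ∈ Icc (0 : ℝ) 1) (y y' : ℝ) :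
    |cutAbs s' (fun x => v x s') y' - cutAbs s (fun x => v x s) y| ≤
      L * (2 * |y' - y| + |s' - s|) := by
  rw [hv.cutAbs_eq hs, hv.cutAbs_eq hs']
  have hc : ∀ y : ℝ, |max (-1) (min y 1)| ≤ 1 := fun y =>
    abs_le.2 ⟨le_max_left _ _, max_le (by norm_num) (min_le_right _ _)⟩
  have hm : ∀ s ∈ Icc (0 : ℝ) 1, ∀ y : ℝ, max s |max (-1) (min y 1)| ∈ Icc (0 : ℝ) 1 :=
    fun s hs y => ⟨hs.1.trans (le_max_left _ _), max_le hs.2 (hc y)⟩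
  refine (abs_abs_sub_abs_le _ _).trans ((hv.lipschitz hL (hc y) (hc y') (hm s hs y)
    (hm s' hs' y')).trans (mul_le_mul_of_nonneg_left ?_ hL0))
  have h1 : |max (-1) (min y' 1) - max (-1) (min y 1)| ≤ |y' - y| := by
    rw [max_comm, max_comm (-1)]
    refine (abs_max_sub_max_le_abs _ _ _).trans ?_
    simpa using abs_min_sub_min_le_max y' 1 y 1
  have h2 := abs_max_sub_max_le_max s' |max (-1) (min y' 1)| s |max (-1) (min y 1)|
  have h3 := abs_abs_sub_abs_le (max (-1) (min y' 1)) (max (-1) (min y 1))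
  have h4 : max |s' - s| |(|max (-1) (min y' 1)| - |max (-1) (min y 1)|)| ≤ |s' - s| + |y' - y| :=
    max_le (le_add_of_nonneg_right (abs_nonneg _))
      ((h3.trans h1).trans (le_add_of_nonneg_left (abs_nonneg _)))
  linarith

theorem continuous_cut {s : ℝ} (hs : s ∈ Icc (0 : ℝ) 1) :
    Continuous (cutAbs s fun x => v x s) :=
  continuous_cutAbs (hv.cont_slice s) (hv.right s hs) (hv.left s hs)

theorem bddAbove_cut {s : ℝ} (hs : s ∈ Icc (0 : ℝ) 1) :
    BddAbove (range (cutAbs s fun x => v x s)) :=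
  (hasCompactSupport_cutAbs _ _).bddAbove_range_real (hv.continuous_cut hs)

end WedgeFun

/-- Slicewise rearrangement of `|v|`. -/
def sliceRear (v : ℝ → ℝ → ℝ) (x s : ℝ) : ℝ := rear (cutAbs s fun y => v y s) x

namespace WedgeFun

variable {v vx vs : ℝ → ℝ → ℝ} (hv : WedgeFun v vx vs)
include hv

theorem sliceRear_antitone {s : ℝ} (hs : s ∈ Icc (0 : ℝ) 1) : Antitone fun x => sliceRear v x s :=
  rear_antitone (hv.bddAbove_cut hs)

theorem sliceRear_eq_zero {s x : ℝ} (hs : s ∈ Icc (0 : ℝ) 1) (h : s ≤ x) :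
    sliceRear v x s = 0 :=
  rear_eq_zero (fun _ hy => (cutAbs_eq_zero (v := fun y => v y s) (hv.right s hs) (hv.left s hs) hy).le) h

theorem abs_sliceRear_sub_le_s {L : ℝ} (hL0 : 0 ≤ L)
    (hL : ∀ x s, |x| ≤ 1 → s ∈ Icc (0 : ℝ) 1 → |vx x s| ≤ L ∧ |vs x s| ≤ L) {s s' : ℝ}
    (hs : s ∈ Icc (0 : ℝ) 1) (hs' : s' ∈ Icc (0 : ℝ) 1) (x : ℝ) :
    |sliceRear v x s' - sliceRear v x s| ≤ L * |s' - s| := by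
  have key : ∀ y, |cutAbs s' (fun x => v x s') y - cutAbs s (fun x => v x s) y| ≤ L * |s' - s| := by
    intro y
    simpa using hv.cutAbs_lipschitz hL0 hL hs hs' y y
  have hn : 0 ≤ L * |s' - s| := by positivity
  have h1 := rear_le_add (hv.bddAbove_cut hs') (hv.bddAbove_cut hs) hn
    (fun y => by linarith [(abs_le.1 (key y)).2]) x
  have h2 := rear_le_add (hv.bddAbove_cut hs) (hv.bddAbove_cut hs') hn
    (fun y => by linarith [(abs_le.1 (key y)).1]) x
  unfold sliceRear
  rw [abs_le]
  constructor <;> linarith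

theorem abs_sliceRear_sub_le_x {L : ℝ} (hL0 : 0 < L)
    (hL : ∀ x s, |x| ≤ 1 → s ∈ Icc (0 : ℝ) 1 → |vx x s| ≤ L ∧ |vs x s| ≤ L) {s : ℝ}
    (hs : s ∈ Icc (0 : ℝ) 1) {x x' : ℝ} (hx : 0 ≤ x) (hx' : 0 ≤ x') :
    |sliceRear v x' s - sliceRear v x s| ≤ L * |x' - x| := by
  have key : ∀ x x', 0 ≤ x → x ≤ x' → |sliceRear v x' s - sliceRear v x s| ≤ L * |x' - x| := by
    intro x x' hx hxx
    have h1 := rear_sub_le_mul hs.1 (fun x => hv.dx x s) (hv.cont_slice_x s) (hv.right s hs)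
      (hv.left s hs) hx hxx hL0 (fun y hy => (hL y s (abs_le.2
        ⟨by linarith [hy.1, hs.2], by linarith [hy.2, hs.2]⟩) hs).1)
    have h2 := hv.sliceRear_antitone hs hxx
    simp only at h2
    rw [abs_of_nonpos (by linarith), abs_of_nonneg (by linarith)]
    unfold sliceRear at h2 ⊢
    linarith
  rcases le_total x x' with h | h
  · exact key x x' hx h
  · rw [abs_sub_comm, abs_sub_comm x']
    exact key x' x hx' h

/-- The rearrangement, extended continuously to the whole plane. -/
theorem continuous_sliceRear :
    Continuous fun p : ℝ × ℝ => sliceRear v (max 0 p.1) (max 0 (min p.2 1)) := by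
  obtain ⟨L, hL0, hL⟩ := hv.exists_bound
  have hm : ∀ s : ℝ, max 0 (min s 1) ∈ Icc (0 : ℝ) 1 := fun s =>
    ⟨le_max_left _ _, max_le zero_le_one (min_le_right _ _)⟩
  have hlip : LipschitzWith (2 * L).toNNReal
      fun p : ℝ × ℝ => sliceRear v (max 0 p.1) (max 0 (min p.2 1)) := by
    refine LipschitzWith.of_dist_le_mul fun p q => ?_
    rw [Real.coe_toNNReal _ (by positivity), Real.dist_eq]
    have h1 := hv.abs_sliceRear_sub_le_s hL0.le hL (hm q.2) (hm p.2) (max 0 p.1)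
    have h2 := hv.abs_sliceRear_sub_le_x hL0 hL (hm q.2) (le_max_left 0 q.1) (le_max_left 0 p.1)
    have h3 : |max 0 (min p.2 1) - max 0 (min q.2 1)| ≤ dist p q := by
      rw [max_comm, max_comm 0]
      refine (abs_max_sub_max_le_abs _ _ _).trans ((abs_min_sub_min_le_max p.2 1 q.2 1).trans ?_)
      rw [sub_self, abs_zero, max_eq_left (abs_nonneg _)]
      rw [← Real.dist_eq]
      exact le_max_right _ _
    have h4 : |max 0 p.1 - max 0 q.1| ≤ dist p q := by
      rw [max_comm, max_comm 0]
      refine (abs_max_sub_max_le_abs _ _ _).trans ?_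
      rw [← Real.dist_eq]
      exact le_max_left _ _
    have h5 := mul_le_mul_of_nonneg_left h3 hL0.le
    have h6 := mul_le_mul_of_nonneg_left h4 hL0.le
    refine (abs_sub_le _ (sliceRear v (max 0 p.1) (max 0 (min q.2 1))) _).trans ?_
    linarith
  exact hlip.continuous

end WedgeFun

/-- Slicewise rearrangement of `|v|`, extended continuously to the whole plane. -/
def wedgeRear (v : ℝ → ℝ → ℝ) (x s : ℝ) : ℝ := sliceRear v (max 0 x) (max 0 (min s 1))

theorem wedgeRear_eq (v : ℝ → ℝ → ℝ) {x s : ℝ} (hx : 0 ≤ x) (hs : s ∈ Icc (0 : ℝ) 1) :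
    wedgeRear v x s = rear (cutAbs s fun y => v y s) x := by
  rw [wedgeRear, sliceRear, max_eq_right hx, min_eq_left hs.2, max_eq_right hs.1]

theorem exists_uniform_of_continuous {F : ℝ × ℝ × ℝ → ℝ} (hF : Continuous F) {ε : ℝ} (hε : 0 < ε) :
    ∃ δ > 0, ∀ x s s', x ∈ Icc (0 : ℝ) 1 → s ∈ Icc (0 : ℝ) 1 → s' ∈ Icc (0 : ℝ) 1 →
      |s' - s| ≤ δ → |F (x, s, s') - F (x, s, s)| ≤ ε := by
  have huc := (isCompact_Icc.prod (isCompact_Icc.prod isCompact_Icc) : IsCompact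
    (Icc (0 : ℝ) 1 ×ˢ Icc (0 : ℝ) 1 ×ˢ Icc (0 : ℝ) 1)).uniformContinuousOn_of_continuous
    hF.continuousOn
  rw [Metric.uniformContinuousOn_iff_le] at huc
  obtain ⟨δ, hδ, h⟩ := huc ε hε
  refine ⟨δ, hδ, fun x s s' hx hs hs' hd => ?_⟩
  refine h (x, s, s') ⟨hx, hs, hs'⟩ (x, s, s) ⟨hx, hs, hs⟩ ?_
  simpa [Prod.dist_eq, Real.dist_eq, hδ.le] using hd

theorem continuous_integral_symm {f : ℝ → ℝ → ℝ} (hf : Continuous fun p : ℝ × ℝ => f p.1 p.2) :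
    Continuous fun s => ∫ y in -s..s, f y s := by
  have hc : Continuous (Function.uncurry fun s y => f y s) := hf.comp continuous_swap
  have e : (fun s => ∫ y in -s..s, f y s) =
      fun s => (∫ y in (0 : ℝ)..s, f y s) - ∫ y in (0 : ℝ)..-s, f y s := by
    funext s
    have hi : ∀ a b, IntervalIntegrable (fun y => f y s) volume a b := fun a b =>
      (hf.comp (by fun_prop : Continuous fun y : ℝ => (y, s))).intervalIntegrable a b
    rw [intervalIntegral.integral_interval_sub_left (hi _ _) (hi _ _)]
  rw [e]
  exact (intervalIntegral.continuous_parametric_intervalIntegral_of_continuous hc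
    continuous_id).sub (intervalIntegral.continuous_parametric_intervalIntegral_of_continuous hc
    continuous_neg)

theorem continuous_integral_unit {f : ℝ → ℝ → ℝ} (hf : Continuous fun p : ℝ × ℝ => f p.1 p.2) :
    Continuous fun s => ∫ x in (0 : ℝ)..1, f x s :=
  intervalIntegral.continuous_parametric_intervalIntegral_of_continuous
    (f := fun s x => f x s) (hf.comp continuous_swap) continuous_const

namespace WedgeFun

variable {v vx vs : ℝ → ℝ → ℝ} (hv : WedgeFun v vx vs)
include hv

theorem continuous_wedgeRear : Continuous fun p : ℝ × ℝ => wedgeRear v p.1 p.2 :=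
  hv.continuous_sliceRear

theorem wedgeRear_eq_zero {s x : ℝ} (hs : s ∈ Icc (0 : ℝ) 1) (h : s ≤ x) :
    wedgeRear v x s = 0 := by
  rw [wedgeRear_eq v (hs.1.trans h) hs]
  exact hv.sliceRear_eq_zero hs h

theorem abs_cutAbs_shift_le {t ε s h y : ℝ} (hs : 0 ≤ s) (hh : 0 ≤ h) (hsh : s + h ≤ 1)
    (hD : ∀ y s y' s', |y| ≤ 1 → s ∈ Icc (0 : ℝ) 1 → |y'| ≤ 1 → s' ∈ Icc (0 : ℝ) 1 →
      |y' - y| ≤ |t| * h → |s' - s| ≤ h →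
      |(vs y' s' + t * vx y' s') - (vs y s + t * vx y s)| ≤ ε)
    (h1 : |y| ≤ s) (h2 : |y + t * h| ≤ s + h) :
    |cutAbs (s + h) (fun x => v x (s + h)) (y + t * h) - cutAbs s (fun x => v x s) y| ≤
      (|vs y s + t * vx y s| + ε) * h := by
  rw [cutAbs_of_le h1, cutAbs_of_le h2]
  refine (abs_abs_sub_abs_le _ _).trans ?_
  have := abs_sub_le_of_deriv (f := fun θ => v (y + t * θ) (s + θ)) (a := 0) (b := h)
    (x := 0) (y := h) (C := |vs y s + t * vx y s| + ε)
    (fun θ _ => hv.line t y s θ) (fun θ hθ => ?_) ⟨le_rfl, hh⟩ ⟨hh, le_rfl⟩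
  · simpa [abs_of_nonneg hh] using this
  · have k1 : |y + t * θ| ≤ 1 := by
      rw [abs_le] at h1 h2 ⊢
      rcases le_total 0 t with ht | ht
      · have := mul_le_mul_of_nonneg_left hθ.2 ht
        have := mul_nonneg ht hθ.1
        constructor <;> linarith
      · have := mul_le_mul_of_nonpos_left hθ.2 ht
        have := mul_nonpos_of_nonpos_of_nonneg ht hθ.1
        constructor <;> linarith
    have := hD y s (y + t * θ) (s + θ) (h1.trans (by linarith)) ⟨hs, by linarith⟩ k1
      ⟨by linarith [hθ.1], by linarith [hθ.2]⟩
      (by rw [add_sub_cancel_left, abs_mul, abs_of_nonneg hθ.1]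
          exact mul_le_mul_of_nonneg_left hθ.2 (abs_nonneg t))
      (by rw [add_sub_cancel_left, abs_of_nonneg hθ.1]; exact hθ.2)
    have k2 := abs_sub_abs_le_abs_sub (vs (y + t * θ) (s + θ) + t * vx (y + t * θ) (s + θ))
      (vs y s + t * vx y s)
    linarith

theorem cutAbs_shift_sq_le {t ε s h L : ℝ} (hs : 0 ≤ s) (hh : 0 ≤ h) (hsh : s + h ≤ 1)
    (hL0 : 0 ≤ L)
    (hL : ∀ x s, |x| ≤ 1 → s ∈ Icc (0 : ℝ) 1 → |vx x s| ≤ L ∧ |vs x s| ≤ L)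
    (hD : ∀ y s y' s', |y| ≤ 1 → s ∈ Icc (0 : ℝ) 1 → |y'| ≤ 1 → s' ∈ Icc (0 : ℝ) 1 →
      |y' - y| ≤ |t| * h → |s' - s| ≤ h →
      |(vs y' s' + t * vx y' s') - (vs y s + t * vx y s)| ≤ ε) (y : ℝ) :
    (cutAbs (s + h) (fun x => v x (s + h)) (y + t * h) - cutAbs s (fun x => v x s) y) ^ 2 ≤
      (Icc (-s) s).indicator (fun y => (|vs y s + t * vx y s| + ε) ^ 2 * h ^ 2) y +
      ((Icc (s - (1 + |t|) * h) (s + (1 + |t|) * h)).indicator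
        (fun _ => (L * (2 * |t| + 1)) ^ 2 * h ^ 2) y +
      (Icc (-s - (1 + |t|) * h) (-s + (1 + |t|) * h)).indicator
        (fun _ => (L * (2 * |t| + 1)) ^ 2 * h ^ 2) y) := by
  have hs1 : s ∈ Icc (0 : ℝ) 1 := ⟨hs, by linarith⟩
  have hs2 : s + h ∈ Icc (0 : ℝ) 1 := ⟨by linarith, hsh⟩
  have n1 : ∀ y, 0 ≤ (Icc (-s) s).indicator
      (fun y => (|vs y s + t * vx y s| + ε) ^ 2 * h ^ 2) y :=
    fun y => indicator_nonneg (fun _ _ => by positivity) y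
  have n2 : ∀ a b y : ℝ, 0 ≤ (Icc a b).indicator (fun _ => (L * (2 * |t| + 1)) ^ 2 * h ^ 2) y :=
    fun a b y => indicator_nonneg (s := Icc a b)
      (f := fun _ => (L * (2 * |t| + 1)) ^ 2 * h ^ 2) (fun _ _ => by positivity) y
  have hth : |t * h| = |t| * h := by rw [abs_mul, abs_of_nonneg hh]
  have hth' := abs_le.1 hth.le
  by_cases hA : |y| ≤ s - (1 + |t|) * h
  · have hn : 0 ≤ (1 + |t|) * h := by positivity
    have h1 : |y| ≤ s := by linarith
    have h2 : |y + t * h| ≤ s + h := by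
      have := abs_add_le y (t * h)
      linarith
    have := hv.abs_cutAbs_shift_le hs hh hsh hD h1 h2
    rw [indicator_of_mem (show y ∈ Icc (-s) s from abs_le.1 h1)]
    have k := pow_le_pow_left₀ (abs_nonneg _) this 2
    rw [sq_abs, mul_pow] at k
    linarith [n2 (s - (1 + |t|) * h) (s + (1 + |t|) * h) y,
      n2 (-s - (1 + |t|) * h) (-s + (1 + |t|) * h) y]
  · rw [not_le] at hA
    by_cases hB : |y| ≤ s + (1 + |t|) * h
    · have key : (cutAbs (s + h) (fun x => v x (s + h)) (y + t * h) -
          cutAbs s (fun x => v x s) y) ^ 2 ≤ (L * (2 * |t| + 1)) ^ 2 * h ^ 2 := by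
        have := hv.cutAbs_lipschitz hL0 hL hs1 hs2 y (y + t * h)
        rw [add_sub_cancel_left, add_sub_cancel_left, hth, abs_of_nonneg hh] at this
        have k := pow_le_pow_left₀ (abs_nonneg _) this 2
        rw [sq_abs] at k
        refine k.trans (le_of_eq ?_)
        ring
      rcases le_total 0 y with hy | hy
      · rw [abs_of_nonneg hy] at hA hB
        rw [indicator_of_mem (show y ∈ Icc (s - (1 + |t|) * h) (s + (1 + |t|) * h) from
          ⟨hA.le, hB⟩)]
        linarith [n1 y, n2 (-s - (1 + |t|) * h) (-s + (1 + |t|) * h) y]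
      · rw [abs_of_nonpos hy] at hA hB
        rw [indicator_of_mem (show y ∈ Icc (-s - (1 + |t|) * h) (-s + (1 + |t|) * h) from
          ⟨by linarith, by linarith⟩)]
        linarith [n1 y, n2 (s - (1 + |t|) * h) (s + (1 + |t|) * h) y]
    · rw [not_le] at hB
      have hn : 0 ≤ |t| * h := by positivity
      have e1 : cutAbs s (fun x => v x s) y = 0 := cutAbs_of_lt (by linarith)
      have e2 : cutAbs (s + h) (fun x => v x (s + h)) (y + t * h) = 0 := by
        refine cutAbs_of_lt ?_
        have := abs_sub_abs_le_abs_sub y (-(t * h))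
        rw [abs_neg, sub_neg_eq_add] at this
        linarith
      rw [e1, e2]
      have := n1 y
      have := n2 (s - (1 + |t|) * h) (s + (1 + |t|) * h) y
      have := n2 (-s - (1 + |t|) * h) (-s + (1 + |t|) * h) y
      linarith

theorem integral_wedgeRear_sub_sq_le {t ε s h L B : ℝ} (hs : 0 ≤ s) (hh : 0 ≤ h) (hsh : s + h ≤ 1)
    (hε : 0 ≤ ε) (hL0 : 0 ≤ L)
    (hL : ∀ x s, |x| ≤ 1 → s ∈ Icc (0 : ℝ) 1 → |vx x s| ≤ L ∧ |vs x s| ≤ L)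
    (hB : ∀ y s, |y| ≤ 1 → s ∈ Icc (0 : ℝ) 1 → |vs y s + t * vx y s| ≤ B)
    (hD : ∀ y s y' s', |y| ≤ 1 → s ∈ Icc (0 : ℝ) 1 → |y'| ≤ 1 → s' ∈ Icc (0 : ℝ) 1 →
      |y' - y| ≤ |t| * h → |s' - s| ≤ h →
      |(vs y' s' + t * vx y' s') - (vs y s + t * vx y s)| ≤ ε) :
    ∫ x in (0 : ℝ)..1, (wedgeRear v x (s + h) - wedgeRear v x s) ^ 2 ≤
      h ^ 2 * ((∫ y in -s..s, (vs y s + t * vx y s) ^ 2) / 2 + ε * (2 * B + ε) +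
        2 * (1 + |t|) * (L * (2 * |t| + 1)) ^ 2 * h) := by
  have hs1 : s ∈ Icc (0 : ℝ) 1 := ⟨hs, by linarith⟩
  have hs2 : s + h ∈ Icc (0 : ℝ) 1 := ⟨by linarith, hsh⟩
  set ψ := cutAbs s fun x => v x s with hψ
  set φ := cutAbs (s + h) fun x => v x (s + h) with hφ
  have cψ : Continuous ψ := hv.continuous_cut hs1
  have cφ : Continuous φ := hv.continuous_cut hs2
  have kψ : HasCompactSupport ψ := hasCompactSupport_cutAbs _ _
  have kφ : HasCompactSupport φ := hasCompactSupport_cutAbs _ _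
  have cφ' : Continuous fun y => φ (y + t * h) := cφ.comp (by fun_prop)
  have kφ' : HasCompactSupport fun y => φ (y + t * h) :=
    kφ.comp_homeomorph (Homeomorph.addRight (t * h))
  have e1 : ∫ x in (0 : ℝ)..1, (wedgeRear v x (s + h) - wedgeRear v x s) ^ 2 =
      ∫ x in Ioc (0 : ℝ) 1, (rear (fun y => φ (y + t * h)) x - rear ψ x) ^ 2 := by
    rw [intervalIntegral.integral_of_le zero_le_one, rear_comp_add]
    refine setIntegral_congr_fun measurableSet_Ioc fun x hx => ?_
    simp only [wedgeRear_eq v hx.1.le hs1, wedgeRear_eq v hx.1.le hs2, ψ, φ]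
  have i1 := integrableOn_rear_sq cφ' (fun y => cutAbs_nonneg _ _ _) kφ'
  have i2 := integrableOn_rear_sq cψ (fun y => cutAbs_nonneg _ _ _) kψ
  have i3 := integrableOn_rear_mul cφ' cψ (fun y => cutAbs_nonneg _ _ _)
    (fun y => cutAbs_nonneg _ _ _) kφ' kψ
  have i4 : IntegrableOn (fun x => (rear (fun y => φ (y + t * h)) x - rear ψ x) ^ 2) (Ioi 0) := by
    refine ((i1.sub (i3.const_mul 2)).add i2).congr (Filter.Eventually.of_forall fun x => ?_)
    simp only [Pi.add_apply, Pi.sub_apply]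
    ring
  have e2 : ∫ x in Ioc (0 : ℝ) 1, (rear (fun y => φ (y + t * h)) x - rear ψ x) ^ 2 ≤
      ∫ x in Ioi (0 : ℝ), (rear (fun y => φ (y + t * h)) x - rear ψ x) ^ 2 :=
    setIntegral_mono_set i4 (Filter.Eventually.of_forall fun x => sq_nonneg _)
      Ioc_subset_Ioi_self.eventuallyLE
  have e3 := integral_rear_sub_sq_le cφ' cψ (fun y => cutAbs_nonneg _ _ _)
    (fun y => cutAbs_nonneg _ _ _) kφ' kψ
  have cD : Continuous fun y => vs y s + t * vx y s :=
    (hv.cont_s.comp (by fun_prop : Continuous fun y : ℝ => (y, s))).add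
      ((hv.cont_x.comp (by fun_prop : Continuous fun y : ℝ => (y, s))).const_mul t)
  have cD2 : Continuous fun y => (vs y s + t * vx y s) ^ 2 := cD.pow 2
  have j1 : Integrable ((Icc (-s) s).indicator
      (fun y => (|vs y s + t * vx y s| + ε) ^ 2 * h ^ 2)) := by
    refine IntegrableOn.integrable_indicator (ContinuousOn.integrableOn_compact isCompact_Icc ?_)
      measurableSet_Icc
    exact (((cD.abs.add continuous_const).pow 2).mul continuous_const).continuousOn
  have j2 : ∀ a b, Integrable ((Icc a b).indicator
      (fun _ : ℝ => (L * (2 * |t| + 1)) ^ 2 * h ^ 2)) := fun a b =>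
    IntegrableOn.integrable_indicator (continuousOn_const.integrableOn_compact isCompact_Icc)
      measurableSet_Icc
  have e4 := integral_mono_of_nonneg (Filter.Eventually.of_forall fun y => sq_nonneg _)
    (j1.add ((j2 (s - (1 + |t|) * h) (s + (1 + |t|) * h)).add
      (j2 (-s - (1 + |t|) * h) (-s + (1 + |t|) * h))))
    (Filter.Eventually.of_forall (hv.cutAbs_shift_sq_le hs hh hsh hL0 hL hD))
  have hn : 0 ≤ (1 + |t|) * h := by positivity
  rw [integral_add' j1 ((j2 _ _).add (j2 _ _)), integral_add' (j2 _ _) (j2 _ _),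
    integral_indicator measurableSet_Icc, integral_indicator measurableSet_Icc,
    integral_indicator measurableSet_Icc, setIntegral_const, setIntegral_const,
    Real.volume_real_Icc_of_le (by linarith), Real.volume_real_Icc_of_le (by linarith),
    integral_mul_const, integral_Icc_eq_integral_Ioc,
    ← intervalIntegral.integral_of_le (by linarith)] at e4
  simp only [smul_eq_mul] at e4
  have e5 : ∫ y in -s..s, (|vs y s + t * vx y s| + ε) ^ 2 ≤
      ∫ y in -s..s, ((vs y s + t * vx y s) ^ 2 + ε * (2 * B + ε)) := by
    refine intervalIntegral.integral_mono_on (by linarith)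
      (((cD.abs.add continuous_const).pow 2).intervalIntegrable _ _)
      (((cD.pow 2).add continuous_const).intervalIntegrable _ _) fun y hy => ?_
    have := hB y s ((abs_le.2 hy).trans hs1.2) hs1
    have k := sq_abs (vs y s + t * vx y s)
    have := mul_le_mul_of_nonneg_left this hε
    nlinarith
  rw [intervalIntegral.integral_add (cD2.intervalIntegrable _ _)
    intervalIntegrable_const, intervalIntegral.integral_const, smul_eq_mul] at e5
  have hB0 : 0 ≤ B := (abs_nonneg _).trans (hB 0 s (by simp) hs1)
  have e6 : (s - -s) * (ε * (2 * B + ε)) ≤ 2 * (ε * (2 * B + ε)) :=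
    mul_le_mul_of_nonneg_right (by linarith [hs1.2]) (by positivity)
  have e7 := mul_le_mul_of_nonneg_right (e5.trans (add_le_add_right e6 _)) (sq_nonneg h)
  rw [e1]
  refine (e2.trans e3).trans ?_
  linarith

end WedgeFun

namespace WedgeFun

variable {v vx vs : ℝ → ℝ → ℝ} (hv : WedgeFun v vx vs)
include hv

theorem cont_line (t : ℝ) : Continuous fun p : ℝ × ℝ => vs p.1 p.2 + t * vx p.1 p.2 :=
  hv.cont_s.add (hv.cont_x.const_mul t)

theorem exists_uniform_line (t : ℝ) {ε : ℝ} (hε : 0 < ε) :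
    ∃ δ > 0, ∀ h ≤ δ, ∀ y s y' s', |y| ≤ 1 → s ∈ Icc (0 : ℝ) 1 → |y'| ≤ 1 → s' ∈ Icc (0 : ℝ) 1 →
      |y' - y| ≤ |t| * h → |s' - s| ≤ h →
      |(vs y' s' + t * vx y' s') - (vs y s + t * vx y s)| ≤ ε := by
  have huc := (isCompact_Icc.prod isCompact_Icc : IsCompact
    (Icc (-1 : ℝ) 1 ×ˢ Icc (0 : ℝ) 1)).uniformContinuousOn_of_continuous
    (hv.cont_line t).continuousOn
  rw [Metric.uniformContinuousOn_iff_le] at huc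
  obtain ⟨δ, hδ, H⟩ := huc ε hε
  refine ⟨δ / (1 + |t|), by positivity, fun h hh y s y' s' hy hs hy' hs' h1 h2 => ?_⟩
  have h0 : 0 ≤ h := (abs_nonneg _).trans h2
  have h3 := (le_div_iff₀ (by positivity)).1 hh
  have h4 := mul_nonneg (abs_nonneg t) h0
  refine H (y', s') ⟨abs_le.1 hy', hs'⟩ (y, s) ⟨abs_le.1 hy, hs⟩ ?_
  rw [Prod.dist_eq, Real.dist_eq, Real.dist_eq]
  exact max_le (h1.trans (by nlinarith)) (h2.trans (by nlinarith))

theorem exists_bound_line (t : ℝ) :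
    ∃ B, ∀ y s, |y| ≤ 1 → s ∈ Icc (0 : ℝ) 1 → |vs y s + t * vx y s| ≤ B := by
  obtain ⟨B, hB⟩ := (isCompact_Icc.prod isCompact_Icc : IsCompact
    (Icc (-1 : ℝ) 1 ×ˢ Icc (0 : ℝ) 1)).exists_bound_of_continuousOn (hv.cont_line t).continuousOn
  exact ⟨B, fun y s hy hs => hB (y, s) ⟨abs_le.1 hy, hs⟩⟩

omit hv in
theorem _root_.sq_sub_mul_le {b w w' h : ℝ} (hh : 0 < h) :
    b * (w' ^ 2 - w ^ 2) ≤ (w' - w) ^ 2 / h + h * (b ^ 2 * ((w' + w) ^ 2 / 4)) := by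
  have e : (w' - w) ^ 2 / h + h * (b ^ 2 * ((w' + w) ^ 2 / 4)) - b * (w' ^ 2 - w ^ 2) =
      ((w' - w) - h * (b * (w' + w)) / 2) ^ 2 / h := by
    field_simp
    ring
  have : 0 ≤ ((w' - w) - h * (b * (w' + w)) / 2) ^ 2 / h := by positivity
  linarith

theorem exists_increment_point {β βs : ℝ → ℝ → ℝ} (hβ : Continuous fun p : ℝ × ℝ => β p.1 p.2)
    (hβs : Continuous fun p : ℝ × ℝ => βs p.1 p.2)
    (hd : ∀ x s, 0 ≤ x → x ≤ s → s ≤ 1 → HasDerivWithinAt (β x) (βs x s) (Icc x 1) s)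
    {ε : ℝ} (hε : 0 < ε) :
    ∃ δ > 0, ∀ s s', 0 ≤ s → s < s' → s' ≤ 1 → s' - s ≤ δ → ∀ x ∈ Icc (0 : ℝ) 1,
      β x s' * wedgeRear v x s' ^ 2 - β x s * wedgeRear v x s ^ 2 ≤
      (βs x s + β x s ^ 2) * wedgeRear v x s ^ 2 * (s' - s) + ε * (s' - s) +
        (wedgeRear v x s' - wedgeRear v x s) ^ 2 / (s' - s) := by
  have hw := hv.continuous_wedgeRear
  obtain ⟨M, hM⟩ := (isCompact_Icc.prod isCompact_Icc : IsCompact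
    (Icc (0 : ℝ) 1 ×ˢ Icc (0 : ℝ) 1)).exists_bound_of_continuousOn hw.continuousOn
  have hM' : ∀ x s, x ∈ Icc (0 : ℝ) 1 → s ∈ Icc (0 : ℝ) 1 → wedgeRear v x s ^ 2 ≤ M ^ 2 := by
    intro x s hx hs
    have := hM (x, s) ⟨hx, hs⟩
    rw [Real.norm_eq_abs] at this
    rw [← sq_abs]
    exact pow_le_pow_left₀ (abs_nonneg _) this 2
  have p2 : Continuous fun q : ℝ × ℝ × ℝ => (q.1, q.2.1) := by fun_prop
  have p3 : Continuous fun q : ℝ × ℝ × ℝ => (q.1, q.2.2) := by fun_prop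
  have hη₁ : 0 < ε / (2 * (M ^ 2 + 1)) := by positivity
  obtain ⟨δ₁, hδ₁, H1⟩ := exists_uniform_of_continuous (hβs.comp p3) hη₁
  obtain ⟨δ₂, hδ₂, H2⟩ := exists_uniform_of_continuous
    (F := fun q => β q.1 q.2.2 ^ 2 * ((wedgeRear v q.1 q.2.2 + wedgeRear v q.1 q.2.1) ^ 2 / 4))
    (((hβ.comp p3).pow 2).mul ((((hw.comp p3).add (hw.comp p2)).pow 2).div_const 4)) (half_pos hε)
  refine ⟨min δ₁ δ₂, by positivity, fun s s' hs hss hs' hdist x hx => ?_⟩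
  obtain ⟨d1, d2⟩ := le_min_iff.1 hdist
  have hs1 : s ∈ Icc (0 : ℝ) 1 := ⟨hs, by linarith⟩
  have hs2 : s' ∈ Icc (0 : ℝ) 1 := ⟨by linarith, hs'⟩
  have hh0 : 0 < s' - s := sub_pos.2 hss
  have q3 := (le_abs_self _).trans (H2 x s s' hx hs1 hs2 (by rwa [abs_of_pos hh0]))
  have q2 := sq_sub_mul_le (b := β x s') (w := wedgeRear v x s) (w' := wedgeRear v x s') hh0
  have q1 : (β x s' - β x s) * wedgeRear v x s ^ 2 ≤
      βs x s * wedgeRear v x s ^ 2 * (s' - s) + ε / 2 * (s' - s) := by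
    rcases le_total x s with hxs | hxs
    · have := (convex_Icc s s').norm_image_sub_le_of_norm_hasDerivWithin_le
        (f := fun r => β x r - βs x s * r) (f' := fun r => βs x r - βs x s)
        (C := ε / (2 * (M ^ 2 + 1))) (x := s) (y := s')
        (fun r hr => by
          have := ((hd x r hx.1 (hxs.trans hr.1) (hr.2.trans hs')).mono
            (Icc_subset_Icc hxs hs')).sub
            (((hasDerivAt_id r).const_mul (βs x s)).hasDerivWithinAt)
          rw [mul_one] at this
          exact this)
        (fun r hr => H1 x s r hx hs1 ⟨hs.trans hr.1, hr.2.trans hs'⟩ (by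
          rw [abs_of_nonneg (sub_nonneg.2 hr.1)]
          linarith [hr.2]))
        ⟨le_rfl, hss.le⟩ ⟨hss.le, le_rfl⟩
      rw [Real.norm_eq_abs, Real.norm_eq_abs, abs_of_pos hh0] at this
      have k1 : β x s' - β x s ≤ βs x s * (s' - s) + ε / (2 * (M ^ 2 + 1)) * (s' - s) := by
        have := (le_abs_self _).trans this
        linarith
      have k2 := mul_le_mul_of_nonneg_right k1 (sq_nonneg (wedgeRear v x s))
      have k3 : ε / (2 * (M ^ 2 + 1)) * wedgeRear v x s ^ 2 ≤ ε / 2 := by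
        have e : ε / 2 = ε / (2 * (M ^ 2 + 1)) * (M ^ 2 + 1) := by
          field_simp
        rw [e]
        exact mul_le_mul_of_nonneg_left (by linarith [hM' x s hx hs1]) hη₁.le
      have k4 := mul_le_mul_of_nonneg_right k3 hh0.le
      linarith
    · rw [hv.wedgeRear_eq_zero hs1 hxs]
      have : 0 < ε / 2 * (s' - s) := by positivity
      linarith
  have k5 : β x s ^ 2 * ((wedgeRear v x s + wedgeRear v x s) ^ 2 / 4) =
    β x s ^ 2 * wedgeRear v x s ^ 2 := by ring
  simp only [k5] at q3
  have q5 := mul_le_mul_of_nonneg_left q3 hh0.le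
  generalize (wedgeRear v x s' - wedgeRear v x s) ^ 2 / (s' - s) = Q at *
  linarith

theorem exists_rear_diff_le (t : ℝ) {ε : ℝ} (hε : 0 < ε) :
    ∃ δ > 0, ∀ s s', 0 ≤ s → s < s' → s' ≤ 1 → s' - s ≤ δ →
      (∫ x in (0 : ℝ)..1, (wedgeRear v x s' - wedgeRear v x s) ^ 2) / (s' - s) ≤
        (s' - s) * ((∫ y in -s..s, (vs y s + t * vx y s) ^ 2) / 2 + ε) := by
  obtain ⟨L, hL0, hL⟩ := hv.exists_bound
  obtain ⟨B, hB⟩ := hv.exists_bound_line t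
  have hB0 : 0 ≤ B := (abs_nonneg _).trans (hB 0 0 (by simp) ⟨le_rfl, zero_le_one⟩)
  obtain ⟨η, hη0, hη1, hη2⟩ : ∃ η > 0, η ≤ 1 ∧ η ≤ ε / (2 * (2 * B + 1)) :=
    ⟨min 1 (ε / (2 * (2 * B + 1))), by positivity, min_le_left _ _, min_le_right _ _⟩
  obtain ⟨δ₃, hδ₃, H3⟩ := hv.exists_uniform_line t hη0
  obtain ⟨K, hK⟩ : ∃ K, K = 2 * (1 + |t|) * (L * (2 * |t| + 1)) ^ 2 := ⟨_, rfl⟩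
  have hK0 : 0 ≤ K := by rw [hK]; positivity
  refine ⟨min δ₃ (ε / (2 * (K + 1))), by positivity, fun s s' hs hss hs' hdist => ?_⟩
  obtain ⟨d1, d2⟩ := le_min_iff.1 hdist
  have hh0 : 0 < s' - s := sub_pos.2 hss
  have R2 := hv.integral_wedgeRear_sub_sq_le (t := t) hs hh0.le (by linarith) hη0.le hL0.le hL hB
    (H3 (s' - s) d1)
  rw [add_sub_cancel, ← hK] at R2
  rw [div_le_iff₀ hh0]
  refine R2.trans ?_
  have l1 : η * (2 * B + η) ≤ ε / 2 := by
    have e : ε / 2 = ε / (2 * (2 * B + 1)) * (2 * B + 1) := by field_simp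
    rw [e]
    exact mul_le_mul hη2 (by linarith) (by positivity) (by positivity)
  have l2 : K * (s' - s) ≤ ε / 2 := by
    have e : ε / 2 = (K + 1) * (ε / (2 * (K + 1))) := by field_simp
    rw [e]
    exact mul_le_mul (by linarith) d2 hh0.le (by linarith)
  have := mul_le_mul_of_nonneg_left (add_le_add l1 l2) (sq_nonneg (s' - s))
  linarith

theorem increment_le {β βs : ℝ → ℝ → ℝ} (hβ : Continuous fun p : ℝ × ℝ => β p.1 p.2)
    (hβs : Continuous fun p : ℝ × ℝ => βs p.1 p.2)
    (hd : ∀ x s, 0 ≤ x → x ≤ s → s ≤ 1 → HasDerivWithinAt (β x) (βs x s) (Icc x 1) s)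
    (t : ℝ) {ε : ℝ} (hε : 0 < ε) :
    ∃ δ > 0, ∀ s s', 0 ≤ s → s ≤ s' → s' ≤ 1 → s' - s ≤ δ →
      (∫ x in (0 : ℝ)..1, β x s' * wedgeRear v x s' ^ 2) -
        (∫ x in (0 : ℝ)..1, β x s * wedgeRear v x s ^ 2) ≤
      ((∫ x in (0 : ℝ)..1, (βs x s + β x s ^ 2) * wedgeRear v x s ^ 2) +
        (∫ y in -s..s, (vs y s + t * vx y s) ^ 2) / 2 + ε) * (s' - s) := by
  have hw := hv.continuous_wedgeRear
  obtain ⟨δ₁, hδ₁, H1⟩ := hv.exists_increment_point hβ hβs hd (half_pos hε)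
  obtain ⟨δ₂, hδ₂, H2⟩ := hv.exists_rear_diff_le t (half_pos hε)
  refine ⟨min δ₁ δ₂, by positivity, fun s s' hs hss hs' hdist => ?_⟩
  obtain ⟨d1, d2⟩ := le_min_iff.1 hdist
  rcases hss.eq_or_lt with h0 | h0
  · subst h0
    simp
  have point := H1 s s' hs h0 hs' d1
  have R3 := H2 s s' hs h0 hs' d2
  have cβ : ∀ s, Continuous fun x => β x s := fun s =>
    hβ.comp (by fun_prop : Continuous fun x : ℝ => (x, s))
  have cβs : ∀ s, Continuous fun x => βs x s := fun s =>
    hβs.comp (by fun_prop : Continuous fun x : ℝ => (x, s))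
  have cw : ∀ s, Continuous fun x => wedgeRear v x s := fun s =>
    hw.comp (by fun_prop : Continuous fun x : ℝ => (x, s))
  have I1 : IntervalIntegrable (fun x => (βs x s + β x s ^ 2) * wedgeRear v x s ^ 2) volume 0 1 :=
    (((cβs s).add ((cβ s).pow 2)).mul ((cw s).pow 2)).intervalIntegrable _ _
  have I2 : ∀ s, IntervalIntegrable (fun x => β x s * wedgeRear v x s ^ 2) volume 0 1 := fun s =>
    ((cβ s).mul ((cw s).pow 2)).intervalIntegrable _ _
  have I3 : IntervalIntegrable (fun x => (wedgeRear v x s' - wedgeRear v x s) ^ 2) volume 0 1 :=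
    (((cw s').sub (cw s)).pow 2).intervalIntegrable _ _
  have R1 := intervalIntegral.integral_mono_on zero_le_one ((I2 s').sub (I2 s))
    (((I1.mul_const (s' - s)).add intervalIntegrable_const).add (I3.div_const (s' - s))) point
  rw [intervalIntegral.integral_sub (I2 s') (I2 s), intervalIntegral.integral_add
    ((I1.mul_const _).add intervalIntegrable_const) (I3.div_const _),
    intervalIntegral.integral_add (I1.mul_const _) intervalIntegrable_const,
    intervalIntegral.integral_mul_const, intervalIntegral.integral_const,
    intervalIntegral.integral_div] at R1
  simp only [sub_zero, one_smul] at R1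
  linarith

/-- Control of the rearrangement in the direction `s`. -/
theorem zero_le_rear_s {β βs : ℝ → ℝ → ℝ} (hβ : Continuous fun p : ℝ × ℝ => β p.1 p.2)
    (hβs : Continuous fun p : ℝ × ℝ => βs p.1 p.2)
    (hd : ∀ x s, 0 ≤ x → x ≤ s → s ≤ 1 → HasDerivWithinAt (β x) (βs x s) (Icc x 1) s)
    (h1 : ∀ x ∈ Icc (0 : ℝ) 1, β x 1 = 0) (t : ℝ) :
    0 ≤ ∫ s in (0 : ℝ)..1, ((∫ x in (0 : ℝ)..1, (βs x s + β x s ^ 2) * wedgeRear v x s ^ 2) +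
        (∫ y in -s..s, (vs y s + t * vx y s) ^ 2) / 2) := by
  have hw := hv.continuous_wedgeRear
  have cg : Continuous fun s => ((∫ x in (0 : ℝ)..1, (βs x s + β x s ^ 2) * wedgeRear v x s ^ 2) +
        (∫ y in -s..s, (vs y s + t * vx y s) ^ 2) / 2) :=
    (continuous_integral_unit ((hβs.add (hβ.pow 2)).mul (hw.pow 2))).add
      ((continuous_integral_symm ((hv.cont_line t).pow 2)).div_const 2)
  have main := sub_le_integral_of_local
    (φ := fun s => ∫ x in (0 : ℝ)..1, β x s * wedgeRear v x s ^ 2) zero_le_one cg.continuousOn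
    (fun ε hε => hv.increment_le hβ hβs hd t hε)
  have e1 : ∫ x in (0 : ℝ)..1, β x 1 * wedgeRear v x 1 ^ 2 = 0 := by
    refine intervalIntegral.integral_zero_ae (Filter.Eventually.of_forall fun x hx => ?_)
    rw [uIoc_of_le zero_le_one] at hx
    rw [h1 x (Ioc_subset_Icc_self hx), zero_mul]
  have e0 : ∫ x in (0 : ℝ)..1, β x 0 * wedgeRear v x 0 ^ 2 = 0 := by
    refine intervalIntegral.integral_zero_ae (Filter.Eventually.of_forall fun x hx => ?_)
    rw [uIoc_of_le zero_le_one] at hx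
    simp [hv.wedgeRear_eq_zero ⟨le_rfl, zero_le_one⟩ hx.1.le]
  simp only [e1, e0] at main
  linarith

end WedgeFun

/-- Integral over the triangle `|x| < s < 1`. -/
def wedgeInt (f : ℝ → ℝ → ℝ) : ℝ := ∫ s in (0 : ℝ)..1, ∫ y in -s..s, f y s

/-- The field `κ tan (κ (z - 1/2))`, frozen outside `[0, 1]`. -/
def tanField (κ z : ℝ) : ℝ := κ * Real.tan (κ * (max 0 (min z 1) - 1 / 2))

section tanField

variable {κ : ℝ} (hκ : 0 < κ) (hκπ : κ < Real.pi)
include hκ hκπ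

theorem cos_tanField_pos {z : ℝ} (hz : z ∈ Icc (0 : ℝ) 1) : 0 < Real.cos (κ * (z - 1 / 2)) := by
  obtain ⟨h0, h1⟩ := hz
  apply Real.cos_pos_of_mem_Ioo
  constructor <;> nlinarith

theorem continuous_tanField : Continuous (tanField κ) := by
  have h : ∀ z : ℝ, Real.cos (κ * (max 0 (min z 1) - 1 / 2)) ≠ 0 := fun z =>
    (cos_tanField_pos hκ hκπ ⟨le_max_left _ _, max_le zero_le_one (min_le_right _ _)⟩).ne'
  unfold tanField
  simp only [Real.tan_eq_sin_div_cos]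
  exact continuous_const.mul (Continuous.div (by fun_prop) (by fun_prop) h)

omit hκ hκπ in
theorem tanField_eq {z : ℝ} (hz : z ∈ Icc (0 : ℝ) 1) :
    tanField κ z = κ * Real.tan (κ * (z - 1 / 2)) := by
  rw [tanField, min_eq_left hz.2, max_eq_right hz.1]

omit hκ hκπ in
theorem tanField_symm {z : ℝ} (hz : z ∈ Icc (0 : ℝ) 1) : tanField κ (1 - z) = -tanField κ z := by
  rw [tanField_eq hz, tanField_eq ⟨by linarith [hz.2], by linarith [hz.1]⟩,
    show κ * (1 - z - 1 / 2) = -(κ * (z - 1 / 2)) by ring, Real.tan_neg]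
  ring

theorem hasDerivAt_tan_field {z : ℝ} (hz : z ∈ Icc (0 : ℝ) 1) :
    HasDerivAt (fun z => κ * Real.tan (κ * (z - 1 / 2))) (κ ^ 2 + tanField κ z ^ 2) z := by
  have hc := (cos_tanField_pos hκ hκπ hz).ne'
  have h1 : HasDerivAt (fun z : ℝ => κ * (z - 1 / 2)) κ z := by
    have := ((hasDerivAt_id z).sub_const (1 / 2)).const_mul κ
    rwa [mul_one] at this
  have := ((Real.hasDerivAt_tan hc).comp z h1).const_mul κ
  rw [tanField_eq hz]
  have e : κ * (1 / Real.cos (κ * (z - 1 / 2)) ^ 2 * κ) =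
      κ ^ 2 + (κ * Real.tan (κ * (z - 1 / 2))) ^ 2 := by
    have h := Real.one_add_tan_sq_mul_cos_sq_eq_one hc
    have h' : 1 / Real.cos (κ * (z - 1 / 2)) ^ 2 = 1 + Real.tan (κ * (z - 1 / 2)) ^ 2 := by
      rw [div_eq_iff (pow_ne_zero 2 hc), h]
    rw [h']
    ring
  rw [← e]
  exact this

theorem tanField_mono {z z' : ℝ} (hz : 0 ≤ z) (hzz : z ≤ z') (hz' : z' ≤ 1) :
    tanField κ z ≤ tanField κ z' := by
  rw [tanField_eq ⟨hz, hzz.trans hz'⟩, tanField_eq ⟨hz.trans hzz, hz'⟩]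
  refine mul_le_mul_of_nonneg_left ?_ hκ.le
  refine Real.strictMonoOn_tan.monotoneOn ⟨?_, ?_⟩ ⟨?_, ?_⟩ ?_ <;> nlinarith

end tanField

namespace WedgeFun

variable {v vx vs : ℝ → ℝ → ℝ} (hv : WedgeFun v vx vs)
include hv

theorem integral_wedgeRear_restrict {G : ℝ → ℝ} (hG : Continuous G) {s : ℝ}
    (hs : s ∈ Icc (0 : ℝ) 1) :
    ∫ x in (0 : ℝ)..1, G x * wedgeRear v x s ^ 2 =
      ∫ x in (0 : ℝ)..s, G x * rear (cutAbs s fun y => v y s) x ^ 2 := by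
  have cw : Continuous fun x => wedgeRear v x s :=
    hv.continuous_wedgeRear.comp (by fun_prop : Continuous fun x : ℝ => (x, s))
  have c : Continuous fun x => G x * wedgeRear v x s ^ 2 := hG.mul (cw.pow 2)
  rw [← intervalIntegral.integral_add_adjacent_intervals (c.intervalIntegrable 0 s)
    (c.intervalIntegrable s 1)]
  have e : ∫ x in s..1, G x * wedgeRear v x s ^ 2 = 0 := by
    refine intervalIntegral.integral_zero_ae (Filter.Eventually.of_forall fun x hx => ?_)
    rw [uIoc_of_le hs.2] at hx
    rw [hv.wedgeRear_eq_zero hs hx.1.le]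
    ring
  rw [e, add_zero]
  refine intervalIntegral.integral_congr fun x hx => ?_
  rw [uIcc_of_le hs.1] at hx
  simp only [wedgeRear_eq v hx.1 hs]

theorem integral_wedgeRear_sq {s : ℝ} (hs : s ∈ Icc (0 : ℝ) 1) :
    ∫ x in (0 : ℝ)..1, wedgeRear v x s ^ 2 = (∫ y in -s..s, v y s ^ 2) / 2 := by
  have h := hv.integral_wedgeRear_restrict (continuous_const (y := (1 : ℝ))) hs
  simp only [one_mul] at h
  have hk := hasCompactSupport_cutAbs s fun y => v y s
  have h2 := integral_rear_sq (hv.continuous_cut hs) (fun y => cutAbs_nonneg _ _ _) hk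
  rw [h, intervalIntegral.integral_of_le hs.1]
  have e1 : ∫ x in Ioc 0 s, rear (cutAbs s fun y => v y s) x ^ 2 =
      ∫ x in Ioi 0, rear (cutAbs s fun y => v y s) x * rear (cutAbs s fun y => v y s) x := by
    simp only [← sq]
    refine (setIntegral_eq_of_subset_of_forall_sdiff_eq_zero measurableSet_Ioi
      Ioc_subset_Ioi_self fun x hx => ?_).symm
    have hx' : s ≤ x := by
      by_contra hc
      exact hx.2 ⟨hx.1, (not_le.1 hc).le⟩
    have := hv.sliceRear_eq_zero hs hx'
    rw [sliceRear] at this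
    rw [this]
    ring
  have e2 : ∫ y, cutAbs s (fun y => v y s) y * cutAbs s (fun y => v y s) y =
      ∫ y in -s..s, v y s ^ 2 := by
    rw [intervalIntegral.integral_of_le (by linarith [hs.1]), ← integral_Icc_eq_integral_Ioc,
      ← integral_indicator measurableSet_Icc]
    congr 1
    funext y
    by_cases hy : |y| ≤ s
    · rw [indicator_of_mem (show y ∈ Icc (-s) s from abs_le.1 hy), cutAbs_of_le hy, abs_mul_abs_self,
        sq]
    · rw [indicator_of_notMem (show y ∉ Icc (-s) s from fun h => hy (abs_le.2 h)),
        cutAbs_of_lt (not_le.1 hy), mul_zero]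
  rw [e1, h2, e2]

theorem energy_ge_of_fields {A c t : ℝ} (hA : 0 < A) {r p : ℝ → ℝ → ℝ}
    (cr : Continuous fun q : ℝ × ℝ => r q.1 q.2) (cp : Continuous fun q : ℝ × ℝ => p q.1 q.2)
    (hrp : ∀ x s, A * r x s + A⁻¹ * p x s = -c)
    (hx : ∀ s ∈ Icc (0 : ℝ) 1, 0 ≤ (∫ x in (0 : ℝ)..1, r x s * wedgeRear v x s ^ 2) +
        (∫ y in -s..s, vx y s ^ 2) / 2)
    (hs : 0 ≤ ∫ s in (0 : ℝ)..1, ((∫ x in (0 : ℝ)..1, p x s * wedgeRear v x s ^ 2) +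
        (∫ y in -s..s, (vs y s + t * vx y s) ^ 2) / 2)) :
    c * wedgeInt (fun x s => v x s ^ 2) ≤ A * wedgeInt (fun x s => vx x s ^ 2) +
        wedgeInt (fun x s => (vs x s + t * vx x s) ^ 2) / A := by
  have hw := hv.continuous_wedgeRear
  have c1 : Continuous fun q : ℝ × ℝ => r q.1 q.2 * wedgeRear v q.1 q.2 ^ 2 := cr.mul (hw.pow 2)
  have c3 : Continuous fun q : ℝ × ℝ => p q.1 q.2 * wedgeRear v q.1 q.2 ^ 2 := cp.mul (hw.pow 2)
  have c2 : Continuous fun q : ℝ × ℝ => vx q.1 q.2 ^ 2 := hv.cont_x.pow 2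
  have c4 : Continuous fun q : ℝ × ℝ => (vs q.1 q.2 + t * vx q.1 q.2) ^ 2 := (hv.cont_line t).pow 2
  have i1 := (continuous_integral_unit (f := fun x s => r x s * wedgeRear v x s ^ 2) c1).intervalIntegrable (μ := volume) 0 1
  have i2 := ((continuous_integral_symm (f := fun x s => vx x s ^ 2) c2).div_const 2).intervalIntegrable (μ := volume) 0 1
  have i3 := (continuous_integral_unit (f := fun x s => p x s * wedgeRear v x s ^ 2) c3).intervalIntegrable (μ := volume) 0 1
  have i4 := ((continuous_integral_symm (f := fun x s => (vs x s + t * vx x s) ^ 2) c4).div_const 2).intervalIntegrable (μ := volume) 0 1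
  have hxi := intervalIntegral.integral_nonneg (μ := volume) zero_le_one hx
  rw [intervalIntegral.integral_add i1 i2, intervalIntegral.integral_div] at hxi
  rw [intervalIntegral.integral_add i3 i4, intervalIntegral.integral_div] at hs
  have hN : wedgeInt (fun x s => v x s ^ 2) =
      2 * ∫ s in (0 : ℝ)..1, ∫ x in (0 : ℝ)..1, wedgeRear v x s ^ 2 := by
    rw [wedgeInt, ← intervalIntegral.integral_const_mul]
    refine intervalIntegral.integral_congr fun s hs => ?_
    rw [uIcc_of_le zero_le_one] at hs
    simp only [hv.integral_wedgeRear_sq hs]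
    ring
  have hsum : A * (∫ s in (0 : ℝ)..1, ∫ x in (0 : ℝ)..1, r x s * wedgeRear v x s ^ 2) +
      A⁻¹ * (∫ s in (0 : ℝ)..1, ∫ x in (0 : ℝ)..1, p x s * wedgeRear v x s ^ 2) =
      -c * ∫ s in (0 : ℝ)..1, ∫ x in (0 : ℝ)..1, wedgeRear v x s ^ 2 := by
    rw [← intervalIntegral.integral_const_mul, ← intervalIntegral.integral_const_mul,
      ← intervalIntegral.integral_const_mul,
      ← intervalIntegral.integral_add (i1.const_mul A) (i3.const_mul A⁻¹)]
    refine intervalIntegral.integral_congr fun s _ => ?_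
    have cx : Continuous fun x : ℝ => (x, s) := by fun_prop
    have j1 : IntervalIntegrable (fun x => r x s * wedgeRear v x s ^ 2) volume 0 1 :=
      (c1.comp cx).intervalIntegrable 0 1
    have j3 : IntervalIntegrable (fun x => p x s * wedgeRear v x s ^ 2) volume 0 1 :=
      (c3.comp cx).intervalIntegrable 0 1
    rw [← intervalIntegral.integral_const_mul, ← intervalIntegral.integral_const_mul,
      ← intervalIntegral.integral_const_mul,
      ← intervalIntegral.integral_add (j1.const_mul A) (j3.const_mul A⁻¹)]
    refine intervalIntegral.integral_congr fun x _ => ?_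
    simp only [← hrp x s]
    ring
  have hA' : 0 < A⁻¹ := inv_pos.2 hA
  have hxi' := mul_le_mul_of_nonneg_left hxi hA.le
  have hs' := mul_le_mul_of_nonneg_left hs hA'.le
  have f1 : wedgeInt (fun x s => vx x s ^ 2) = ∫ s in (0 : ℝ)..1, ∫ y in -s..s, vx y s ^ 2 := rfl
  have f2 : wedgeInt (fun x s => (vs x s + t * vx x s) ^ 2) =
    ∫ s in (0 : ℝ)..1, ∫ y in -s..s, (vs y s + t * vx y s) ^ 2 := rfl
  rw [hN, f1, f2, div_eq_inv_mul]
  linarith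

section Fields

variable {κ : ℝ} (hκ : 0 < κ) (hκπ : κ < Real.pi)
include hκ hκπ

theorem zero_le_field_x {α s : ℝ} (hα : 0 ≤ α) (hs : s ∈ Icc (0 : ℝ) 1) :
    0 ≤ (∫ x in (0 : ℝ)..1,
        (-α * (κ ^ 2 + (tanField κ ((s - x) / 2) ^ 2 + tanField κ ((s + x) / 2) ^ 2) / 2) +
          (α * (tanField κ ((s - x) / 2) - tanField κ ((s + x) / 2))) ^ 2) *
          wedgeRear v x s ^ 2) + (∫ y in -s..s, vx y s ^ 2) / 2 := by
  have hμ := continuous_tanField hκ hκπ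
  have ca : Continuous fun x => tanField κ ((s - x) / 2) := hμ.comp (by fun_prop)
  have cb : Continuous fun x => tanField κ ((s + x) / 2) := hμ.comp (by fun_prop)
  have mem : ∀ x ∈ Icc 0 s, (s - x) / 2 ∈ Icc (0 : ℝ) 1 ∧ (s + x) / 2 ∈ Icc (0 : ℝ) 1 :=
    fun x hx => ⟨⟨by linarith [hx.2], by linarith [hx.1, hs.2]⟩,
      ⟨by linarith [hx.1, hs.1], by linarith [hx.2, hs.2]⟩⟩
  have cq : Continuous fun x => -α * (κ ^ 2 +
      (tanField κ ((s - x) / 2) ^ 2 + tanField κ ((s + x) / 2) ^ 2) / 2) :=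
    (continuous_const.add (((ca.pow 2).add (cb.pow 2)).div_const 2)).const_mul (-α)
  have cr : Continuous fun x => -α * (κ ^ 2 +
      (tanField κ ((s - x) / 2) ^ 2 + tanField κ ((s + x) / 2) ^ 2) / 2) +
      (α * (tanField κ ((s - x) / 2) - tanField κ ((s + x) / 2))) ^ 2 :=
    cq.add (((ca.sub cb).const_mul α).pow 2)
  rw [hv.integral_wedgeRear_restrict cr hs]
  obtain ⟨T, hT⟩ : ∃ T : ℝ → ℝ, T = fun z => κ * Real.tan (κ * (z - 1 / 2)) := ⟨_, rfl⟩
  have hTe : ∀ z ∈ Icc (0 : ℝ) 1, T z = tanField κ z := fun z hz => by rw [hT, tanField_eq hz]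
  have hTd : ∀ z ∈ Icc (0 : ℝ) 1, HasDerivAt T (κ ^ 2 + tanField κ z ^ 2) z := fun z hz => by
    rw [hT]
    exact hasDerivAt_tan_field hκ hκπ hz
  have key := neg_integral_rear_le (R := fun x => α * (T ((s - x) / 2) - T ((s + x) / 2)))
    hs.1 (fun x => hv.dx x s) (hv.cont_slice_x s) (hv.right s hs)
    (hv.left s hs) (fun x hx => ?_) cq.continuousOn (by simp) (fun x hx => ?_)
  · have e : ∫ x in (0 : ℝ)..s, (-α * (κ ^ 2 +
          (tanField κ ((s - x) / 2) ^ 2 + tanField κ ((s + x) / 2) ^ 2) / 2) +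
            (α * (T ((s - x) / 2) - T ((s + x) / 2))) ^ 2) *
          rear (cutAbs s fun x => v x s) x ^ 2 =
        ∫ x in (0 : ℝ)..s, (-α * (κ ^ 2 +
          (tanField κ ((s - x) / 2) ^ 2 + tanField κ ((s + x) / 2) ^ 2) / 2) +
            (α * (tanField κ ((s - x) / 2) - tanField κ ((s + x) / 2))) ^ 2) *
          rear (cutAbs s fun y => v y s) x ^ 2 := by
      refine intervalIntegral.integral_congr fun x hx => ?_
      rw [uIcc_of_le hs.1] at hx
      simp only [hTe _ (mem x hx).1, hTe _ (mem x hx).2]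
    rw [e] at key
    linarith
  · obtain ⟨m1, m2⟩ := mem x hx
    have g1 : HasDerivAt (fun x : ℝ => (s - x) / 2) (-1 / 2) x := by
      simpa using ((hasDerivAt_id x).const_sub s).div_const 2
    have g2 : HasDerivAt (fun x : ℝ => (s + x) / 2) (1 / 2) x := by
      simpa using ((hasDerivAt_id x).const_add s).div_const 2
    have := (((hTd _ m1).comp x g1).sub ((hTd _ m2).comp x g2)).const_mul α
    refine this.congr_deriv ?_
    ring
  · obtain ⟨m1, m2⟩ := mem x hx
    have := tanField_mono hκ hκπ m1.1 (by linarith [hx.1] : (s - x) / 2 ≤ (s + x) / 2) m2.2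
    rw [hTe _ m1, hTe _ m2]
    exact mul_nonpos_of_nonneg_of_nonpos hα (sub_nonpos.2 this)

theorem zero_le_field_s (γ t : ℝ) :
    0 ≤ ∫ s in (0 : ℝ)..1, ((∫ x in (0 : ℝ)..1,
        (-γ * (κ ^ 2 + (tanField κ ((s - x) / 2) ^ 2 + tanField κ ((s + x) / 2) ^ 2) / 2) +
          (-γ * (tanField κ ((s - x) / 2) + tanField κ ((s + x) / 2))) ^ 2) *
          wedgeRear v x s ^ 2) + (∫ y in -s..s, (vs y s + t * vx y s) ^ 2) / 2) := by
  have hμ := continuous_tanField hκ hκπ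
  have ca : Continuous fun p : ℝ × ℝ => tanField κ ((p.2 - p.1) / 2) := hμ.comp (by fun_prop)
  have cb : Continuous fun p : ℝ × ℝ => tanField κ ((p.2 + p.1) / 2) := hμ.comp (by fun_prop)
  refine hv.zero_le_rear_s
    (β := fun x s => -γ * (tanField κ ((s - x) / 2) + tanField κ ((s + x) / 2)))
    (βs := fun x s => -γ *
      (κ ^ 2 + (tanField κ ((s - x) / 2) ^ 2 + tanField κ ((s + x) / 2) ^ 2) / 2))
    ((ca.add cb).const_mul (-γ))
    ((continuous_const.add (((ca.pow 2).add (cb.pow 2)).div_const 2)).const_mul (-γ))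
    (fun x s hx hxs hs1 => ?_) (fun x hx => ?_) t
  · have h1 : ∀ r ∈ Icc x 1, (r - x) / 2 ∈ Icc (0 : ℝ) 1 ∧ (r + x) / 2 ∈ Icc (0 : ℝ) 1 :=
      fun r hr => ⟨⟨by linarith [hr.1], by linarith [hr.2]⟩,
        ⟨by linarith [hr.1], by linarith [hr.1, hr.2]⟩⟩
    obtain ⟨m1, m2⟩ := h1 s ⟨hxs, hs1⟩
    have g1 : HasDerivAt (fun s : ℝ => (s - x) / 2) (1 / 2) s :=
      ((hasDerivAt_id s).sub_const x).div_const 2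
    have g2 : HasDerivAt (fun s : ℝ => (s + x) / 2) (1 / 2) s :=
      ((hasDerivAt_id s).add_const x).div_const 2
    have := ((((hasDerivAt_tan_field hκ hκπ m1).comp s g1).add
      ((hasDerivAt_tan_field hκ hκπ m2).comp s g2)).const_mul (-γ)).hasDerivWithinAt (s := Icc x 1)
    refine (this.congr_of_mem (fun r hr => ?_) ⟨hxs, hs1⟩).congr_deriv (by ring)
    simp only [tanField_eq (h1 r hr).1, tanField_eq (h1 r hr).2, Pi.add_apply, Function.comp_apply]
  · have := tanField_symm (κ := κ) (z := (1 + x) / 2) ⟨by linarith [hx.1], by linarith [hx.2]⟩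
    rw [show 1 - (1 + x) / 2 = (1 - x) / 2 by ring] at this
    simp [this]

theorem energy_ge_of_lt {A : ℝ} (hA : 0 < A) (t : ℝ) :
    κ ^ 2 * ((A + 1) ^ 2 / (4 * A)) * wedgeInt (fun x s => v x s ^ 2) ≤
      A * wedgeInt (fun x s => vx x s ^ 2) +
        wedgeInt (fun x s => (vs x s + t * vx x s) ^ 2) / A := by
  have hμ := continuous_tanField hκ hκπ
  have ca : Continuous fun p : ℝ × ℝ => tanField κ ((p.2 - p.1) / 2) := hμ.comp (by fun_prop)
  have cb : Continuous fun p : ℝ × ℝ => tanField κ ((p.2 + p.1) / 2) := hμ.comp (by fun_prop)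
  have cq : Continuous fun p : ℝ × ℝ => κ ^ 2 +
      (tanField κ ((p.2 - p.1) / 2) ^ 2 + tanField κ ((p.2 + p.1) / 2) ^ 2) / 2 :=
    continuous_const.add (((ca.pow 2).add (cb.pow 2)).div_const 2)
  refine hv.energy_ge_of_fields hA
    ((cq.const_mul (-((A + 1) / (4 * A)))).add (((ca.sub cb).const_mul ((A + 1) / (4 * A))).pow 2))
    ((cq.const_mul (-((A + 1) / 4))).add (((ca.add cb).const_mul (-((A + 1) / 4))).pow 2))
    (fun x s => ?_) (fun s hs => hv.zero_le_field_x hκ hκπ (by positivity) hs)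
    (hv.zero_le_field_s hκ hκπ _ t)
  field_simp
  ring

end Fields

/-- The sharp lower bound for the anisotropic Dirichlet energy. -/
theorem energy_ge {A : ℝ} (hA : 0 < A) (t : ℝ) :
    Real.pi ^ 2 * ((A + 1) ^ 2 / (4 * A)) * wedgeInt (fun x s => v x s ^ 2) ≤
      A * wedgeInt (fun x s => vx x s ^ 2) +
        wedgeInt (fun x s => (vs x s + t * vx x s) ^ 2) / A := by
  have h : Filter.Tendsto (fun κ : ℝ => κ ^ 2 * ((A + 1) ^ 2 / (4 * A)) *
      wedgeInt (fun x s => v x s ^ 2)) (nhdsWithin Real.pi (Iio Real.pi))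
      (nhds (Real.pi ^ 2 * ((A + 1) ^ 2 / (4 * A)) * wedgeInt (fun x s => v x s ^ 2))) :=
    ((by fun_prop : Continuous fun κ : ℝ => κ ^ 2 * ((A + 1) ^ 2 / (4 * A)) *
      wedgeInt (fun x s => v x s ^ 2)).tendsto _).mono_left nhdsWithin_le_nhds
  refine le_of_tendsto h ?_
  filter_upwards [Ioo_mem_nhdsLT Real.pi_pos] with κ hκ
  exact hv.energy_ge_of_lt hκ.1 hκ.2 hA t

end WedgeFun

/-- Differentiation of an integral over the moving interval `[-s, s]`. -/
theorem hasDerivAt_integral_symm {f fs : ℝ → ℝ → ℝ} (hf : Continuous fun p : ℝ × ℝ => f p.1 p.2)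
    (hfs : Continuous fun p : ℝ × ℝ => fs p.1 p.2)
    (hd : ∀ y s, HasDerivAt (fun s => f y s) (fs y s) s) (s : ℝ) :
    HasDerivAt (fun s => ∫ y in -s..s, f y s) (f s s + f (-s) s + ∫ y in -s..s, fs y s) s := by
  have slice : ∀ {g : ℝ → ℝ → ℝ}, (Continuous fun p : ℝ × ℝ => g p.1 p.2) → ∀ r,
      Continuous fun y => g y r := fun hg r =>
    hg.comp (by fun_prop : Continuous fun y : ℝ => (y, r))
  have cI : Continuous fun p : ℝ × ℝ => ∫ y in (0 : ℝ)..p.1, fs y p.2 := by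
    refine intervalIntegral.continuous_parametric_intervalIntegral_of_continuous
      (f := fun (p : ℝ × ℝ) y => fs y p.2) ?_ continuous_fst
    exact hfs.comp (by fun_prop : Continuous fun q : (ℝ × ℝ) × ℝ => (q.2, q.1.2))
  have d2 : ∀ u r, HasDerivAt (fun r => ∫ y in (0 : ℝ)..u, f y r) (∫ y in (0 : ℝ)..u, fs y r) r := by
    intro u r
    obtain ⟨B, hB⟩ := ((isCompact_uIcc (a := (0 : ℝ)) (b := u)).prod
      (isCompact_Icc (a := r - 1) (b := r + 1))).exists_bound_of_continuousOn hfs.continuousOn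
    refine (intervalIntegral.hasDerivAt_integral_of_dominated_loc_of_deriv_le
      (F := fun r y => f y r) (F' := fun r y => fs y r) (bound := fun _ => B)
      (s := Icc (r - 1) (r + 1)) (Icc_mem_nhds (by linarith) (by linarith))
      (Filter.Eventually.of_forall fun r => (slice hf r).aestronglyMeasurable)
      ((slice hf r).intervalIntegrable _ _) (slice hfs r).aestronglyMeasurable
      (Filter.Eventually.of_forall fun y hy q hq => hB (y, q) ⟨uIoc_subset_uIcc hy, hq⟩)
      (by simp) (Filter.Eventually.of_forall fun y _ q _ => hd y q)).2
  have K : ∀ u r, HasStrictFDerivAt (fun p : ℝ × ℝ => ∫ y in (0 : ℝ)..p.1, f y p.2)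
      ((ContinuousLinearMap.toSpanSingleton ℝ (f u r)).coprod
        (ContinuousLinearMap.toSpanSingleton ℝ (∫ y in (0 : ℝ)..u, fs y r))) (u, r) := by
    intro u r
    have span : Continuous fun x : ℝ => ContinuousLinearMap.toSpanSingleton ℝ x :=
      (ContinuousLinearMap.toSpanSingletonCLE (𝕜 := ℝ) (E := ℝ)).continuous
    refine hasStrictFDerivAt_uncurry_coprod (𝕜 := ℝ) (u := (u, r))
      (f := fun u r => ∫ y in (0 : ℝ)..u, f y r)
      (f₁ := fun u r => ContinuousLinearMap.toSpanSingleton ℝ (f u r))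
      (f₂ := fun u r => ContinuousLinearMap.toSpanSingleton ℝ (∫ y in (0 : ℝ)..u, fs y r))
      (Filter.Eventually.of_forall fun p => ?_) (Filter.Eventually.of_forall fun p => ?_)
      (span.comp hf).continuousAt (span.comp cI).continuousAt
    · exact (intervalIntegral.integral_hasDerivAt_right ((slice hf _).intervalIntegrable _ _)
        ((slice hf _).stronglyMeasurableAtFilter _ _) (slice hf _).continuousAt).hasFDerivAt
    · exact (d2 p.1 p.2).hasFDerivAt
  have g1 : HasDerivAt (fun s : ℝ => (s, s)) ((1 : ℝ), (1 : ℝ)) s :=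
    (hasDerivAt_id s).prodMk (hasDerivAt_id s)
  have g2 : HasDerivAt (fun s : ℝ => (-s, s)) ((-1 : ℝ), (1 : ℝ)) s :=
    (hasDerivAt_neg s).prodMk (hasDerivAt_id s)
  have h := ((K s s).hasFDerivAt.comp_hasDerivAt (f := fun s : ℝ => (s, s)) s g1).sub
    ((K (-s) s).hasFDerivAt.comp_hasDerivAt (f := fun s : ℝ => (-s, s)) s g2)
  have sub : ∀ {g : ℝ → ℝ → ℝ}, (Continuous fun p : ℝ × ℝ => g p.1 p.2) → ∀ r,
      ∫ y in -r..r, g y r = (∫ y in (0 : ℝ)..r, g y r) - ∫ y in (0 : ℝ)..-r, g y r := fun hg r =>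
    (intervalIntegral.integral_interval_sub_left ((slice hg r).intervalIntegrable _ _)
      ((slice hg r).intervalIntegrable _ _)).symm
  have e : (fun s => ∫ y in -s..s, f y s) =
      fun s => (∫ y in (0 : ℝ)..s, f y s) - ∫ y in (0 : ℝ)..-s, f y s := funext (sub hf)
  rw [e, sub hfs]
  refine h.congr_deriv ?_
  simp
  ring

/-- Poincaré's inequality on `[0, s]` with Dirichlet conditions. -/
theorem poincare_dirichlet {s : ℝ} (hs : 0 < s) {W W' : ℝ → ℝ} (hd : ∀ x, HasDerivAt W (W' x) x)
    (hc : Continuous W') (h0 : W 0 = 0) (h1 : W s = 0) :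
    (Real.pi / s) ^ 2 * ∫ x in (0 : ℝ)..s, W x ^ 2 ≤ ∫ x in (0 : ℝ)..s, W' x ^ 2 := by
  have cW : Continuous W := continuous_iff_continuousAt.2 fun x => (hd x).continuousAt
  have cW2 : Continuous fun x => W x ^ 2 := cW.pow 2
  have cW'2 : Continuous fun x => W' x ^ 2 := hc.pow 2
  have main : ∀ κ ∈ Ioo 0 Real.pi,
      (κ / s) ^ 2 * ∫ x in (0 : ℝ)..s, W x ^ 2 ≤ ∫ x in (0 : ℝ)..s, W' x ^ 2 := by
    rintro κ ⟨hκ, hκπ⟩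
    have mem : ∀ x ∈ Icc 0 s, x / s ∈ Icc (0 : ℝ) 1 := fun x hx =>
      ⟨div_nonneg hx.1 hs.le, (div_le_one hs).2 hx.2⟩
    have cφ : Continuous fun x => (κ / s) ^ 2 * W x ^ 2 - W' x ^ 2 :=
      (cW2.const_mul _).sub cW'2
    have dT : ∀ x ∈ Icc 0 s, HasDerivAt
        (fun x => κ * Real.tan (κ * (x / s - 1 / 2)) / s * W x ^ 2)
        ((κ ^ 2 + tanField κ (x / s) ^ 2) / s ^ 2 * W x ^ 2 +
          tanField κ (x / s) / s * (2 * W x * W' x)) x := by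
      intro x hx
      have g : HasDerivAt (fun x : ℝ => x / s) (1 / s) x := (hasDerivAt_id x).div_const s
      have := (((hasDerivAt_tan_field hκ hκπ (mem x hx)).comp x g).div_const s).mul ((hd x).pow 2)
      refine this.congr_deriv ?_
      rw [tanField_eq (mem x hx)]
      simp only [Function.comp_apply, Pi.pow_apply, Nat.cast_ofNat, Nat.add_one_sub_one, pow_one]
      field_simp
    have := intervalIntegral.integral_le_sub_of_hasDeriv_right_of_le hs.le
      (fun x hx => (dT x hx).continuousAt.continuousWithinAt)
      (fun x hx => (dT x (Ioo_subset_Icc_self hx)).hasDerivWithinAt)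
      (φ := fun x => (κ / s) ^ 2 * W x ^ 2 - W' x ^ 2)
      (cφ.integrableOn_Icc) (fun x _ => ?_)
    · rw [h0, h1, intervalIntegral.integral_sub ((cW2.const_mul _).intervalIntegrable _ _)
        (cW'2.intervalIntegrable _ _), intervalIntegral.integral_const_mul] at this
      simp at this
      exact this
    · have e : (κ ^ 2 + tanField κ (x / s) ^ 2) / s ^ 2 * W x ^ 2 +
          tanField κ (x / s) / s * (2 * W x * W' x) - ((κ / s) ^ 2 * W x ^ 2 - W' x ^ 2) =
          (W' x + tanField κ (x / s) / s * W x) ^ 2 := by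
        field_simp
        ring
      have := sq_nonneg (W' x + tanField κ (x / s) / s * W x)
      linarith
  have h : Filter.Tendsto (fun κ : ℝ => (κ / s) ^ 2 * ∫ x in (0 : ℝ)..s, W x ^ 2)
      (nhdsWithin Real.pi (Iio Real.pi))
      (nhds ((Real.pi / s) ^ 2 * ∫ x in (0 : ℝ)..s, W x ^ 2)) :=
    ((by fun_prop : Continuous fun κ : ℝ => (κ / s) ^ 2 * ∫ x in (0 : ℝ)..s, W x ^ 2).tendsto
      _).mono_left nhdsWithin_le_nhds
  refine le_of_tendsto h ?_
  filter_upwards [Ioo_mem_nhdsLT Real.pi_pos] with κ hκ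
  exact main κ hκ

/-- Poincaré's inequality on `[0, s]` for functions of mean zero. -/
theorem poincare_mean_zero {s : ℝ} (hs : 0 < s) {e e' : ℝ → ℝ} (hd : ∀ x, HasDerivAt e (e' x) x)
    (hc : Continuous e') (h0 : ∫ x in (0 : ℝ)..s, e x = 0) :
    (Real.pi / s) ^ 2 * ∫ x in (0 : ℝ)..s, e x ^ 2 ≤ ∫ x in (0 : ℝ)..s, e' x ^ 2 := by
  have ce : Continuous e := continuous_iff_continuousAt.2 fun x => (hd x).continuousAt
  obtain ⟨W, hW⟩ : ∃ W : ℝ → ℝ, W = fun x => ∫ y in (0 : ℝ)..x, e y := ⟨_, rfl⟩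
  have dW : ∀ x, HasDerivAt W (e x) x := fun x => by
    rw [hW]
    exact intervalIntegral.integral_hasDerivAt_right (ce.intervalIntegrable _ _)
      (ce.stronglyMeasurableAtFilter _ _) ce.continuousAt
  have W0 : W 0 = 0 := by simp [hW]
  have W1 : W s = 0 := by simpa [hW] using h0
  have cW : Continuous W := continuous_iff_continuousAt.2 fun x => (dW x).continuousAt
  have key := poincare_dirichlet hs dW ce W0 W1
  have ibp := intervalIntegral.integral_mul_deriv_eq_deriv_mul (a := 0) (b := s)
    (fun x _ => hd x) (fun x _ => dW x) (hc.intervalIntegrable _ _) (ce.intervalIntegrable _ _)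
  rw [W0, W1] at ibp
  obtain ⟨k, hk⟩ : ∃ k, k = (Real.pi / s) ^ 2 := ⟨_, rfl⟩
  rw [← hk] at key ⊢
  have hk0 : 0 ≤ k := hk ▸ sq_nonneg _
  have c1 : Continuous fun x => e' x ^ 2 := hc.pow 2
  have c2 : Continuous fun x => 2 * k * (e' x * W x) := (hc.mul cW).const_mul _
  have c3 : Continuous fun x => k ^ 2 * W x ^ 2 := (cW.pow 2).const_mul _
  have nn : 0 ≤ ∫ x in (0 : ℝ)..s, (e' x ^ 2 + 2 * k * (e' x * W x) + k ^ 2 * W x ^ 2) :=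
    intervalIntegral.integral_nonneg hs.le fun x _ => by
      nlinarith [sq_nonneg (e' x + k * W x)]
  have c12 : Continuous fun x => e' x ^ 2 + 2 * k * (e' x * W x) := c1.add c2
  rw [intervalIntegral.integral_add (c12.intervalIntegrable _ _)
    (c3.intervalIntegrable _ _), intervalIntegral.integral_add (c1.intervalIntegrable _ _)
    (c2.intervalIntegrable _ _), intervalIntegral.integral_const_mul,
    intervalIntegral.integral_const_mul] at nn
  have e2 : ∫ x in (0 : ℝ)..s, e x ^ 2 = -∫ x in (0 : ℝ)..s, e' x * W x := by
    simp only [sq]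
    rw [ibp]
    ring
  have := mul_le_mul_of_nonneg_left key hk0
  rw [e2] at this ⊢
  nlinarith

theorem integral_symm_eq {g : ℝ → ℝ} (hg : Continuous g) (s : ℝ) :
    ∫ x in -s..s, g x = ∫ x in (0 : ℝ)..s, (g x + g (-x)) := by
  have hn : Continuous fun x => g (-x) := hg.comp continuous_neg
  rw [intervalIntegral.integral_add (hg.intervalIntegrable _ _) (hn.intervalIntegrable _ _),
    intervalIntegral.integral_comp_neg (fun x => g x), neg_zero, add_comm,
    intervalIntegral.integral_add_adjacent_intervals (hg.intervalIntegrable _ _)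
    (hg.intervalIntegrable _ _)]

/-- Wirtinger's inequality for functions of mean zero vanishing at `± s`. -/
theorem wirtinger {s : ℝ} (hs : 0 < s) {r r' : ℝ → ℝ} (hd : ∀ x, HasDerivAt r (r' x) x)
    (hc : Continuous r') (h1 : r s = 0) (h2 : r (-s) = 0) (h0 : ∫ x in -s..s, r x = 0) :
    (Real.pi / s) ^ 2 * ∫ x in -s..s, r x ^ 2 ≤ ∫ x in -s..s, r' x ^ 2 := by
  have cr : Continuous r := continuous_iff_continuousAt.2 fun x => (hd x).continuousAt
  have crn : Continuous fun x => r (-x) := cr.comp continuous_neg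
  have cn : Continuous fun x => r' (-x) := hc.comp continuous_neg
  have dn : ∀ x, HasDerivAt (fun x => r (-x)) (-r' (-x)) x := fun x => by
    have := (hd (-x)).comp x (hasDerivAt_neg x)
    rw [mul_neg_one] at this
    exact this
  have sq2 : Continuous fun x => r x ^ 2 := cr.pow 2
  have sq'2 : Continuous fun x => r' x ^ 2 := hc.pow 2
  have even := poincare_mean_zero hs (fun x => (hd x).add (dn x)) (hc.add cn.neg)
    (by
      rw [integral_symm_eq cr] at h0
      exact h0)
  have odd := poincare_dirichlet hs (fun x => (hd x).sub (dn x)) (hc.sub cn.neg) (by simp)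
    (by simp [h1, h2])
  have ca : Continuous fun x => (r x + r (-x)) ^ 2 := (cr.add crn).pow 2
  have cb : Continuous fun x => (r x - r (-x)) ^ 2 := (cr.sub crn).pow 2
  have ca' : Continuous fun x => (r' x + -r' (-x)) ^ 2 := (hc.add cn.neg).pow 2
  have cb' : Continuous fun x => (r' x - -r' (-x)) ^ 2 := (hc.sub cn.neg).pow 2
  have e1 : 2 * ∫ x in -s..s, r x ^ 2 =
      (∫ x in (0 : ℝ)..s, (r x + r (-x)) ^ 2) + ∫ x in (0 : ℝ)..s, (r x - r (-x)) ^ 2 := by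
    rw [integral_symm_eq sq2, ← intervalIntegral.integral_const_mul,
      ← intervalIntegral.integral_add (ca.intervalIntegrable _ _) (cb.intervalIntegrable _ _)]
    congr 1
    funext x
    ring
  have e2 : 2 * ∫ x in -s..s, r' x ^ 2 = (∫ x in (0 : ℝ)..s, (r' x + -r' (-x)) ^ 2) +
      ∫ x in (0 : ℝ)..s, (r' x - -r' (-x)) ^ 2 := by
    rw [integral_symm_eq sq'2, ← intervalIntegral.integral_const_mul,
      ← intervalIntegral.integral_add (ca'.intervalIntegrable _ _) (cb'.intervalIntegrable _ _)]
    congr 1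
    funext x
    ring
  simp only [Pi.add_apply, Pi.sub_apply] at even odd
  have := congrArg (fun z => (Real.pi / s) ^ 2 * z) e1
  simp only [mul_add] at this
  linarith

theorem integral_lin_comb {f g h : ℝ → ℝ} (hf : Continuous f) (hg : Continuous g)
    (hh : Continuous h) (a b α β γ : ℝ) :
    ∫ x in a..b, (α * f x + β * g x + γ * h x) =
      α * (∫ x in a..b, f x) + β * (∫ x in a..b, g x) + γ * ∫ x in a..b, h x := by
  have c1 : Continuous fun x => α * f x := hf.const_mul α
  have c2 : Continuous fun x => β * g x := hg.const_mul β
  have c3 : Continuous fun x => γ * h x := hh.const_mul γ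
  have c12 : Continuous fun x => α * f x + β * g x := c1.add c2
  rw [intervalIntegral.integral_add (c12.intervalIntegrable _ _) (c3.intervalIntegrable _ _),
    intervalIntegral.integral_add (c1.intervalIntegrable _ _) (c2.intervalIntegrable _ _),
    intervalIntegral.integral_const_mul, intervalIntegral.integral_const_mul,
    intervalIntegral.integral_const_mul]

theorem integral_id_sq_symm (s : ℝ) : ∫ x in -s..s, x * x = 2 / 3 * s ^ 3 := by
  simp only [← sq, integral_pow]
  norm_num
  ring

/-- Bessel's inequality for the orthogonal functions `1` and `x`. -/
theorem sq_integral_add_sq_moment_le {g : ℝ → ℝ} (hg : Continuous g) {s : ℝ} (hs : 0 < s)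
    (hs1 : s ≤ 1) :
    (∫ x in -s..s, g x) ^ 2 / (2 * s) + (∫ x in -s..s, x * g x) ^ 2 ≤ ∫ x in -s..s, g x ^ 2 := by
  have c2 : Continuous fun x => g x ^ 2 := hg.pow 2
  have cx : Continuous fun x => x * g x := continuous_id.mul hg
  obtain ⟨α, hα⟩ : ∃ α, α = (∫ x in -s..s, g x) / (2 * s) := ⟨_, rfl⟩
  obtain ⟨m, hm⟩ : ∃ m, m = ∫ x in -s..s, x * g x := ⟨_, rfl⟩
  have nn : 0 ≤ ∫ x in -s..s, (g x - α - m * x) ^ 2 :=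
    intervalIntegral.integral_nonneg (by linarith) fun x _ => sq_nonneg _
  have e : ∀ x, (g x - α - m * x) ^ 2 = 1 * (1 * g x ^ 2 + (-2 * α) * g x + (-2 * m) * (x * g x)) +
      1 * (α ^ 2 * 1 + (2 * α * m) * x + m ^ 2 * (x * x)) + 0 * 0 := fun x => by ring
  simp only [e] at nn
  rw [integral_lin_comb (by fun_prop) (by fun_prop) continuous_const,
    integral_lin_comb c2 hg cx, integral_lin_comb continuous_const continuous_id'
      (by fun_prop), integral_id_sq_symm, integral_id, ← hm] at nn
  have hF : ∫ x in -s..s, g x = 2 * s * α := by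
    rw [hα]
    field_simp
  rw [hF] at nn ⊢
  simp at nn
  rw [← hm]
  have h3 : s ^ 3 ≤ 1 := pow_le_one₀ hs.le hs1
  have h4 := mul_le_mul_of_nonneg_left h3 (sq_nonneg m)
  have e2 : (2 * s * α) ^ 2 / (2 * s) = 2 * s * α ^ 2 := by field_simp
  rw [e2]
  nlinarith

/-- Half of `π ∫ (cos π x - cos π s)` over `[-s, s]`. -/
def capMass (s : ℝ) : ℝ := Real.sin (Real.pi * s) - Real.pi * s * Real.cos (Real.pi * s)

theorem hasDerivAt_capMass (s : ℝ) :
    HasDerivAt capMass (Real.pi ^ 2 * s * Real.sin (Real.pi * s)) s := by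
  have h : HasDerivAt (fun s : ℝ => Real.pi * s) Real.pi s := by
    simpa using (hasDerivAt_id s).const_mul Real.pi
  refine (h.sin.sub (h.mul h.cos)).congr_deriv ?_
  ring

theorem capMass_half : capMass (1 / 2) = 1 := by
  rw [capMass, show Real.pi * (1 / 2) = Real.pi / 2 by ring]
  simp

theorem sin_pi_mul_nonneg {s : ℝ} (h0 : 0 ≤ s) (h1 : s ≤ 1) : 0 ≤ Real.sin (Real.pi * s) :=
  Real.sin_nonneg_of_nonneg_of_le_pi (by have := Real.pi_pos; positivity)
    (by nlinarith [Real.pi_pos])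

theorem pow_three_le_capMass {s : ℝ} (h0 : 0 ≤ s) (h1 : s ≤ 1) : s ^ 3 ≤ capMass s := by
  rcases le_total s (1 / 2) with h | h
  · have mono : MonotoneOn (fun s => capMass s - s ^ 3) (Icc 0 (1 / 2)) := by
      have d : ∀ x : ℝ, HasDerivAt (fun s => capMass s - s ^ 3)
          (Real.pi ^ 2 * x * Real.sin (Real.pi * x) - 3 * x ^ 2) x := fun x => by
        exact ((hasDerivAt_capMass x).sub (hasDerivAt_pow 3 x)).congr_deriv (by norm_num)
      refine monotoneOn_of_deriv_nonneg (convex_Icc _ _)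
        (fun x _ => (d x).continuousAt.continuousWithinAt)
        (fun x _ => (d x).differentiableAt.differentiableWithinAt) fun x hx => ?_
      rw [interior_Icc] at hx
      rw [(d x).deriv]
      have hj := Real.mul_le_sin (x := Real.pi * x) (by have := Real.pi_pos; have := hx.1; positivity)
        (by nlinarith [Real.pi_pos, hx.2])
      have e : 2 / Real.pi * (Real.pi * x) = 2 * x := by
        field_simp
      rw [e] at hj
      have hp : (3 : ℝ) ≤ Real.pi ^ 2 := by nlinarith [Real.pi_gt_three]
      have h2 := mul_le_mul_of_nonneg_left hj (by have := hx.1; positivity : 0 ≤ Real.pi ^ 2 * x)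
      nlinarith [mul_le_mul_of_nonneg_right hp (sq_nonneg x), sq_nonneg x]
    have := mono (by norm_num : (0 : ℝ) ∈ Icc (0 : ℝ) (1 / 2)) ⟨h0, h⟩ h0
    simp [capMass] at this
    rw [capMass]
    linarith
  · have mono : MonotoneOn capMass (Icc (1 / 2) 1) := by
      refine monotoneOn_of_deriv_nonneg (convex_Icc _ _)
        (fun x _ => (hasDerivAt_capMass x).continuousAt.continuousWithinAt)
        (fun x _ => (hasDerivAt_capMass x).differentiableAt.differentiableWithinAt) fun x hx => ?_
      rw [interior_Icc] at hx
      rw [(hasDerivAt_capMass x).deriv]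
      have hx0 : 0 ≤ x := by linarith [hx.1]
      exact mul_nonneg (by positivity) (sin_pi_mul_nonneg hx0 hx.2.le)
    have := mono (by norm_num : (1 / 2 : ℝ) ∈ Icc (1 / 2 : ℝ) 1) ⟨h, h1⟩ h
    rw [capMass_half] at this
    exact (pow_le_one₀ h0 h1).trans this

theorem capMass_pos {s : ℝ} (h0 : 0 < s) (h1 : s ≤ 1) : 0 < capMass s :=
  (by positivity : 0 < s ^ 3).trans_le (pow_three_le_capMass h0.le h1)

theorem integral_cap (s : ℝ) :
    ∫ x in -s..s, (Real.cos (Real.pi * x) - Real.cos (Real.pi * s)) = 2 * capMass s / Real.pi := by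
  have hp := Real.pi_pos.ne'
  have d : ∀ x ∈ uIcc (-s) s, HasDerivAt
      (fun x => Real.sin (Real.pi * x) / Real.pi - x * Real.cos (Real.pi * s))
      (Real.cos (Real.pi * x) - Real.cos (Real.pi * s)) x := fun x _ => by
    have h : HasDerivAt (fun s : ℝ => Real.pi * s) Real.pi x := by
      simpa using (hasDerivAt_id x).const_mul Real.pi
    refine ((h.sin.div_const Real.pi).sub ((hasDerivAt_id x).mul_const _)).congr_deriv ?_
    field_simp
  rw [intervalIntegral.integral_eq_sub_of_hasDerivAt d (by
    apply Continuous.intervalIntegrable; fun_prop), capMass]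
  simp only [mul_neg, Real.sin_neg]
  field_simp
  ring

theorem cap_bounds {s x : ℝ} (hs1 : s ≤ 1) (hx : x ∈ Icc (-s) s) :
    (Real.cos (Real.pi * x) - Real.cos (Real.pi * s)) ^ 2 ≤ Real.pi ^ 4 * s ^ 4 / 4 := by
  have hp := Real.pi_pos
  have hs : 0 ≤ s := by linarith [hx.1, hx.2]
  have h1 : Real.cos (Real.pi * s) ≤ Real.cos (Real.pi * x) := by
    rw [← Real.cos_abs (Real.pi * x), abs_mul, abs_of_pos hp]
    exact Real.cos_le_cos_of_nonneg_of_le_pi (by positivity) (by nlinarith)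
      (mul_le_mul_of_nonneg_left (abs_le.2 hx) hp.le)
  have h2 := Real.one_sub_sq_div_two_le_cos (x := Real.pi * s)
  have h3 := Real.cos_le_one (Real.pi * x)
  have h4 : Real.cos (Real.pi * x) - Real.cos (Real.pi * s) ≤ Real.pi ^ 2 * s ^ 2 / 2 := by
    nlinarith
  calc _ ≤ (Real.pi ^ 2 * s ^ 2 / 2) ^ 2 := pow_le_pow_left₀ (by linarith) h4 2
    _ = _ := by ring

theorem integral_cap_form {s : ℝ} {u u' : ℝ → ℝ} (hd : ∀ x, HasDerivAt u (u' x) x)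
    (hc : Continuous u') (h1 : u s = 0) (h2 : u (-s) = 0) :
    (∫ x in -s..s, -(Real.pi * Real.sin (Real.pi * x)) * u' x) -
      Real.pi ^ 2 * ∫ x in -s..s, (Real.cos (Real.pi * x) - Real.cos (Real.pi * s)) * u x =
      Real.pi ^ 2 * Real.cos (Real.pi * s) * ∫ x in -s..s, u x := by
  have cu : Continuous u := continuous_iff_continuousAt.2 fun x => (hd x).continuousAt
  have d : ∀ x ∈ uIcc (-s) s, HasDerivAt (fun x => -(Real.pi * Real.sin (Real.pi * x)))
      (-(Real.pi ^ 2 * Real.cos (Real.pi * x))) x := fun x _ => by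
    have h : HasDerivAt (fun s : ℝ => Real.pi * s) Real.pi x := by
      simpa using (hasDerivAt_id x).const_mul Real.pi
    refine (h.sin.const_mul Real.pi).neg.congr_deriv ?_
    ring
  have ibp := intervalIntegral.integral_mul_deriv_eq_deriv_mul d (fun x _ => hd x)
    (by apply Continuous.intervalIntegrable; fun_prop) (hc.intervalIntegrable _ _)
  rw [h1, h2] at ibp
  rw [ibp]
  have e : ∀ x, -(Real.pi ^ 2 * Real.cos (Real.pi * x)) * u x =
      -Real.pi ^ 2 * ((Real.cos (Real.pi * x) - Real.cos (Real.pi * s)) * u x) +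
      -Real.pi ^ 2 * Real.cos (Real.pi * s) * u x + 0 * 0 := fun x => by ring
  simp only [e]
  rw [integral_lin_comb (by fun_prop) cu continuous_const]
  ring

/-- A function vanishing at `± s`, split into a multiple of `cos π x - cos π s` and a part of
mean zero with square integral `ρ`. -/
theorem exists_slice_split {s : ℝ} (hs : 0 < s) (hs1 : s ≤ 1) {u u' : ℝ → ℝ}
    (hd : ∀ x, HasDerivAt u (u' x) x) (hc : Continuous u') (h1 : u s = 0) (h2 : u (-s) = 0) :
    ∃ ρ : ℝ, Real.pi ^ 3 * Real.cos (Real.pi * s) / (2 * capMass s) * (∫ x in -s..s, u x) ^ 2 +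
        Real.pi ^ 2 * (1 / s ^ 2 - 1) * ρ ≤
        (∫ x in -s..s, u' x ^ 2) - Real.pi ^ 2 * ∫ x in -s..s, u x ^ 2 ∧
      (∫ x in -s..s, x * u x) ^ 2 ≤ ρ ∧
      s * ∫ x in -s..s, u x ^ 2 ≤ 2 * ρ + Real.pi ^ 6 / 4 * (∫ x in -s..s, u x) ^ 2 := by
  have hp := Real.pi_pos
  have hF0 := capMass_pos hs hs1
  have cu : Continuous u := continuous_iff_continuousAt.2 fun x => (hd x).continuousAt
  obtain ⟨p, hpp⟩ : ∃ p : ℝ → ℝ, p = fun x => Real.cos (Real.pi * x) - Real.cos (Real.pi * s) :=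
    ⟨_, rfl⟩
  obtain ⟨p', hp'⟩ : ∃ p' : ℝ → ℝ, p' = fun x => -(Real.pi * Real.sin (Real.pi * x)) := ⟨_, rfl⟩
  have cp : Continuous p := by rw [hpp]; fun_prop
  have cp' : Continuous p' := by rw [hp']; fun_prop
  have dp : ∀ x, HasDerivAt p (p' x) x := fun x => by
    have h : HasDerivAt (fun s : ℝ => Real.pi * s) Real.pi x := by
      simpa using (hasDerivAt_id x).const_mul Real.pi
    rw [hpp, hp']
    refine (h.cos.sub_const _).congr_deriv ?_
    ring
  have ps : p s = 0 := by simp [hpp]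
  have pn : p (-s) = 0 := by simp [hpp]
  have formu := integral_cap_form hd hc h1 h2
  have formp := integral_cap_form dp cp' ps pn
  have intp := integral_cap s
  have hp2 : ∫ x in -s..s, p x ^ 2 ≤ Real.pi ^ 4 * s ^ 5 / 2 := by
    have := intervalIntegral.integral_mono_on (a := -s) (b := s) (μ := volume) (by linarith)
      ((cp.pow 2).intervalIntegrable _ _) (continuous_const.intervalIntegrable _ _)
      (g := fun _ => Real.pi ^ 4 * s ^ 4 / 4)
      (fun x hx => by rw [hpp]; exact cap_bounds hs1 hx)
    rw [intervalIntegral.integral_const] at this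
    refine this.trans_eq ?_
    simp
    ring
  have xp : ∫ x in -s..s, x * p x = 0 := by
    have h := integral_symm_eq (g := fun x => x * p x) (continuous_id.mul cp) s
    rw [h]
    have : ∀ x, x * p x + -x * p (-x) = 0 := fun x => by simp [hpp]
    simp only [this, intervalIntegral.integral_zero]
  rw [show (fun x => Real.cos (Real.pi * x) - Real.cos (Real.pi * s)) = p from hpp.symm] at intp
  have ep : ∀ x, Real.cos (Real.pi * x) - Real.cos (Real.pi * s) = p x := fun x => by rw [hpp]
  have ep' : ∀ x, -(Real.pi * Real.sin (Real.pi * x)) = p' x := fun x => by rw [hp']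
  simp only [ep, ep'] at formu formp
  clear hpp hp' ep ep'
  obtain ⟨F, hF⟩ : ∃ F, F = ∫ x in -s..s, u x := ⟨_, rfl⟩
  obtain ⟨c, hcc⟩ : ∃ c, c = F * Real.pi / (2 * capMass s) := ⟨_, rfl⟩
  have cr : Continuous fun x => u x - c * p x := cu.sub (cp.const_mul c)
  have cr' : Continuous fun x => u' x - c * p' x := hc.sub (cp'.const_mul c)
  have cxu : Continuous fun x => x * u x := continuous_id.mul cu
  have cxp : Continuous fun x => x * p x := continuous_id.mul cp
  have cu2 : Continuous fun x => u x ^ 2 := cu.pow 2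
  have cp2 : Continuous fun x => p x ^ 2 := cp.pow 2
  have cr2 : Continuous fun x => (u x - c * p x) ^ 2 := cr.pow 2
  have cu'2 : Continuous fun x => u' x ^ 2 := hc.pow 2
  have cpu : Continuous fun x => p x * u x := cp.mul cu
  have cpp : Continuous fun x => p x * p x := cp.mul cp
  have cpu' : Continuous fun x => p' x * u' x := cp'.mul hc
  have cpp' : Continuous fun x => p' x * p' x := cp'.mul cp'
  have dr : ∀ x, HasDerivAt (fun x => u x - c * p x) (u' x - c * p' x) x := fun x =>
    (hd x).sub ((dp x).const_mul c)
  have cP : c * (2 * capMass s / Real.pi) = F := by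
    rw [hcc]
    field_simp
  have mean : ∫ x in -s..s, (u x - c * p x) = 0 := by
    have e : ∀ x, u x - c * p x = 1 * u x + (-c) * p x + 0 * 0 := fun x => by ring
    simp only [e]
    rw [integral_lin_comb cu cp continuous_const, intp, ← hF]
    linarith
  have wirt := wirtinger hs dr cr' (by simp [h1, ps]) (by simp [h2, pn]) mean
  have mom : ∫ x in -s..s, x * (u x - c * p x) = ∫ x in -s..s, x * u x := by
    have e : ∀ x, x * (u x - c * p x) = 1 * (x * u x) + (-c) * (x * p x) + 0 * 0 := fun x => by ring
    simp only [e]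
    rw [integral_lin_comb cxu cxp continuous_const, xp]
    ring
  have bess := sq_integral_add_sq_moment_le cr hs hs1
  rw [mean, mom] at bess
  have sq1 : ∫ x in -s..s, (u x - c * p x) ^ 2 = (∫ x in -s..s, u x ^ 2) +
      (-2 * c) * (∫ x in -s..s, p x * u x) + c ^ 2 * ∫ x in -s..s, p x * p x := by
    rw [← one_mul (∫ x in -s..s, u x ^ 2), ← integral_lin_comb cu2 cpu cpp]
    congr 1
    funext x
    ring
  have sq2 : ∫ x in -s..s, (u' x - c * p' x) ^ 2 = (∫ x in -s..s, u' x ^ 2) +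
      (-2 * c) * (∫ x in -s..s, p' x * u' x) + c ^ 2 * ∫ x in -s..s, p' x * p' x := by
    rw [← one_mul (∫ x in -s..s, u' x ^ 2),
      ← integral_lin_comb cu'2 cpu' cpp']
    congr 1
    funext x
    ring
  refine ⟨∫ x in -s..s, (u x - c * p x) ^ 2, ?_, by simpa using bess, ?_⟩
  · rw [intp] at formp
    rw [← hF] at formu ⊢
    have e1 : Real.pi ^ 3 * Real.cos (Real.pi * s) / (2 * capMass s) * F ^ 2 =
        Real.pi ^ 2 * Real.cos (Real.pi * s) * (c * F) := by
      rw [hcc]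
      field_simp
    have e2 : Real.pi ^ 2 * (1 / s ^ 2 - 1) * (∫ x in -s..s, (u x - c * p x) ^ 2) =
        (Real.pi / s) ^ 2 * (∫ x in -s..s, (u x - c * p x) ^ 2) -
          Real.pi ^ 2 * (∫ x in -s..s, (u x - c * p x) ^ 2) := by
      field_simp
    have e3 : c ^ 2 * (Real.pi ^ 2 * Real.cos (Real.pi * s) * (2 * capMass s / Real.pi)) =
        Real.pi ^ 2 * Real.cos (Real.pi * s) * (c * F) := by
      rw [← cP]
      ring
    rw [e1, e2]
    refine (add_le_add_right (sub_le_sub_right wirt _) _).trans ?_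
    rw [sq1, sq2]
    linear_combination -2 * c * formu + c ^ 2 * formp + e3
  · have le : ∫ x in -s..s, u x ^ 2 ≤
        2 * (∫ x in -s..s, (u x - c * p x) ^ 2) + 2 * c ^ 2 * (∫ x in -s..s, p x ^ 2) + 0 * ∫ x in -s..s, (0 : ℝ) := by
      rw [← integral_lin_comb cr2 cp2 continuous_const]
      refine intervalIntegral.integral_mono_on (by linarith) (cu2.intervalIntegrable _ _)
        (Continuous.intervalIntegrable ?_ _ _) fun x _ => ?_
      · have c1 : Continuous fun x => 2 * (u x - c * p x) ^ 2 := cr2.const_mul 2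
        have c2 : Continuous fun x => 2 * c ^ 2 * p x ^ 2 := cp2.const_mul _
        exact (c1.add c2).add continuous_const
      · nlinarith [sq_nonneg (u x - 2 * (c * p x))]
    have ρ0 : 0 ≤ ∫ x in -s..s, (u x - c * p x) ^ 2 :=
      intervalIntegral.integral_nonneg (by linarith) fun x _ => sq_nonneg _
    have e4 : s * (c ^ 2 * (Real.pi ^ 4 * s ^ 5 / 2)) * 2 ≤ Real.pi ^ 6 / 4 * F ^ 2 := by
      have h6 : (s ^ 3) ^ 2 ≤ capMass s ^ 2 :=
        pow_le_pow_left₀ (by positivity) (pow_three_le_capMass hs.le hs1) 2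
      have e5 : c ^ 2 * capMass s ^ 2 = F ^ 2 * Real.pi ^ 2 / 4 := by
        rw [hcc]
        field_simp
        norm_num
      have := mul_le_mul_of_nonneg_left h6 (by positivity : 0 ≤ c ^ 2 * Real.pi ^ 4)
      have e6 : c ^ 2 * Real.pi ^ 4 * capMass s ^ 2 = F ^ 2 * Real.pi ^ 6 / 4 := by
        rw [mul_right_comm, e5]
        ring
      nlinarith
    rw [← hF]
    have h5 := mul_le_mul_of_nonneg_left (mul_le_mul_of_nonneg_left hp2 (sq_nonneg c)) hs.le
    have h7 := mul_le_mul_of_nonneg_left le hs.le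
    have h8 := mul_le_mul_of_nonneg_right hs1 ρ0
    generalize (∫ x in -s..s, (u x - c * p x) ^ 2) = ρ at *
    generalize (∫ x in -s..s, u x ^ 2) = N at *
    generalize (∫ x in -s..s, p x ^ 2) = P at *
    have e9 : s * (2 * ρ + 2 * c ^ 2 * P + 0 * ∫ x in -s..s, (0 : ℝ)) =
      2 * (s * ρ) + 2 * (s * (c ^ 2 * P)) := by ring
    linarith

/-- Integral over the horizontal slice of the triangle at height `s`. -/
def sliceInt (f : ℝ → ℝ → ℝ) (s : ℝ) : ℝ := ∫ y in -s..s, f y s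

theorem wedgeInt_eq (f : ℝ → ℝ → ℝ) : wedgeInt f = ∫ s in (0 : ℝ)..1, sliceInt f s := rfl

theorem sliceInt_zero (f : ℝ → ℝ → ℝ) : sliceInt f 0 = 0 := by simp [sliceInt]

theorem continuous_sliceInt {f : ℝ → ℝ → ℝ} (hf : Continuous fun p : ℝ × ℝ => f p.1 p.2) :
    Continuous (sliceInt f) :=
  continuous_integral_symm hf

namespace WedgeFun

variable {v vx vs : ℝ → ℝ → ℝ} (hv : WedgeFun v vx vs)
include hv

theorem cont_slice_line (t s : ℝ) : Continuous fun x => vs x s + t * vx x s :=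
  (hv.cont_line t).comp (by fun_prop : Continuous fun x : ℝ => (x, s))

theorem cont_slice_s (s : ℝ) : Continuous fun x => vs x s :=
  hv.cont_s.comp (by fun_prop : Continuous fun x : ℝ => (x, s))

theorem hasDerivAt_sliceInt (t : ℝ) {s : ℝ} (hs : s ∈ Icc (0 : ℝ) 1) :
    HasDerivAt (sliceInt v) (sliceInt (fun x s => vs x s + t * vx x s) s) s := by
  refine (hasDerivAt_integral_symm hv.cont hv.cont_s hv.ds s).congr_deriv ?_
  rw [hv.right s hs, hv.left s hs, sliceInt, intervalIntegral.integral_add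
    ((hv.cont_slice_s s).intervalIntegrable _ _)
    (((hv.cont_slice_x s).const_mul t).intervalIntegrable _ _),
    intervalIntegral.integral_const_mul, intervalIntegral.integral_eq_sub_of_hasDerivAt
    (fun x _ => hv.dx x s) ((hv.cont_slice_x s).intervalIntegrable _ _), hv.right s hs,
    hv.left s hs]
  ring

theorem hasDerivAt_sliceInt_moment (t : ℝ) {s : ℝ} (hs : s ∈ Icc (0 : ℝ) 1) :
    HasDerivAt (sliceInt fun x s => x * v x s)
      (sliceInt (fun x s => x * (vs x s + t * vx x s)) s + t * sliceInt v s) s := by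
  have c1 : Continuous fun p : ℝ × ℝ => p.1 * v p.1 p.2 := continuous_fst.mul hv.cont
  have c2 : Continuous fun p : ℝ × ℝ => p.1 * vs p.1 p.2 := continuous_fst.mul hv.cont_s
  refine (hasDerivAt_integral_symm (f := fun x s => x * v x s) (fs := fun x s => x * vs x s)
    c1 c2 (fun y s => (hv.ds y s).const_mul y) s).congr_deriv ?_
  have ibp := intervalIntegral.integral_mul_deriv_eq_deriv_mul (a := -s) (b := s)
    (fun x _ => hasDerivAt_id x) (fun x _ => hv.dx x s) (by simp)
    ((hv.cont_slice_x s).intervalIntegrable _ _)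
  simp only [id, hv.right s hs, hv.left s hs, one_mul, mul_zero, sub_zero, zero_sub] at ibp
  have c3 : Continuous fun x => x * vs x s := continuous_id.mul (hv.cont_slice_s s)
  have c4 : Continuous fun x => x * vx x s := continuous_id.mul (hv.cont_slice_x s)
  have e : ∀ x, x * (vs x s + t * vx x s) = 1 * (x * vs x s) + t * (x * vx x s) + 0 * 0 :=
    fun x => by ring
  simp only [sliceInt, e, hv.right s hs, hv.left s hs]
  rw [integral_lin_comb c3 c4 continuous_const, ibp]
  ring

theorem hasDerivAt_sliceInt_sq (t : ℝ) {s : ℝ} (hs : s ∈ Icc (0 : ℝ) 1) :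
    HasDerivAt (sliceInt fun x s => v x s ^ 2)
      (2 * sliceInt (fun x s => v x s * (vs x s + t * vx x s)) s) s := by
  have c1 : Continuous fun p : ℝ × ℝ => v p.1 p.2 ^ 2 := hv.cont.pow 2
  have c2 : Continuous fun p : ℝ × ℝ => 2 * (v p.1 p.2 * vs p.1 p.2) :=
    (hv.cont.mul hv.cont_s).const_mul 2
  have d2 : ∀ y s, HasDerivAt (fun s => v y s ^ 2) (2 * (v y s * vs y s)) s := fun y s =>
    ((hv.ds y s).pow 2).congr_deriv (by norm_num; ring)
  refine (hasDerivAt_integral_symm (f := fun x s => v x s ^ 2)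
    (fs := fun x s => 2 * (v x s * vs x s)) c1 c2 d2 s).congr_deriv ?_
  have ibp := intervalIntegral.integral_mul_deriv_eq_deriv_mul (a := -s) (b := s)
    (fun x _ => hv.dx x s) (fun x _ => hv.dx x s) ((hv.cont_slice_x s).intervalIntegrable _ _)
    ((hv.cont_slice_x s).intervalIntegrable _ _)
  simp only [hv.right s hs, hv.left s hs, mul_zero, sub_zero, zero_sub, mul_comm (vx _ _)] at ibp
  have c3 : Continuous fun x => v x s * vs x s := (hv.cont_slice s).mul (hv.cont_slice_s s)
  have c4 : Continuous fun x => v x s * vx x s := (hv.cont_slice s).mul (hv.cont_slice_x s)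
  have e : ∀ x, v x s * (vs x s + t * vx x s) =
    1 * (v x s * vs x s) + t * (v x s * vx x s) + 0 * 0 := fun x => by ring
  simp only [sliceInt, e, hv.right s hs, hv.left s hs]
  rw [integral_lin_comb c3 c4 continuous_const, intervalIntegral.integral_const_mul]
  have z : ∫ x in -s..s, v x s * vx x s = 0 := by linarith
  rw [z]
  ring

theorem sq_sliceInt_le {s : ℝ} (hs : 0 < s) (hs1 : s ≤ 1) :
    sliceInt v s ^ 2 ≤ 2 * sliceInt (fun x s => v x s ^ 2) s := by
  have h := sq_integral_add_sq_moment_le (hv.cont_slice s) hs hs1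
  have h0 := sq_nonneg (∫ x in -s..s, x * v x s)
  have h1 : (∫ x in -s..s, v x s) ^ 2 / (2 * s) ≤ sliceInt (fun x s => v x s ^ 2) s :=
    (le_add_of_nonneg_right h0).trans h
  rw [div_le_iff₀ (by positivity)] at h1
  have h2 : 0 ≤ sliceInt (fun x s => v x s ^ 2) s :=
    intervalIntegral.integral_nonneg (by linarith) fun x _ => sq_nonneg _
  have h3 : sliceInt v s ^ 2 ≤ sliceInt (fun x s => v x s ^ 2) s * (2 * s) := h1
  nlinarith

theorem sliceInt_line_bounds (t : ℝ) {s : ℝ} (hs : 0 < s) (hs1 : s ≤ 1) :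
    sliceInt (fun x s => vs x s + t * vx x s) s ^ 2 / (2 * s) +
      sliceInt (fun x s => x * (vs x s + t * vx x s)) s ^ 2 ≤
      sliceInt (fun x s => (vs x s + t * vx x s) ^ 2) s :=
  sq_integral_add_sq_moment_le (hv.cont_slice_line t s) hs hs1

theorem exists_abs_sliceInt_le : ∃ C, 0 ≤ C ∧ ∀ s ∈ Icc (0 : ℝ) 1, |sliceInt v s| ≤ C * s ^ 2 := by
  obtain ⟨L, hL, hb⟩ := hv.exists_bound
  refine ⟨4 * L, by positivity, fun s hs => ?_⟩
  have h := intervalIntegral.norm_integral_le_of_norm_le_const (a := -s) (b := s)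
    (f := fun x => v x s) (C := L * (2 * s)) (fun x hx => ?_)
  · rw [abs_of_nonneg (by linarith [hs.1])] at h
    exact h.trans_eq (by ring)
  · rw [uIoc_of_le (by linarith [hs.1])] at hx
    have := hv.lipschitz hb (x := s) (x' := x) (by rw [abs_of_nonneg hs.1]; exact hs.2)
      (abs_le.2 ⟨by linarith [hx.1, hs.2], by linarith [hx.2, hs.2]⟩) hs hs
    rw [hv.right s hs, sub_zero, sub_self, abs_zero, add_zero, abs_of_nonpos (sub_nonpos.2 hx.2)]
      at this
    exact this.trans (mul_le_mul_of_nonneg_left (by linarith [hx.1]) hL.le)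

end WedgeFun

theorem two_mul_sq_one_sub_le {s : ℝ} (h0 : 0 < s) (h1 : s ≤ 1) :
    2 * (1 - s) ^ 2 ≤ Real.pi ^ 2 * (1 / s ^ 2 - 1) := by
  have h2 : (1 - s) ^ 2 ≤ 1 / s ^ 2 - 1 := by
    have h3 : (1 - s) ^ 2 + 1 ≤ 1 / s ^ 2 := by
      rw [le_div_iff₀ (by positivity)]
      have h4 : 0 ≤ s * (1 - s) := mul_nonneg h0.le (by linarith)
      have h5 : s * (1 - s) ≤ 1 := by nlinarith
      nlinarith [mul_nonneg h4 (sub_nonneg.2 h5), mul_nonneg h4 h0.le]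
    linarith
  have h6 : (2 : ℝ) ≤ Real.pi ^ 2 := by nlinarith [Real.pi_gt_three]
  exact mul_le_mul h6 h2 (sq_nonneg _) (sq_nonneg _)

theorem sq_one_sub_le {s : ℝ} (h0 : 0 < s) (h1 : s ≤ 1) :
    (1 - s) ^ 2 ≤ Real.pi ^ 2 * (1 / s ^ 2 - 1) := by
  linarith [two_mul_sq_one_sub_le h0 h1, sq_nonneg (1 - s)]

namespace WedgeFun

variable {v vx vs : ℝ → ℝ → ℝ} (hv : WedgeFun v vx vs)
include hv

theorem continuousOn_riccati :
    ContinuousOn (fun s => Real.pi ^ 2 * Real.sin (Real.pi * s) / (2 * capMass s) * sliceInt v s ^ 2)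
      (Icc 0 1) := by
  obtain ⟨C, hC, hF⟩ := hv.exists_abs_sliceInt_le
  have hp := Real.pi_pos
  rintro s ⟨h0, h1⟩
  rcases h0.eq_or_lt with rfl | h0
  · have bound : ∀ r ∈ Icc (0 : ℝ) 1,
        ‖Real.pi ^ 2 * Real.sin (Real.pi * r) / (2 * capMass r) * sliceInt v r ^ 2‖ ≤
          Real.pi ^ 3 * C ^ 2 / 2 * r ^ 2 := by
      rintro r ⟨hr0, hr1⟩
      rcases hr0.eq_or_lt with rfl | hr0
      · simp
      have h3 := pow_three_le_capMass hr0.le hr1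
      have hm := capMass_pos hr0 hr1
      have hsin := sin_pi_mul_nonneg hr0.le hr1
      have hsin' : Real.sin (Real.pi * r) ≤ Real.pi * r := Real.sin_le (by positivity)
      have hF2 : sliceInt v r ^ 2 ≤ (C * r ^ 2) ^ 2 := sq_le_sq' (abs_le.1 (hF r ⟨hr0.le, hr1⟩)).1
        (abs_le.1 (hF r ⟨hr0.le, hr1⟩)).2
      rw [Real.norm_of_nonneg (by positivity)]
      calc _ ≤ Real.pi ^ 2 * (Real.pi * r) / (2 * r ^ 3) * (C * r ^ 2) ^ 2 := by gcongr
        _ = _ := by field_simp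
    have lim : Filter.Tendsto (fun r : ℝ => Real.pi ^ 3 * C ^ 2 / 2 * r ^ 2)
        (nhdsWithin 0 (Icc 0 1)) (nhds 0) := by
      have : Continuous fun r : ℝ => Real.pi ^ 3 * C ^ 2 / 2 * r ^ 2 := by fun_prop
      simpa using (this.tendsto 0).mono_left nhdsWithin_le_nhds
    have := squeeze_zero_norm' (Filter.eventually_of_mem self_mem_nhdsWithin bound) lim
    rw [ContinuousWithinAt]
    simpa using this
  · have hm := capMass_pos h0 h1
    have c1 : ContinuousAt capMass s := (hasDerivAt_capMass s).continuousAt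
    have c2 : ContinuousAt (fun s => 2 * capMass s) s := c1.const_mul 2
    have c3 : ContinuousAt (fun s => Real.pi ^ 2 * Real.sin (Real.pi * s)) s := by fun_prop
    have c4 : ContinuousAt (fun s => sliceInt v s ^ 2) s :=
      ((continuous_sliceInt hv.cont).pow 2).continuousAt
    exact ((c3.div c2 (by positivity)).mul c4).continuousWithinAt

/-- Integration of a Riccati-type differential inequality for the slice integrals. -/
theorem integral_nonneg_of_riccati (t : ℝ) {k : ℝ → ℝ} (hk : Continuous k)
    (h : ∀ s ∈ Ioo (0 : ℝ) 1,
      sliceInt (fun x s => vs x s + t * vx x s) s ^ 2 / (2 * s) +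
        Real.pi ^ 3 * Real.cos (Real.pi * s) / (2 * capMass s) * sliceInt v s ^ 2 ≤ k s) :
    0 ≤ ∫ s in (0 : ℝ)..1, k s := by
  have hd : ∀ s ∈ Ioo (0 : ℝ) 1, HasDerivAt
      (fun s => Real.pi ^ 2 * Real.sin (Real.pi * s) / (2 * capMass s) * sliceInt v s ^ 2)
      ((Real.pi ^ 3 * Real.cos (Real.pi * s) / (2 * capMass s) -
        2 * s * (Real.pi ^ 2 * Real.sin (Real.pi * s) / (2 * capMass s)) ^ 2) * sliceInt v s ^ 2 +
      Real.pi ^ 2 * Real.sin (Real.pi * s) / (2 * capMass s) *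
        (2 * sliceInt v s * sliceInt (fun x s => vs x s + t * vx x s) s)) s := by
    intro s hs
    have hm := capMass_pos hs.1 hs.2.le
    have g : HasDerivAt (fun s : ℝ => Real.pi * s) Real.pi s := by
      simpa using (hasDerivAt_id s).const_mul Real.pi
    have d1 := (g.sin.const_mul (Real.pi ^ 2)).div ((hasDerivAt_capMass s).const_mul 2)
      (by positivity)
    have d2 := (hv.hasDerivAt_sliceInt t (Ioo_subset_Icc_self hs)).pow 2
    refine (d1.mul d2).congr_deriv ?_
    simp only [Pi.div_apply, Pi.pow_apply, Nat.cast_ofNat, Nat.add_one_sub_one, pow_one]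
    field_simp
  have key := intervalIntegral.sub_le_integral_of_hasDeriv_right_of_le zero_le_one
    hv.continuousOn_riccati (fun s hs => (hd s hs).hasDerivWithinAt) hk.integrableOn_Icc
    (fun s hs => ?_)
  · simpa using key
  · refine le_trans ?_ (h s hs)
    obtain ⟨Q, hQ⟩ : ∃ Q, Q = Real.pi ^ 2 * Real.sin (Real.pi * s) / (2 * capMass s) := ⟨_, rfl⟩
    rw [← hQ]
    generalize sliceInt (fun x s => vs x s + t * vx x s) s = D
    generalize sliceInt v s = F
    have hs0 := hs.1
    have e : D ^ 2 / (2 * s) + 2 * s * Q ^ 2 * F ^ 2 - Q * (2 * F * D) =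
        (D - 2 * s * Q * F) ^ 2 / (2 * s) := by
      field_simp
      ring
    have : 0 ≤ (D - 2 * s * Q * F) ^ 2 / (2 * s) := by positivity
    linarith

theorem cont_slices (t : ℝ) :
    Continuous (sliceInt v) ∧ Continuous (sliceInt fun x s => x * v x s) ∧
    Continuous (sliceInt fun x s => v x s ^ 2) ∧ Continuous (sliceInt fun x s => vx x s ^ 2) ∧
    Continuous (sliceInt fun x s => vs x s + t * vx x s) ∧
    Continuous (sliceInt fun x s => x * (vs x s + t * vx x s)) ∧
    Continuous (sliceInt fun x s => (vs x s + t * vx x s) ^ 2) ∧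
    Continuous (sliceInt fun x s => v x s * (vs x s + t * vx x s)) :=
  ⟨continuous_sliceInt hv.cont, continuous_sliceInt (continuous_fst.mul hv.cont),
    continuous_sliceInt (hv.cont.pow 2), continuous_sliceInt (hv.cont_x.pow 2),
    continuous_sliceInt (hv.cont_line t), continuous_sliceInt (continuous_fst.mul (hv.cont_line t)),
    continuous_sliceInt ((hv.cont_line t).pow 2),
    continuous_sliceInt (hv.cont.mul (hv.cont_line t))⟩

theorem moments_le_defect (t : ℝ) :
    ∫ s in (0 : ℝ)..1, (sliceInt (fun x s => x * (vs x s + t * vx x s)) s ^ 2 +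
      (1 - s) ^ 2 * sliceInt (fun x s => x * v x s) s ^ 2) ≤
    wedgeInt (fun x s => vx x s ^ 2) + wedgeInt (fun x s => (vs x s + t * vx x s) ^ 2) -
      Real.pi ^ 2 * wedgeInt (fun x s => v x s ^ 2) := by
  obtain ⟨cF, cM, ca, cq, cD, cm, ch, cz⟩ := hv.cont_slices t
  have c1 : Continuous fun s => sliceInt (fun x s => x * (vs x s + t * vx x s)) s ^ 2 +
      (1 - s) ^ 2 * sliceInt (fun x s => x * v x s) s ^ 2 := by fun_prop
  have c2 : Continuous fun s => 1 * sliceInt (fun x s => vx x s ^ 2) s +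
      1 * sliceInt (fun x s => (vs x s + t * vx x s) ^ 2) s +
      (-Real.pi ^ 2) * sliceInt (fun x s => v x s ^ 2) s := by fun_prop
  have nn := hv.integral_nonneg_of_riccati t (c2.sub c1) (fun s hs => ?_)
  · simp only [Pi.sub_apply] at nn
    rw [intervalIntegral.integral_sub (c2.intervalIntegrable _ _) (c1.intervalIntegrable _ _),
      integral_lin_comb cq ch ca] at nn
    simp only [wedgeInt_eq]
    linarith
  · obtain ⟨ρ, h1, h2, -⟩ := exists_slice_split hs.1 hs.2.le (fun x => hv.dx x s)
      (hv.cont_slice_x s) (hv.right s (Ioo_subset_Icc_self hs)) (hv.left s (Ioo_subset_Icc_self hs))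
    have h4 := hv.sliceInt_line_bounds t hs.1 hs.2.le
    have h5 : (1 - s) ^ 2 * sliceInt (fun x s => x * v x s) s ^ 2 ≤
        Real.pi ^ 2 * (1 / s ^ 2 - 1) * ρ :=
      mul_le_mul (sq_one_sub_le hs.1 hs.2.le) h2 (sq_nonneg _)
        ((sq_nonneg _).trans (sq_one_sub_le hs.1 hs.2.le))
    simp only [Pi.sub_apply]
    simp only [sliceInt] at *
    linarith

end WedgeFun

theorem two_mul_abs_mul_le {x y ν : ℝ} (hν : 0 < ν) : 2 * |x * y| ≤ ν * x ^ 2 + y ^ 2 / ν := by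
  have h : 0 ≤ (ν * |x| - |y|) ^ 2 / ν := by positivity
  have e : (ν * |x| - |y|) ^ 2 / ν = ν * |x| ^ 2 + |y| ^ 2 / ν - 2 * (|x| * |y|) := by
    field_simp
    ring
  rw [e, sq_abs, sq_abs, ← abs_mul] at h
  linarith

theorem abs_cross_terms_le {F D M m a h c ν : ℝ} (hν : 0 < ν) (hc0 : 0 ≤ c) (hc1 : c ≤ 1)
    (hF : F ^ 2 ≤ 2 * a) (hD : D ^ 2 ≤ 2 * h) :
    |(-2) * c * F * M + c ^ 2 * D * M + c ^ 2 * F * m| ≤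
      3 * ν * (a + h) + 2 / ν * (m ^ 2 + c ^ 2 * M ^ 2) := by
  have b1 := two_mul_abs_mul_le (x := F) (y := c * M) hν
  have b2 := two_mul_abs_mul_le (x := D) (y := c * M) hν
  have b3 := two_mul_abs_mul_le (x := F) (y := m) hν
  have e1 : (-2) * c * F * M + c ^ 2 * D * M + c ^ 2 * F * m =
      (-2) * (F * (c * M)) + c * (D * (c * M)) + c ^ 2 * (F * m) := by ring
  have t1 : |(-2) * (F * (c * M)) + c * (D * (c * M)) + c ^ 2 * (F * m)| ≤
      2 * |F * (c * M)| + c * |D * (c * M)| + c ^ 2 * |F * m| := by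
    refine (abs_add_three _ _ _).trans_eq ?_
    rw [abs_mul (-2), abs_mul c (D * _), abs_mul (c ^ 2), abs_of_nonneg hc0,
      abs_of_nonneg (sq_nonneg c)]
    norm_num
  have t2 : c * |D * (c * M)| ≤ |D * (c * M)| := mul_le_of_le_one_left (abs_nonneg _) hc1
  have t3 : c ^ 2 * |F * m| ≤ |F * m| :=
    mul_le_of_le_one_left (abs_nonneg _) (pow_le_one₀ hc0 hc1)
  have f1 := mul_le_mul_of_nonneg_left hF hν.le
  have f2 := mul_le_mul_of_nonneg_left hD hν.le
  have p1 : 0 ≤ (c * M) ^ 2 / ν := by positivity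
  have p2 : 0 ≤ m ^ 2 / ν := by positivity
  have p3 : 0 ≤ ν * h := mul_nonneg hν.le (by nlinarith [sq_nonneg D])
  have e2 : 2 / ν * (m ^ 2 + c ^ 2 * M ^ 2) = 2 * (m ^ 2 / ν) + 2 * ((c * M) ^ 2 / ν) := by
    field_simp
  rw [e1, e2]
  linarith

theorem slope_abs_mul_le {ψ v H η : ℝ} (hη : 0 < η) :
    -2 * ψ * (v * H) ≤ η * H ^ 2 + ψ ^ 2 / η * v ^ 2 := by
  have h : 0 ≤ (η * H + ψ * v) ^ 2 / η := by positivity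
  have e : (η * H + ψ * v) ^ 2 / η = η * H ^ 2 + ψ ^ 2 / η * v ^ 2 + 2 * ψ * (v * H) := by
    field_simp
    ring
  linarith

namespace WedgeFun

variable {v vx vs : ℝ → ℝ → ℝ} (hv : WedgeFun v vx vs)
include hv

theorem weighted_sq_le_defect (t : ℝ) :
    (∫ s in (0 : ℝ)..1, (1 - s) ^ 2 * (s * sliceInt (fun x s => v x s ^ 2) s)) -
      Real.pi ^ 6 / 4 * (∫ s in (0 : ℝ)..1, (1 - s) ^ 2 * sliceInt v s ^ 2) ≤
    wedgeInt (fun x s => vx x s ^ 2) + wedgeInt (fun x s => (vs x s + t * vx x s) ^ 2) -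
      Real.pi ^ 2 * wedgeInt (fun x s => v x s ^ 2) := by
  obtain ⟨cF, cM, ca, cq, cD, cm, ch, cz⟩ := hv.cont_slices t
  have c1 : Continuous fun s => (1 - s) ^ 2 * (s * sliceInt (fun x s => v x s ^ 2) s) := by
    fun_prop
  have c3 : Continuous fun s => (1 - s) ^ 2 * sliceInt v s ^ 2 := by fun_prop
  have c2 : Continuous fun s => 1 * sliceInt (fun x s => vx x s ^ 2) s +
      1 * sliceInt (fun x s => (vs x s + t * vx x s) ^ 2) s +
      (-Real.pi ^ 2) * sliceInt (fun x s => v x s ^ 2) s := by fun_prop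
  have c4 : Continuous fun s => 1 * (1 * sliceInt (fun x s => vx x s ^ 2) s +
      1 * sliceInt (fun x s => (vs x s + t * vx x s) ^ 2) s +
      (-Real.pi ^ 2) * sliceInt (fun x s => v x s ^ 2) s) +
      (-1) * ((1 - s) ^ 2 * (s * sliceInt (fun x s => v x s ^ 2) s)) +
      Real.pi ^ 6 / 4 * ((1 - s) ^ 2 * sliceInt v s ^ 2) := by fun_prop
  have nn := hv.integral_nonneg_of_riccati t c4 (fun s hs => ?_)
  · rw [integral_lin_comb c2 c1 c3, integral_lin_comb cq ch ca] at nn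
    simp only [wedgeInt_eq]
    linarith
  · obtain ⟨ρ, h1, h2, h3⟩ := exists_slice_split hs.1 hs.2.le (fun x => hv.dx x s)
      (hv.cont_slice_x s) (hv.right s (Ioo_subset_Icc_self hs)) (hv.left s (Ioo_subset_Icc_self hs))
    have h4 := hv.sliceInt_line_bounds t hs.1 hs.2.le
    have hρ : 0 ≤ ρ := (sq_nonneg _).trans h2
    have h5 := mul_le_mul_of_nonneg_right (two_mul_sq_one_sub_le hs.1 hs.2.le) hρ
    have h6 := mul_le_mul_of_nonneg_left h3 (sq_nonneg (1 - s))
    have h7 := (sq_nonneg (sliceInt (fun x s => x * (vs x s + t * vx x s)) s))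
    simp only [sliceInt] at *
    linarith

theorem abs_mul_weighted_le (t : ℝ) {ν : ℝ} (hν : 0 < ν) :
    |t| * (∫ s in (0 : ℝ)..1, (1 - s) ^ 2 * sliceInt v s ^ 2) ≤
      3 * ν * (wedgeInt (fun x s => v x s ^ 2) +
        wedgeInt (fun x s => (vs x s + t * vx x s) ^ 2)) +
      2 / ν * ∫ s in (0 : ℝ)..1, (sliceInt (fun x s => x * (vs x s + t * vx x s)) s ^ 2 +
        (1 - s) ^ 2 * sliceInt (fun x s => x * v x s) s ^ 2) := by
  obtain ⟨cF, cM, ca, cq, cD, cm, ch, cz⟩ := hv.cont_slices t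
  have c1 : Continuous fun s => sliceInt (fun x s => x * (vs x s + t * vx x s)) s ^ 2 +
      (1 - s) ^ 2 * sliceInt (fun x s => x * v x s) s ^ 2 := by fun_prop
  have c2 : Continuous fun s => (1 - s) ^ 2 * sliceInt v s ^ 2 := by fun_prop
  have c3 : Continuous fun s => -2 * (1 - s) * sliceInt v s * sliceInt (fun x s => x * v x s) s +
      (1 - s) ^ 2 * sliceInt (fun x s => vs x s + t * vx x s) s * sliceInt (fun x s => x * v x s) s +
      (1 - s) ^ 2 * sliceInt v s * sliceInt (fun x s => x * (vs x s + t * vx x s)) s := by fun_prop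
  have c4 : Continuous fun s => 1 * (-2 * (1 - s) * sliceInt v s * sliceInt (fun x s => x * v x s) s +
      (1 - s) ^ 2 * sliceInt (fun x s => vs x s + t * vx x s) s * sliceInt (fun x s => x * v x s) s +
      (1 - s) ^ 2 * sliceInt v s * sliceInt (fun x s => x * (vs x s + t * vx x s)) s) +
      t * ((1 - s) ^ 2 * sliceInt v s ^ 2) + 0 * 0 := by fun_prop
  have ftc := intervalIntegral.integral_eq_sub_of_hasDerivAt (a := 0) (b := 1)
    (f := fun s => (1 - s) ^ 2 * sliceInt v s * sliceInt (fun x s => x * v x s) s)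
    (fun s hs => (?_ : HasDerivAt _ (1 * (-2 * (1 - s) * sliceInt v s * sliceInt (fun x s => x * v x s) s +
      (1 - s) ^ 2 * sliceInt (fun x s => vs x s + t * vx x s) s * sliceInt (fun x s => x * v x s) s +
      (1 - s) ^ 2 * sliceInt v s * sliceInt (fun x s => x * (vs x s + t * vx x s)) s) +
      t * ((1 - s) ^ 2 * sliceInt v s ^ 2) + 0 * 0) s)) (c4.intervalIntegrable (μ := volume) _ _)
  · rw [integral_lin_comb c3 c2 continuous_const] at ftc
    simp only [sliceInt_zero, sub_self, mul_zero, one_mul] at ftc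
    have c5 : Continuous fun s => 3 * ν * (sliceInt (fun x s => v x s ^ 2) s +
      sliceInt (fun x s => (vs x s + t * vx x s) ^ 2) s) + 2 / ν *
      (sliceInt (fun x s => x * (vs x s + t * vx x s)) s ^ 2 +
        (1 - s) ^ 2 * sliceInt (fun x s => x * v x s) s ^ 2) := by fun_prop
    have mono := intervalIntegral.integral_mono_on (μ := volume) zero_le_one
      (c3.abs.intervalIntegrable _ _) (c5.intervalIntegrable _ _) (fun s hs => ?_)
    · have h1 := (intervalIntegral.abs_integral_le_integral_abs (μ := volume)
        (f := fun s => -2 * (1 - s) * sliceInt v s * sliceInt (fun x s => x * v x s) s +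
          (1 - s) ^ 2 * sliceInt (fun x s => vs x s + t * vx x s) s *
            sliceInt (fun x s => x * v x s) s +
          (1 - s) ^ 2 * sliceInt v s * sliceInt (fun x s => x * (vs x s + t * vx x s)) s)
        zero_le_one).trans mono
      have c6 : Continuous fun s => sliceInt (fun x s => v x s ^ 2) s +
        sliceInt (fun x s => (vs x s + t * vx x s) ^ 2) s := ca.add ch
      rw [intervalIntegral.integral_add ((c6.const_mul _).intervalIntegrable _ _)
        ((c1.const_mul _).intervalIntegrable _ _), intervalIntegral.integral_const_mul,
        intervalIntegral.integral_const_mul, intervalIntegral.integral_add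
        (ca.intervalIntegrable _ _) (ch.intervalIntegrable _ _)] at h1
      have h2 : 0 ≤ ∫ s in (0 : ℝ)..1, (1 - s) ^ 2 * sliceInt v s ^ 2 :=
        intervalIntegral.integral_nonneg zero_le_one fun s _ => by positivity
      have h3 : t * (∫ s in (0 : ℝ)..1, (1 - s) ^ 2 * sliceInt v s ^ 2) =
        -∫ s in (0 : ℝ)..1, (-2 * (1 - s) * sliceInt v s * sliceInt (fun x s => x * v x s) s +
          (1 - s) ^ 2 * sliceInt (fun x s => vs x s + t * vx x s) s *
            sliceInt (fun x s => x * v x s) s +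
          (1 - s) ^ 2 * sliceInt v s * sliceInt (fun x s => x * (vs x s + t * vx x s)) s) := by
        linarith
      have h4 := congrArg abs h3
      rw [abs_mul, abs_of_nonneg h2, abs_neg] at h4
      rw [h4]
      exact h1
    · rcases hs.1.eq_or_lt with rfl | hs0
      · simp [sliceInt_zero]
      · refine abs_cross_terms_le hν (by linarith [hs.2]) (by linarith) (hv.sq_sliceInt_le hs0 hs.2) ?_
        have h4 := hv.sliceInt_line_bounds t hs0 hs.2
        have h5 : sliceInt (fun x s => vs x s + t * vx x s) s ^ 2 / (2 * s) ≤
            sliceInt (fun x s => (vs x s + t * vx x s) ^ 2) s :=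
          (le_add_of_nonneg_right (sq_nonneg _)).trans h4
        rw [div_le_iff₀ (by positivity)] at h5
        have h6 : 0 ≤ sliceInt (fun x s => (vs x s + t * vx x s) ^ 2) s :=
          intervalIntegral.integral_nonneg (by linarith) fun x _ => sq_nonneg _
        nlinarith [hs.2]
  · rw [uIcc_of_le zero_le_one] at hs
    have d1 : HasDerivAt (fun s : ℝ => (1 - s) ^ 2) (-2 * (1 - s)) s :=
      (((hasDerivAt_id s).const_sub 1).pow 2).congr_deriv (by norm_num)
    exact ((d1.mul (hv.hasDerivAt_sliceInt t hs)).mul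
      (hv.hasDerivAt_sliceInt_moment t hs)).congr_deriv (by
        simp only [Pi.mul_apply]; ring)

/-- The `L²` norm is controlled by a weighted norm and the energy along lines. -/
theorem sq_le_weighted (t : ℝ) {η : ℝ} (hη : 0 < η) :
    wedgeInt (fun x s => v x s ^ 2) ≤
      (12 + 4 / η) * (∫ s in (0 : ℝ)..1, (1 - s) ^ 2 * (s * sliceInt (fun x s => v x s ^ 2) s)) +
      η * wedgeInt (fun x s => (vs x s + t * vx x s) ^ 2) := by
  obtain ⟨cF, cM, ca, cq, cD, cm, ch, cz⟩ := hv.cont_slices t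
  have c1 : Continuous fun s => (1 - s) ^ 2 * (s * sliceInt (fun x s => v x s ^ 2) s) := by
    fun_prop
  have c2 : Continuous fun s => (1 - 12 * s * (1 - s) ^ 2) * sliceInt (fun x s => v x s ^ 2) s +
      (s - 6 * s ^ 2 + 8 * s ^ 3 - 3 * s ^ 4) *
        (2 * sliceInt (fun x s => v x s * (vs x s + t * vx x s)) s) := by fun_prop
  have c3 : Continuous fun s => (12 + 4 / η) * ((1 - s) ^ 2 *
      (s * sliceInt (fun x s => v x s ^ 2) s)) +
      η * sliceInt (fun x s => (vs x s + t * vx x s) ^ 2) s +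
      1 * ((1 - 12 * s * (1 - s) ^ 2) * sliceInt (fun x s => v x s ^ 2) s +
      (s - 6 * s ^ 2 + 8 * s ^ 3 - 3 * s ^ 4) *
        (2 * sliceInt (fun x s => v x s * (vs x s + t * vx x s)) s)) := by fun_prop
  have ftc := intervalIntegral.integral_eq_sub_of_hasDerivAt (a := 0) (b := 1)
    (f := fun s => (s - 6 * s ^ 2 + 8 * s ^ 3 - 3 * s ^ 4) * sliceInt (fun x s => v x s ^ 2) s)
    (fun s hs => (?_ : HasDerivAt _ ((1 - 12 * s * (1 - s) ^ 2) * sliceInt (fun x s => v x s ^ 2) s +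
      (s - 6 * s ^ 2 + 8 * s ^ 3 - 3 * s ^ 4) *
        (2 * sliceInt (fun x s => v x s * (vs x s + t * vx x s)) s)) s))
    (c2.intervalIntegrable (μ := volume) _ _)
  · norm_num [sliceInt_zero] at ftc
    have mono := intervalIntegral.integral_mono_on (μ := volume) zero_le_one
      (ca.intervalIntegrable _ _) (c3.intervalIntegrable _ _) (fun s hs => ?_)
    · rw [integral_lin_comb c1 ch c2] at mono
      simp only [wedgeInt_eq]
      linarith
    · have hs0 := hs.1
      have key : 0 ≤ ∫ x in -s..s, (η * (vs x s + t * vx x s) ^ 2 +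
          (s - 6 * s ^ 2 + 8 * s ^ 3 - 3 * s ^ 4) ^ 2 / η * v x s ^ 2 +
          2 * (s - 6 * s ^ 2 + 8 * s ^ 3 - 3 * s ^ 4) * (v x s * (vs x s + t * vx x s))) :=
        intervalIntegral.integral_nonneg (by linarith) fun x _ => by
          have := slope_abs_mul_le (ψ := s - 6 * s ^ 2 + 8 * s ^ 3 - 3 * s ^ 4) (v := v x s)
            (H := vs x s + t * vx x s) hη
          linarith
      have k1 : Continuous fun x => (vs x s + t * vx x s) ^ 2 := (hv.cont_slice_line t s).pow 2
      have k2 : Continuous fun x => v x s ^ 2 := (hv.cont_slice s).pow 2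
      have k3 : Continuous fun x => v x s * (vs x s + t * vx x s) :=
        (hv.cont_slice s).mul (hv.cont_slice_line t s)
      rw [integral_lin_comb k1 k2 k3] at key
      have ha : 0 ≤ sliceInt (fun x s => v x s ^ 2) s :=
        intervalIntegral.integral_nonneg (by linarith) fun x _ => sq_nonneg _
      have hψ : (s - 6 * s ^ 2 + 8 * s ^ 3 - 3 * s ^ 4) ^ 2 / η ≤ 4 / η * ((1 - s) ^ 2 * s) := by
        rw [div_mul_eq_mul_div]
        refine div_le_div_of_nonneg_right ?_ hη.le
        have e : (s - 6 * s ^ 2 + 8 * s ^ 3 - 3 * s ^ 4) ^ 2 =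
            (s * (1 - 5 * s + 3 * s ^ 2) ^ 2) * ((1 - s) ^ 2 * s) := by ring
        rw [e]
        refine mul_le_mul_of_nonneg_right ?_ (by positivity)
        have e1 : |1 - 5 * s + 3 * s ^ 2| ≤ 2 := by
          rw [abs_le]
          constructor <;> nlinarith [hs.1, hs.2, sq_nonneg (6 * s - 5), mul_nonneg hs.1 (sub_nonneg.2 hs.2)]
        have e2 := sq_le_sq' (abs_le.1 e1).1 (abs_le.1 e1).2
        nlinarith [hs.2, sq_nonneg (1 - 5 * s + 3 * s ^ 2)]
      have h7 := mul_le_mul_of_nonneg_right hψ ha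
      simp only [sliceInt] at *
      linarith
  · rw [uIcc_of_le zero_le_one] at hs
    have d1 : HasDerivAt (fun s : ℝ => s - 6 * s ^ 2 + 8 * s ^ 3 - 3 * s ^ 4)
        (1 - 12 * s * (1 - s) ^ 2) s :=
      ((((hasDerivAt_id s).sub ((hasDerivAt_pow 2 s).const_mul 6)).add
        ((hasDerivAt_pow 3 s).const_mul 8)).sub ((hasDerivAt_pow 4 s).const_mul 3)).congr_deriv
        (by norm_num; ring)
    exact d1.mul (hv.hasDerivAt_sliceInt_sq t hs)

end WedgeFun

namespace WedgeFun

/-- A spectral gap for the sheared triangle of critical height. -/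
theorem energy_gap {t : ℝ} (ht : t ≠ 0) : ∃ δ > 0, ∀ v vx vs : ℝ → ℝ → ℝ, WedgeFun v vx vs →
    (Real.pi ^ 2 + δ) * wedgeInt (fun x s => v x s ^ 2) ≤
      wedgeInt (fun x s => vx x s ^ 2) + wedgeInt (fun x s => (vs x s + t * vx x s) ^ 2) := by
  have ht' : 0 < |t| := abs_pos.2 ht
  obtain ⟨P, hP⟩ : ∃ P, P = Real.pi ^ 2 := ⟨_, rfl⟩
  obtain ⟨C, hC⟩ : ∃ C, C = Real.pi ^ 6 / 4 := ⟨_, rfl⟩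
  have hP0 : 0 < P := by rw [hP]; positivity
  have hC0 : 0 < C := by rw [hC]; positivity
  obtain ⟨L, hL⟩ : ∃ L, L = 12 + 4 / (1 / (4 * P)) := ⟨_, rfl⟩
  have hL0 : 0 < L := by rw [hL]; positivity
  obtain ⟨ν, hν⟩ : ∃ ν, ν = |t| / (12 * L * C * (1 + P)) := ⟨_, rfl⟩
  have hν0 : 0 < ν := by rw [hν]; positivity
  obtain ⟨K, hK⟩ : ∃ K, K = L + L * C / |t| * (3 * ν + 2 / ν) + 1 / (4 * P) := ⟨_, rfl⟩
  have hK0 : 0 < K := by rw [hK]; positivity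
  refine ⟨1 / (2 * K), by positivity, fun v vx vs hv => ?_⟩
  have i1 := hv.moments_le_defect t
  have i2 := hv.weighted_sq_le_defect t
  have i3 := hv.abs_mul_weighted_le t hν0
  have i4 := hv.sq_le_weighted t (η := 1 / (4 * P)) (by positivity)
  have hX : 0 ≤ wedgeInt (fun x s => vx x s ^ 2) :=
    intervalIntegral.integral_nonneg zero_le_one fun s hs =>
      intervalIntegral.integral_nonneg (by linarith [hs.1]) fun x _ => sq_nonneg _
  rw [← hP, ← hC] at *
  rw [← hL] at i4
  generalize (∫ s in (0 : ℝ)..1, (1 - s) ^ 2 * (s * sliceInt (fun x s => v x s ^ 2) s)) = W at *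
  generalize (∫ s in (0 : ℝ)..1, (1 - s) ^ 2 * sliceInt v s ^ 2) = Φ at *
  generalize (∫ s in (0 : ℝ)..1, (sliceInt (fun x s => x * (vs x s + t * vx x s)) s ^ 2 +
      (1 - s) ^ 2 * sliceInt (fun x s => x * v x s) s ^ 2)) = J at *
  generalize wedgeInt (fun x s => v x s ^ 2) = N at *
  generalize wedgeInt (fun x s => vx x s ^ 2) = X at *
  generalize wedgeInt (fun x s => (vs x s + t * vx x s) ^ 2) = Y at *
  obtain ⟨R, hR⟩ : ∃ R, R = X + Y - P * N := ⟨_, rfl⟩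
  rw [← hR] at i1 i2
  have hY : Y ≤ R + P * N := by linarith
  have j3 : |t| * Φ ≤ 3 * ν * (N + (R + P * N)) + 2 / ν * R := by
    refine i3.trans (add_le_add (mul_le_mul_of_nonneg_left (by linarith) (by positivity))
      (mul_le_mul_of_nonneg_left i1 (by positivity)))
  have j4 : L * C * Φ ≤ L * C / |t| * (3 * ν * (N + (R + P * N)) + 2 / ν * R) := by
    have := mul_le_mul_of_nonneg_left j3 (by positivity : 0 ≤ L * C / |t|)
    refine le_trans (le_of_eq ?_) this
    field_simp
  have j5 : L * C / |t| * (3 * ν * (1 + P)) = 1 / 4 := by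
    rw [hν]; field_simp; norm_num
  have j6 := mul_le_mul_of_nonneg_left i2 hL0.le
  have j7 := mul_le_mul_of_nonneg_left hY (by positivity : 0 ≤ 1 / (4 * P))
  have j8 : 1 / (4 * P) * (R + P * N) = 1 / (4 * P) * R + N / 4 := by field_simp
  have j9 : L * C / |t| * (3 * ν * (N + (R + P * N)) + 2 / ν * R) =
      L * C / |t| * (3 * ν * (1 + P)) * N + L * C / |t| * (3 * ν + 2 / ν) * R := by ring
  have j10 : K * R = L * R + L * C / |t| * (3 * ν + 2 / ν) * R + 1 / (4 * P) * R := by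
    rw [hK]; ring
  rw [j9, j5] at j4
  have fin : N ≤ 2 * K * R := by linarith
  have : 1 / (2 * K) * N ≤ R := by
    rw [div_mul_eq_mul_div, one_mul, div_le_iff₀ (by positivity)]
    linarith
  linarith

end WedgeFun

/-- The closed triangle `|x| ≤ s ≤ 1`. -/
def wedge : Set (ℝ × ℝ) := {p | p.2 ∈ Icc (0 : ℝ) 1 ∧ p.1 ∈ Icc (-p.2) p.2}

theorem isCompact_wedge : IsCompact wedge := by
  have hc : IsClosed wedge := by
    refine (isClosed_Icc.preimage continuous_snd).inter ?_
    exact (isClosed_le (continuous_snd.neg) continuous_fst).inter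
      (isClosed_le continuous_fst continuous_snd)
  refine (isCompact_Icc.prod isCompact_Icc : IsCompact (Icc (-1 : ℝ) 1 ×ˢ Icc (0 : ℝ) 1)).of_isClosed_subset hc ?_
  rintro ⟨x, s⟩ ⟨⟨h1, h2⟩, h3, h4⟩
  simp only at h1 h2 h3 h4
  exact ⟨⟨by linarith, by linarith⟩, h1, h2⟩

theorem setIntegral_wedge {f : ℝ → ℝ → ℝ} (hf : Continuous fun p : ℝ × ℝ => f p.1 p.2) :
    ∫ p in wedge, f p.1 p.2 = wedgeInt f := by
  have hm : MeasurableSet wedge := isCompact_wedge.isClosed.measurableSet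
  have hi : IntegrableOn (fun p : ℝ × ℝ => f p.1 p.2) wedge volume :=
    hf.continuousOn.integrableOn_compact isCompact_wedge
  rw [← integral_indicator hm, Measure.volume_eq_prod, integral_prod_symm _
    ((integrable_indicator_iff hm).2 hi), wedgeInt, intervalIntegral.integral_of_le zero_le_one,
    ← integral_Icc_eq_integral_Ioc, ← integral_indicator measurableSet_Icc]
  congr 1
  ext s
  by_cases hs : s ∈ Icc (0 : ℝ) 1
  · rw [indicator_of_mem hs, intervalIntegral.integral_of_le (by linarith [hs.1]),
      ← integral_Icc_eq_integral_Ioc, ← integral_indicator measurableSet_Icc]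
    congr 1
    ext x
    by_cases hx : x ∈ Icc (-s) s
    · rw [indicator_of_mem hx, indicator_of_mem (show (x, s) ∈ wedge from ⟨hs, hx⟩)]
    · rw [indicator_of_notMem hx, indicator_of_notMem fun h : (x, s) ∈ wedge => hx h.2]
  · rw [indicator_of_notMem hs]
    refine integral_eq_zero_of_ae (.of_forall fun x => ?_)
    exact indicator_of_notMem (fun h : (x, s) ∈ wedge => hs h.1) _

/-- The identification of `ℝ × ℝ` with the Euclidean plane. -/
def toE2 (p : ℝ × ℝ) : E2 := !₂[p.1, p.2]

theorem toE2_measurePreserving : MeasurePreserving toE2 volume volume :=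
  (PiLp.volume_preserving_toLp (Fin 2)).comp
    (volume_preserving_finTwoArrow ℝ).symm

theorem toE2_measurableEmbedding : MeasurableEmbedding toE2 :=
  (MeasurableEquiv.toLp 2 (Fin 2 → ℝ)).measurableEmbedding.comp
    (MeasurableEquiv.finTwoArrow (α := ℝ)).symm.measurableEmbedding

/-- The linear map with columns `d`, `m`, followed by translation by `A`. -/
def affMap (A d m : E2) (p : ℝ × ℝ) : ℝ × ℝ :=
  (A 0 + (d 0 * p.1 + m 0 * p.2), A 1 + (d 1 * p.1 + m 1 * p.2))

theorem hasFDerivAt_affMap (A d m : E2) (p : ℝ × ℝ) :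
    HasFDerivAt (affMap A d m) ((Matrix.toLin (.finTwoProd ℝ) (.finTwoProd ℝ)
      !![d 0, m 0; d 1, m 1]).toContinuousLinearMap) p := by
  rw [Matrix.toLin_finTwoProd_toContinuousLinearMap]
  refine HasFDerivAt.prodMk (𝕜 := ℝ) ?_ ?_
  · exact ((hasFDerivAt_fst.const_mul (d 0)).add (hasFDerivAt_snd.const_mul (m 0))).const_add (A 0)
  · exact ((hasFDerivAt_fst.const_mul (d 1)).add (hasFDerivAt_snd.const_mul (m 1))).const_add (A 1)

theorem injective_affMap {A d m : E2} (h : d 0 * m 1 - m 0 * d 1 ≠ 0) :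
    Function.Injective (affMap A d m) := by
  rintro ⟨x, s⟩ ⟨x', s'⟩ e
  simp only [affMap, Prod.mk.injEq] at e
  obtain ⟨e1, e2⟩ := e
  have h1 : (d 0 * m 1 - m 0 * d 1) * (x - x') = 0 := by linear_combination m 1 * e1 - m 0 * e2
  have h2 : (d 0 * m 1 - m 0 * d 1) * (s - s') = 0 := by linear_combination d 0 * e2 - d 1 * e1
  simp only [mul_eq_zero, h, false_or] at h1 h2
  ext <;> simp <;> linarith

theorem setIntegral_image_wedge {A d m : E2} (h : d 0 * m 1 - m 0 * d 1 ≠ 0) {g : E2 → ℝ}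
    (hg : Continuous g) :
    ∫ x in (fun p : ℝ × ℝ => A + p.1 • d + p.2 • m) '' wedge, g x =
      |d 0 * m 1 - m 0 * d 1| * wedgeInt fun x s => g (A + x • d + s • m) := by
  have e : ∀ p : ℝ × ℝ, toE2 (affMap A d m p) = A + p.1 • d + p.2 • m := fun p => by
    ext i
    fin_cases i <;> simp [toE2, affMap] <;> ring
  have im : (fun p : ℝ × ℝ => A + p.1 • d + p.2 • m) '' wedge = toE2 '' (affMap A d m '' wedge) := by
    rw [image_image]
    simp only [e]
  have hm : MeasurableSet wedge := isCompact_wedge.isClosed.measurableSet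
  rw [im, ← toE2_measurePreserving.setIntegral_preimage_emb toE2_measurableEmbedding,
    toE2_measurableEmbedding.injective.preimage_image,
    integral_image_eq_integral_abs_det_fderiv_smul volume hm
    (fun p _ => (hasFDerivAt_affMap A d m p).hasFDerivWithinAt) (injective_affMap h).injOn]
  simp only [LinearMap.det_toContinuousLinearMap, LinearMap.det_toLin, Matrix.det_fin_two_of, e,
    smul_eq_mul]
  rw [integral_const_mul, setIntegral_wedge (f := fun x s => g (A + x • d + s • m))]
  exact hg.comp (by fun_prop)

theorem convex_wedge : Convex ℝ wedge := by
  rintro ⟨x, s⟩ ⟨⟨h1, h2⟩, h3, h4⟩ ⟨x', s'⟩ ⟨⟨h1', h2'⟩, h3', h4'⟩ a b ha hb hab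
  simp only at h1 h2 h3 h4 h1' h2' h3' h4'
  have e : b = 1 - a := by linarith
  simp only [wedge, mem_ofPred_eq, Prod.smul_mk, Prod.mk_add_mk, smul_eq_mul, mem_Icc]
  refine ⟨⟨by positivity, ?_⟩, ?_, ?_⟩ <;> nlinarith

theorem convexHull_triangle (A d m : E2) :
    convexHull ℝ {A, A + m - d, A + m + d} =
      (fun p : ℝ × ℝ => A + p.1 • d + p.2 • m) '' wedge := by
  apply Subset.antisymm
  · refine convexHull_min ?_ ?_
    · rintro p (rfl | rfl | rfl)
      · exact ⟨(0, 0), by simp [wedge], by simp⟩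
      · exact ⟨(-1, 1), by simp [wedge], by simp; abel⟩
      · exact ⟨(1, 1), by simp [wedge], by simp; abel⟩
    · rintro _ ⟨p, hp, rfl⟩ _ ⟨q, hq, rfl⟩ a b ha hb hab
      refine ⟨a • p + b • q, convex_wedge hp hq ha hb hab, ?_⟩
      have e : b = 1 - a := by linarith
      subst e
      simp only [Prod.fst_add, Prod.snd_add, Prod.smul_fst, Prod.smul_snd, smul_eq_mul]
      module
  · rintro _ ⟨⟨x, s⟩, ⟨⟨h1, h2⟩, h3, h4⟩, rfl⟩
    simp only at h1 h2 h3 h4 ⊢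
    have hA : A ∈ convexHull ℝ {A, A + m - d, A + m + d} := subset_convexHull _ _ (by simp)
    have hB : A + m - d ∈ convexHull ℝ {A, A + m - d, A + m + d} := subset_convexHull _ _ (by simp)
    have hC : A + m + d ∈ convexHull ℝ {A, A + m - d, A + m + d} := subset_convexHull _ _ (by simp)
    rcases h1.eq_or_lt with rfl | h0
    · have : x = 0 := by linarith
      simpa [this] using hA
    · have hz := convex_convexHull ℝ _ hB hC (a := (s - x) / (2 * s)) (b := (s + x) / (2 * s))
        (div_nonneg (by linarith) (by linarith)) (div_nonneg (by linarith) (by linarith))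
        (by field_simp; ring)
      have := convex_convexHull ℝ _ hA hz (a := 1 - s) (b := s) (by linarith) h1 (by ring)
      convert this using 1
      have e1 : s * ((s - x) / (2 * s)) = (s - x) / 2 := by field_simp
      have e2 : s * ((s + x) / (2 * s)) = (s + x) / 2 := by field_simp
      rw [smul_add, smul_smul, smul_smul, e1, e2]
      module

theorem wedgeInt_one : wedgeInt (fun _ _ => 1) = 1 := by
  have e : ∀ s : ℝ, ∫ _ in -s..s, (1 : ℝ) = 2 * s := fun s => by simp; ring
  simp only [wedgeInt, e]
  rw [intervalIntegral.integral_const_mul, integral_id]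
  norm_num

section Triangle

variable {A d m : E2} (h : d 0 * m 1 - m 0 * d 1 ≠ 0)
include h

theorem setIntegral_convexHull {g : E2 → ℝ} (hg : Continuous g) :
    ∫ x in convexHull ℝ {A, A + m - d, A + m + d}, g x =
      |d 0 * m 1 - m 0 * d 1| * wedgeInt fun x s => g (A + x • d + s • m) := by
  rw [convexHull_triangle, setIntegral_image_wedge h hg]

theorem volume_triangle :
    (volume (convexHull ℝ {A, A + m - d, A + m + d})).toReal = |d 0 * m 1 - m 0 * d 1| := by
  have := setIntegral_convexHull (A := A) h (g := fun _ => 1) continuous_const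
  rw [wedgeInt_one] at this
  simpa [measureReal_def] using this

theorem setIntegral_triangleO {g : E2 → ℝ} (hg : Continuous g) :
    ∫ x in triangleO A (A + m - d) (A + m + d), g x =
      |d 0 * m 1 - m 0 * d 1| * wedgeInt fun x s => g (A + x • d + s • m) := by
  rw [← setIntegral_convexHull h hg, triangleO]
  exact setIntegral_congr_set (interior_ae_eq_of_null_frontier
    ((convex_convexHull ℝ _).addHaar_frontier volume))

end Triangle

theorem norm_sq_eq_coords (L : E2 →L[ℝ] ℝ) :
    ‖L‖ ^ 2 = L (EuclideanSpace.single 0 1) ^ 2 + L (EuclideanSpace.single 1 1) ^ 2 := by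
  obtain ⟨w, rfl⟩ := (InnerProductSpace.toDual ℝ E2).surjective L
  rw [LinearIsometryEquiv.norm_map, EuclideanSpace.norm_sq_eq]
  simp [InnerProductSpace.toDual_apply_apply, EuclideanSpace.inner_single_right]

theorem apply_eq_coords (L : E2 →L[ℝ] ℝ) (w : E2) :
    L w = w 0 * L (EuclideanSpace.single 0 1) + w 1 * L (EuclideanSpace.single 1 1) := by
  have : w = w 0 • EuclideanSpace.single 0 1 + w 1 • EuclideanSpace.single 1 1 := by
    ext i
    fin_cases i <;> simp
  conv_lhs => rw [this]
  simp

/-- The squared norm of a gradient in the frame `d`, `m`. -/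
theorem abs_det_mul_norm_sq {d m : E2} (h : d 0 * m 1 - m 0 * d 1 ≠ 0) (L : E2 →L[ℝ] ℝ) :
    |d 0 * m 1 - m 0 * d 1| * ‖L‖ ^ 2 =
      |d 0 * m 1 - m 0 * d 1| / (d 0 ^ 2 + d 1 ^ 2) * L d ^ 2 +
      (L m + -((d 0 * m 0 + d 1 * m 1) / (d 0 ^ 2 + d 1 ^ 2)) * L d) ^ 2 /
        (|d 0 * m 1 - m 0 * d 1| / (d 0 ^ 2 + d 1 ^ 2)) := by
  rw [norm_sq_eq_coords, apply_eq_coords L d, apply_eq_coords L m]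
  generalize L (EuclideanSpace.single 0 1) = p
  generalize L (EuclideanSpace.single 1 1) = q
  have hd : 0 < d 0 ^ 2 + d 1 ^ 2 := by
    by_contra! hc
    have h0 : d 0 = 0 := by nlinarith [sq_nonneg (d 0), sq_nonneg (d 1)]
    have h1 : d 1 = 0 := by nlinarith [sq_nonneg (d 0), sq_nonneg (d 1)]
    exact h (by rw [h0, h1]; ring)
  have hK : 0 < |d 0 * m 1 - m 0 * d 1| := abs_pos.2 h
  have hK2 := sq_abs (d 0 * m 1 - m 0 * d 1)
  generalize |d 0 * m 1 - m 0 * d 1| = K at *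
  field_simp
  rw [hK2]
  ring

theorem wedgeInt_const_mul (c : ℝ) (f : ℝ → ℝ → ℝ) :
    wedgeInt (fun x s => c * f x s) = c * wedgeInt f := by
  simp only [wedgeInt, intervalIntegral.integral_const_mul]

theorem wedgeInt_lin_comb {f g : ℝ → ℝ → ℝ} (hf : Continuous fun p : ℝ × ℝ => f p.1 p.2)
    (hg : Continuous fun p : ℝ × ℝ => g p.1 p.2) (α β : ℝ) :
    wedgeInt (fun x s => α * f x s + β * g x s) = α * wedgeInt f + β * wedgeInt g := by
  have hf' : Continuous fun p : ℝ × ℝ => α * f p.1 p.2 := hf.const_mul α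
  have hg' : Continuous fun p : ℝ × ℝ => β * g p.1 p.2 := hg.const_mul β
  rw [← wedgeInt_const_mul, ← wedgeInt_const_mul, wedgeInt, wedgeInt, wedgeInt,
    ← intervalIntegral.integral_add
      ((continuous_integral_symm (f := fun x s => α * f x s) hf').intervalIntegrable _ _)
      ((continuous_integral_symm (f := fun x s => β * g x s) hg').intervalIntegrable _ _)]
  refine intervalIntegral.integral_congr fun s _ => ?_
  have sc : Continuous fun x : ℝ => (x, s) := by fun_prop
  have l1 : Continuous fun x : ℝ => α * f x s := hf'.comp sc
  have l2 : Continuous fun x : ℝ => β * g x s := hg'.comp sc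
  exact intervalIntegral.integral_add (l1.intervalIntegrable _ _) (l2.intervalIntegrable _ _)

section Triangle

variable {A d m : E2}

theorem wedgeFun_of_admissible {u : E2 → ℝ} (hu : ContDiff ℝ (⊤ : ℕ∞) u)
    (hD : ∀ x ∈ segment ℝ A (A + m + d) ∪ segment ℝ A (A + m - d), u x = 0) :
    WedgeFun (fun x s => u (A + x • d + s • m)) (fun x s => fderiv ℝ u (A + x • d + s • m) d)
      (fun x s => fderiv ℝ u (A + x • d + s • m) m) := by
  have hc : Continuous (fderiv ℝ u) := hu.continuous_fderiv (by simp)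
  have hp : Continuous fun p : ℝ × ℝ => A + p.1 • d + p.2 • m := by fun_prop
  refine ⟨fun x s => ?_, (hc.comp hp).clm_apply continuous_const,
    (hc.comp hp).clm_apply continuous_const, fun s hs => hD _ (Or.inl ?_),
    fun s hs => hD _ (Or.inr ?_)⟩
  · have d1 : HasFDerivAt (fun p : ℝ × ℝ => A + p.1 • d + p.2 • m)
        ((ContinuousLinearMap.fst ℝ ℝ ℝ).smulRight d + (ContinuousLinearMap.snd ℝ ℝ ℝ).smulRight m)
        (x, s) :=
      ((hasFDerivAt_fst.smul_const d).const_add A).add (hasFDerivAt_snd.smul_const m)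
    have d2 := ((hu.differentiable (by simp)) (A + x • d + s • m)).hasFDerivAt
    refine (HasFDerivAt.comp (x, s) (f := fun p : ℝ × ℝ => A + p.1 • d + p.2 • m) d2 d1).congr_fderiv ?_
    ext <;> simp
  · rw [segment_eq_image']
    exact ⟨s, hs, by simp; module⟩
  · rw [segment_eq_image']
    exact ⟨s, hs, by simp; module⟩

variable (h : d 0 * m 1 - m 0 * d 1 ≠ 0)
include h

theorem sq_integral_pos_of_notAEZero {u : E2 → ℝ} (hu : Continuous u)
    (hn : NotAEZero (triangleO A (A + m - d) (A + m + d)) u) :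
    0 < wedgeInt fun x s => u (A + x • d + s • m) ^ 2 := by
  have c : Continuous fun x => u x ^ 2 := hu.pow 2
  have e := setIntegral_triangleO (A := A) h c
  by_contra! hc
  refine hn ?_
  have h0 : 0 ≤ ∫ x in triangleO A (A + m - d) (A + m + d), u x ^ 2 :=
    integral_nonneg fun x => sq_nonneg _
  have hz : ∫ x in triangleO A (A + m - d) (A + m + d), u x ^ 2 = 0 := by
    refine le_antisymm ?_ h0
    rw [e]
    exact mul_nonpos_of_nonneg_of_nonpos (abs_nonneg _) hc
  have hK : IsCompact (convexHull ℝ ({A, A + m - d, A + m + d} : Set E2)) :=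
    (Set.toFinite _).isCompact_convexHull ℝ
  have hi : IntegrableOn (fun x => u x ^ 2) (triangleO A (A + m - d) (A + m + d)) volume :=
    (c.continuousOn.integrableOn_compact hK).mono_set interior_subset
  have := (integral_eq_zero_iff_of_nonneg (fun x => sq_nonneg _) hi).1 hz
  filter_upwards [this] with x hx
  simpa using hx

theorem rayleigh_eq {u : E2 → ℝ} (hu : ContDiff ℝ (⊤ : ℕ∞) u) :
    rayleigh (triangleO A (A + m - d) (A + m + d)) u =
      (|d 0 * m 1 - m 0 * d 1| / (d 0 ^ 2 + d 1 ^ 2) *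
        wedgeInt (fun x s => fderiv ℝ u (A + x • d + s • m) d ^ 2) +
      wedgeInt (fun x s => (fderiv ℝ u (A + x • d + s • m) m +
        -((d 0 * m 0 + d 1 * m 1) / (d 0 ^ 2 + d 1 ^ 2)) *
          fderiv ℝ u (A + x • d + s • m) d) ^ 2) /
        (|d 0 * m 1 - m 0 * d 1| / (d 0 ^ 2 + d 1 ^ 2))) /
      (|d 0 * m 1 - m 0 * d 1| * wedgeInt fun x s => u (A + x • d + s • m) ^ 2) := by
  have hc : Continuous (fderiv ℝ u) := hu.continuous_fderiv (by simp)
  have hp : Continuous fun p : ℝ × ℝ => A + p.1 • d + p.2 • m := by fun_prop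
  have c1 : Continuous fun p : ℝ × ℝ => fderiv ℝ u (A + p.1 • d + p.2 • m) d :=
    (hc.comp hp).clm_apply continuous_const
  have c2 : Continuous fun p : ℝ × ℝ => fderiv ℝ u (A + p.1 • d + p.2 • m) m :=
    (hc.comp hp).clm_apply continuous_const
  have g1 : Continuous fun x => ‖fderiv ℝ u x‖ ^ 2 := hc.norm.pow 2
  have g2 : Continuous fun x => u x ^ 2 := hu.continuous.pow 2
  rw [rayleigh, setIntegral_triangleO h g1, setIntegral_triangleO h g2]
  congr 1
  have key := fun x s : ℝ => abs_det_mul_norm_sq h (fderiv ℝ u (A + x • d + s • m))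
  have k1 : Continuous fun p : ℝ × ℝ => fderiv ℝ u (A + p.1 • d + p.2 • m) d ^ 2 := c1.pow 2
  have k2 : Continuous fun p : ℝ × ℝ => (fderiv ℝ u (A + p.1 • d + p.2 • m) m +
    -((d 0 * m 0 + d 1 * m 1) / (d 0 ^ 2 + d 1 ^ 2)) *
      fderiv ℝ u (A + p.1 • d + p.2 • m) d) ^ 2 := (c2.add (c1.const_mul _)).pow 2
  have l := wedgeInt_lin_comb (f := fun x s => fderiv ℝ u (A + x • d + s • m) d ^ 2)
    (g := fun x s => (fderiv ℝ u (A + x • d + s • m) m +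
      -((d 0 * m 0 + d 1 * m 1) / (d 0 ^ 2 + d 1 ^ 2)) * fderiv ℝ u (A + x • d + s • m) d) ^ 2)
    k1 k2 (|d 0 * m 1 - m 0 * d 1| / (d 0 ^ 2 + d 1 ^ 2))
    (|d 0 * m 1 - m 0 * d 1| / (d 0 ^ 2 + d 1 ^ 2))⁻¹
  rw [div_eq_inv_mul (wedgeInt _), ← l, ← wedgeInt_const_mul]
  simp only [key, div_eq_inv_mul (_ ^ 2) (|d 0 * m 1 - m 0 * d 1| / (d 0 ^ 2 + d 1 ^ 2))]

end Triangle

/-! The first eigenfunction of the right isosceles triangle. -/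

theorem hasDerivAt_sin_mul (c x : ℝ) :
    HasDerivAt (fun x => Real.sin (c * x)) (c * Real.cos (c * x)) x :=
  (((hasDerivAt_id x).const_mul c).sin).congr_deriv (by simp; ring)

theorem hasDerivAt_cos_mul (c x : ℝ) :
    HasDerivAt (fun x => Real.cos (c * x)) (-(c * Real.sin (c * x))) x :=
  (((hasDerivAt_id x).const_mul c).cos).congr_deriv (by simp; ring)

theorem integral_cos_sub_cos_sq (s : ℝ) :
    ∫ x in -s..s, (Real.cos (Real.pi * x) - Real.cos (Real.pi * s)) ^ 2 =
      2 * s + s * Real.cos (2 * Real.pi * s) - 3 / (2 * Real.pi) * Real.sin (2 * Real.pi * s) := by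
  have hp := Real.pi_ne_zero
  have hd : ∀ x ∈ uIcc (-s) s, HasDerivAt (fun x => x / 2 + 1 / (2 * (2 * Real.pi)) *
      Real.sin (2 * Real.pi * x) - 2 * Real.cos (Real.pi * s) / Real.pi * Real.sin (Real.pi * x) +
      x * Real.cos (Real.pi * s) ^ 2)
      ((Real.cos (Real.pi * x) - Real.cos (Real.pi * s)) ^ 2) x := fun x _ => by
    refine (((((hasDerivAt_id x).div_const 2).add ((hasDerivAt_sin_mul (2 * Real.pi) x).const_mul
      (1 / (2 * (2 * Real.pi))))).sub ((hasDerivAt_sin_mul Real.pi x).const_mul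
      (2 * Real.cos (Real.pi * s) / Real.pi))).add ((hasDerivAt_id x).mul_const _)).congr_deriv ?_
    rw [mul_assoc 2 Real.pi x, Real.cos_two_mul]
    field_simp
    ring
  rw [intervalIntegral.integral_eq_sub_of_hasDerivAt hd
    ((by fun_prop : Continuous fun x => (Real.cos (Real.pi * x) - Real.cos (Real.pi * s)) ^ 2
      ).intervalIntegrable _ _)]
  rw [show 2 * Real.pi * -s = -(2 * Real.pi * s) by ring, show Real.pi * -s = -(Real.pi * s) by ring,
    Real.sin_neg, Real.sin_neg, mul_assoc 2 Real.pi s, Real.sin_two_mul, Real.cos_two_mul]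
  field_simp
  ring

theorem wedgeInt_cos_sub_cos_sq :
    wedgeInt (fun x s => (Real.cos (Real.pi * x) - Real.cos (Real.pi * s)) ^ 2) = 1 := by
  have hp := Real.pi_ne_zero
  have hd : ∀ s ∈ uIcc (0 : ℝ) 1, HasDerivAt (fun s => s ^ 2 + 1 / (2 * Real.pi) *
      (s * Real.sin (2 * Real.pi * s)) + 1 / Real.pi ^ 2 * Real.cos (2 * Real.pi * s))
      (2 * s + s * Real.cos (2 * Real.pi * s) - 3 / (2 * Real.pi) * Real.sin (2 * Real.pi * s)) s :=
      fun s _ => by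
    refine (((hasDerivAt_pow 2 s).add (((hasDerivAt_id s).mul
      (hasDerivAt_sin_mul (2 * Real.pi) s)).const_mul (1 / (2 * Real.pi)))).add
      ((hasDerivAt_cos_mul (2 * Real.pi) s).const_mul (1 / Real.pi ^ 2))).congr_deriv ?_
    simp only [id]
    field_simp
    ring
  simp only [wedgeInt, integral_cos_sub_cos_sq]
  rw [intervalIntegral.integral_eq_sub_of_hasDerivAt hd
    ((by fun_prop : Continuous fun s => 2 * s + s * Real.cos (2 * Real.pi * s) -
      3 / (2 * Real.pi) * Real.sin (2 * Real.pi * s)).intervalIntegrable _ _)]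
  simp

theorem wedgeInt_sin_sq_add :
    wedgeInt (fun x _ => (Real.pi * Real.sin (Real.pi * x)) ^ 2) +
      wedgeInt (fun _ s => (Real.pi * Real.sin (Real.pi * s)) ^ 2) = Real.pi ^ 2 := by
  have hp := Real.pi_ne_zero
  have e1 : ∀ s : ℝ, ∫ x in -s..s, (Real.pi * Real.sin (Real.pi * x)) ^ 2 =
      Real.pi ^ 2 * s - Real.pi / 2 * Real.sin (2 * Real.pi * s) := fun s => by
    have hd : ∀ x ∈ uIcc (-s) s, HasDerivAt (fun x => Real.pi ^ 2 / 2 * x - Real.pi / 4 *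
        Real.sin (2 * Real.pi * x)) ((Real.pi * Real.sin (Real.pi * x)) ^ 2) x := fun x _ => by
      refine (((hasDerivAt_id x).const_mul (Real.pi ^ 2 / 2)).sub
        ((hasDerivAt_sin_mul (2 * Real.pi) x).const_mul (Real.pi / 4))).congr_deriv ?_
      rw [mul_assoc 2 Real.pi x, Real.cos_two_mul, Real.cos_sq']
      ring
    rw [intervalIntegral.integral_eq_sub_of_hasDerivAt hd
      ((by fun_prop : Continuous fun x => (Real.pi * Real.sin (Real.pi * x)) ^ 2
        ).intervalIntegrable _ _),
      show 2 * Real.pi * -s = -(2 * Real.pi * s) by ring, Real.sin_neg]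
    ring
  have e2 : ∀ s : ℝ, ∫ _ in -s..s, (Real.pi * Real.sin (Real.pi * s)) ^ 2 =
      Real.pi ^ 2 * s - Real.pi ^ 2 * (s * Real.cos (2 * Real.pi * s)) := fun s => by
    rw [intervalIntegral.integral_const, smul_eq_mul, mul_assoc 2 Real.pi s, Real.cos_two_mul,
      Real.cos_sq']
    ring
  simp only [wedgeInt, e1, e2]
  rw [← intervalIntegral.integral_add
    ((by fun_prop : Continuous fun s => Real.pi ^ 2 * s - Real.pi / 2 * Real.sin (2 * Real.pi * s)
      ).intervalIntegrable _ _)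
    ((by fun_prop : Continuous fun s => Real.pi ^ 2 * s -
      Real.pi ^ 2 * (s * Real.cos (2 * Real.pi * s))).intervalIntegrable _ _)]
  have hd : ∀ s ∈ uIcc (0 : ℝ) 1, HasDerivAt (fun s => Real.pi ^ 2 * s ^ 2 - Real.pi / 2 *
      (s * Real.sin (2 * Real.pi * s)))
      (Real.pi ^ 2 * s - Real.pi / 2 * Real.sin (2 * Real.pi * s) + (Real.pi ^ 2 * s -
        Real.pi ^ 2 * (s * Real.cos (2 * Real.pi * s)))) s := fun s _ => by
    refine (((hasDerivAt_pow 2 s).const_mul (Real.pi ^ 2)).sub (((hasDerivAt_id s).mul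
      (hasDerivAt_sin_mul (2 * Real.pi) s)).const_mul (Real.pi / 2))).congr_deriv ?_
    simp only [id]
    ring
  rw [intervalIntegral.integral_eq_sub_of_hasDerivAt hd
    ((by fun_prop : Continuous fun s => Real.pi ^ 2 * s - Real.pi / 2 * Real.sin (2 * Real.pi * s) +
      (Real.pi ^ 2 * s - Real.pi ^ 2 * (s * Real.cos (2 * Real.pi * s)))).intervalIntegrable _ _)]
  simp

/-- The function on the plane equal to `cos π x - cos π s` in the affine coordinates `(x, s)`. -/
def cosTest (A d m : E2) (p : E2) : ℝ :=
  Real.cos (Real.pi * (((p 0 - A 0) * m 1 - (p 1 - A 1) * m 0) / (d 0 * m 1 - m 0 * d 1))) -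
    Real.cos (Real.pi * ((d 0 * (p 1 - A 1) - d 1 * (p 0 - A 0)) / (d 0 * m 1 - m 0 * d 1)))

theorem contDiff_cosTest (A d m : E2) : ContDiff ℝ (⊤ : ℕ∞) (cosTest A d m) := by
  unfold cosTest
  fun_prop

section Triangle

variable {A d m : E2} (h : d 0 * m 1 - m 0 * d 1 ≠ 0)
include h

theorem cosTest_eq (x s : ℝ) :
    cosTest A d m (A + x • d + s • m) = Real.cos (Real.pi * x) - Real.cos (Real.pi * s) := by
  have e1 : ((A + x • d + s • m) 0 - A 0) * m 1 - ((A + x • d + s • m) 1 - A 1) * m 0 =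
      x * (d 0 * m 1 - m 0 * d 1) := by simp; ring
  have e2 : d 0 * ((A + x • d + s • m) 1 - A 1) - d 1 * ((A + x • d + s • m) 0 - A 0) =
      s * (d 0 * m 1 - m 0 * d 1) := by simp; ring
  rw [cosTest, e1, e2, mul_div_cancel_right₀ _ h, mul_div_cancel_right₀ _ h]

theorem cosTest_eq_zero {p : E2} (hp : p ∈ segment ℝ A (A + m + d) ∪ segment ℝ A (A + m - d)) :
    cosTest A d m p = 0 := by
  rw [segment_eq_image', segment_eq_image'] at hp
  rcases hp with ⟨s, -, rfl⟩ | ⟨s, -, rfl⟩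
  · have : A + s • (A + m + d - A) = A + s • d + s • m := by module
    simp only [this, cosTest_eq h, sub_self]
  · have : A + s • (A + m - d - A) = A + (-s) • d + s • m := by module
    simp only [this, cosTest_eq h, mul_neg, Real.cos_neg, sub_self]

theorem notAEZero_cosTest : NotAEZero (triangleO A (A + m - d) (A + m + d)) (cosTest A d m) := by
  intro hz
  have c : Continuous fun x => cosTest A d m x ^ 2 := (contDiff_cosTest A d m).continuous.pow 2
  have e := setIntegral_triangleO (A := A) h c
  simp only [cosTest_eq h, wedgeInt_cos_sub_cos_sq, mul_one] at e
  have : ∫ x in triangleO A (A + m - d) (A + m + d), cosTest A d m x ^ 2 = 0 :=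
    integral_eq_zero_of_ae (by filter_upwards [hz] with x hx; simp [hx])
  exact (abs_pos.2 h).ne' (e.symm.trans this)

theorem eig_set_nonempty : { r | ∃ u : E2 → ℝ, ContDiff ℝ (⊤ : ℕ∞) u ∧
    (∀ x ∈ segment ℝ A (A + m + d) ∪ segment ℝ A (A + m - d), u x = 0) ∧
    NotAEZero (triangleO A (A + m - d) (A + m + d)) u ∧
    r = rayleigh (triangleO A (A + m - d) (A + m + d)) u }.Nonempty :=
  ⟨_, cosTest A d m, contDiff_cosTest A d m, fun _ hx => cosTest_eq_zero h hx, notAEZero_cosTest h, rfl⟩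

/-- A lower bound for the anisotropic energy bounds the eigenvalue. -/
theorem firstMixedEig_ge_of_energy {c : ℝ}
    (hc : ∀ v vx vs : ℝ → ℝ → ℝ, WedgeFun v vx vs → c * wedgeInt (fun x s => v x s ^ 2) ≤
      |d 0 * m 1 - m 0 * d 1| / (d 0 ^ 2 + d 1 ^ 2) * wedgeInt (fun x s => vx x s ^ 2) +
      wedgeInt (fun x s => (vs x s + -((d 0 * m 0 + d 1 * m 1) / (d 0 ^ 2 + d 1 ^ 2)) * vx x s) ^ 2)
        / (|d 0 * m 1 - m 0 * d 1| / (d 0 ^ 2 + d 1 ^ 2))) :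
    c / |d 0 * m 1 - m 0 * d 1| ≤ firstMixedEig (triangleO A (A + m - d) (A + m + d))
      (segment ℝ A (A + m + d) ∪ segment ℝ A (A + m - d)) := by
  refine le_csInf (eig_set_nonempty h) ?_
  rintro _ ⟨u, hu, hD, hn, rfl⟩
  have hN := sq_integral_pos_of_notAEZero h hu.continuous hn
  have hK := abs_pos.2 h
  have key := hc _ _ _ (wedgeFun_of_admissible hu hD)
  rw [rayleigh_eq h hu, div_le_div_iff₀ hK (by positivity)]
  have := mul_le_mul_of_nonneg_right key hK.le
  linarith

theorem fderiv_cosTest (x s : ℝ) :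
    fderiv ℝ (cosTest A d m) (A + x • d + s • m) d = -(Real.pi * Real.sin (Real.pi * x)) ∧
    fderiv ℝ (cosTest A d m) (A + x • d + s • m) m = Real.pi * Real.sin (Real.pi * s) := by
  have hw := wedgeFun_of_admissible (contDiff_cosTest A d m) fun _ hx => cosTest_eq_zero h hx
  constructor
  · have d1 := hw.dx x s
    simp only [cosTest_eq h] at d1
    exact d1.unique ((hasDerivAt_cos_mul Real.pi x).sub_const _)
  · have d1 := hw.ds x s
    simp only [cosTest_eq h] at d1
    exact (d1.unique ((hasDerivAt_cos_mul Real.pi s).const_sub _)).trans (neg_neg _)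

theorem firstMixedEig_le (ha : |d 0 * m 1 - m 0 * d 1| / (d 0 ^ 2 + d 1 ^ 2) = 1)
    (ht : d 0 * m 0 + d 1 * m 1 = 0) :
    firstMixedEig (triangleO A (A + m - d) (A + m + d))
      (segment ℝ A (A + m + d) ∪ segment ℝ A (A + m - d)) ≤
      Real.pi ^ 2 / |d 0 * m 1 - m 0 * d 1| := by
  refine csInf_le ⟨0, ?_⟩ ⟨cosTest A d m, contDiff_cosTest A d m,
    fun _ hx => cosTest_eq_zero h hx, notAEZero_cosTest h, ?_⟩
  · rintro _ ⟨u, -, -, -, rfl⟩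
    exact div_nonneg (integral_nonneg fun x => sq_nonneg _) (integral_nonneg fun x => sq_nonneg _)
  · rw [rayleigh_eq h (contDiff_cosTest A d m), ha, ht]
    simp only [fderiv_cosTest h, cosTest_eq h, wedgeInt_cos_sub_cos_sq, zero_div, neg_zero, zero_mul,
      add_zero, one_mul, div_one, neg_sq, mul_one, wedgeInt_sin_sq_add]

end Triangle

theorem det_ne_zero_of_not_collinear {A d m : E2}
    (hT : ¬ Collinear ℝ ({A, A + m - d, A + m + d} : Set E2)) : d 0 * m 1 - m 0 * d 1 ≠ 0 := by
  intro h
  refine hT ?_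
  rw [collinear_iff_of_mem (p₀ := A) (by simp)]
  by_cases h0 : d 0 = 0 ∧ d 1 = 0
  · have hd : d = 0 := by ext i; fin_cases i <;> simp [h0]
    refine ⟨m, ?_⟩
    rintro p (rfl | rfl | rfl)
    · exact ⟨0, by simp⟩
    · exact ⟨1, by simp [hd, add_comm]⟩
    · exact ⟨1, by simp [hd, add_comm]⟩
  · have : ∃ c : ℝ, m = c • d := by
      rw [not_and_or] at h0
      rcases h0 with h0 | h0
      · refine ⟨m 0 / d 0, ?_⟩
        ext i
        fin_cases i
        · simp [h0]
        · simp; field_simp; linarith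
      · refine ⟨m 1 / d 1, ?_⟩
        ext i
        fin_cases i
        · simp; field_simp; linarith
        · simp [h0]
    obtain ⟨c, rfl⟩ := this
    refine ⟨d, ?_⟩
    rintro p (rfl | rfl | rfl)
    · exact ⟨0, by simp⟩
    · exact ⟨c - 1, by simp [sub_smul]; abel⟩
    · exact ⟨c + 1, by simp [add_smul]; abel⟩

section Triangle

variable {A d m : E2} (h : d 0 * m 1 - m 0 * d 1 ≠ 0)
include h

theorem base_sq_pos : 0 < d 0 ^ 2 + d 1 ^ 2 := by
  by_contra! hc
  have h0 : d 0 = 0 := by nlinarith [sq_nonneg (d 0), sq_nonneg (d 1)]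
  have h1 : d 1 = 0 := by nlinarith [sq_nonneg (d 0), sq_nonneg (d 1)]
  exact h (by rw [h0, h1]; ring)

theorem shape_bound_le_firstMixedEig :
    Real.pi ^ 2 * ((|d 0 * m 1 - m 0 * d 1| / (d 0 ^ 2 + d 1 ^ 2) + 1) ^ 2 /
      (4 * (|d 0 * m 1 - m 0 * d 1| / (d 0 ^ 2 + d 1 ^ 2)))) / |d 0 * m 1 - m 0 * d 1| ≤
    firstMixedEig (triangleO A (A + m - d) (A + m + d))
      (segment ℝ A (A + m + d) ∪ segment ℝ A (A + m - d)) :=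
  firstMixedEig_ge_of_energy h fun _ _ _ hv =>
    hv.energy_ge (div_pos (abs_pos.2 h) (base_sq_pos h)) _

theorem pi_sq_div_le_firstMixedEig :
    Real.pi ^ 2 / |d 0 * m 1 - m 0 * d 1| ≤ firstMixedEig (triangleO A (A + m - d) (A + m + d))
      (segment ℝ A (A + m + d) ∪ segment ℝ A (A + m - d)) := by
  refine le_trans ?_ (shape_bound_le_firstMixedEig h)
  have ha := div_pos (abs_pos.2 h) (base_sq_pos h)
  refine div_le_div_of_nonneg_right (le_mul_of_one_le_right (sq_nonneg _) ?_) (abs_nonneg _)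
  rw [le_div_iff₀ (by positivity)]
  nlinarith [sq_nonneg (|d 0 * m 1 - m 0 * d 1| / (d 0 ^ 2 + d 1 ^ 2) - 1)]

theorem firstMixedEig_eq_iff_shape :
    firstMixedEig (triangleO A (A + m - d) (A + m + d))
      (segment ℝ A (A + m + d) ∪ segment ℝ A (A + m - d)) =
      Real.pi ^ 2 / |d 0 * m 1 - m 0 * d 1| ↔
    |d 0 * m 1 - m 0 * d 1| / (d 0 ^ 2 + d 1 ^ 2) = 1 ∧ d 0 * m 0 + d 1 * m 1 = 0 := by
  have hd := base_sq_pos h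
  have hK := abs_pos.2 h
  constructor
  · intro he
    have h1 := shape_bound_le_firstMixedEig (A := A) h
    have ha := div_pos hK hd
    rw [he, div_le_div_iff_of_pos_right hK] at h1
    have h2 := le_of_mul_le_mul_left (h1.trans_eq (mul_one _).symm) (by positivity)
    rw [div_le_one (by positivity)] at h2
    have ha1 : |d 0 * m 1 - m 0 * d 1| / (d 0 ^ 2 + d 1 ^ 2) = 1 := by
      have : (|d 0 * m 1 - m 0 * d 1| / (d 0 ^ 2 + d 1 ^ 2) - 1) ^ 2 ≤ 0 := by linarith
      have := pow_eq_zero_iff (two_ne_zero) |>.1 (le_antisymm this (sq_nonneg _))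
      linarith
    refine ⟨ha1, ?_⟩
    by_contra ht
    obtain ⟨δ, hδ, hgap⟩ := WedgeFun.energy_gap
      (t := -((d 0 * m 0 + d 1 * m 1) / (d 0 ^ 2 + d 1 ^ 2))) (neg_ne_zero.2 (div_ne_zero ht hd.ne'))
    have h3 := firstMixedEig_ge_of_energy (A := A) h (c := Real.pi ^ 2 + δ) fun v vx vs hv => by
      rw [ha1, one_mul, div_one]
      exact hgap v vx vs hv
    rw [he, div_le_div_iff_of_pos_right hK] at h3
    linarith
  · rintro ⟨ha, ht⟩
    exact (firstMixedEig_le h ha ht).antisymm (pi_sq_div_le_firstMixedEig h)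

theorem shape_iff_dist :
    (|d 0 * m 1 - m 0 * d 1| / (d 0 ^ 2 + d 1 ^ 2) = 1 ∧ d 0 * m 0 + d 1 * m 1 = 0) ↔
    dist A (A + m - d) = dist A (A + m + d) ∧
      dist (A + m - d) (A + m + d) ^ 2 = 2 * dist A (A + m - d) ^ 2 := by
  have hd := base_sq_pos h
  have hK := abs_pos.2 h
  have hK2 := sq_abs (d 0 * m 1 - m 0 * d 1)
  have e1 : dist A (A + m - d) ^ 2 = (m 0 - d 0) ^ 2 + (m 1 - d 1) ^ 2 := by
    rw [EuclideanSpace.dist_sq_eq]; simp [Real.dist_eq, sq_abs]; ring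
  have e2 : dist A (A + m + d) ^ 2 = (m 0 + d 0) ^ 2 + (m 1 + d 1) ^ 2 := by
    rw [EuclideanSpace.dist_sq_eq]; simp [Real.dist_eq, sq_abs]; ring
  have e3 : dist (A + m - d) (A + m + d) ^ 2 = 4 * (d 0 ^ 2 + d 1 ^ 2) := by
    rw [EuclideanSpace.dist_sq_eq]; simp [Real.dist_eq, sq_abs]; ring
  rw [← sq_eq_sq₀ dist_nonneg dist_nonneg, e1, e2, e3, div_eq_one_iff_eq hd.ne']
  generalize |d 0 * m 1 - m 0 * d 1| = K at *
  constructor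
  · rintro ⟨rfl, ht⟩
    have e : (d 0 ^ 2 + d 1 ^ 2) * (d 0 ^ 2 + d 1 ^ 2) = (d 0 ^ 2 + d 1 ^ 2) * (m 0 ^ 2 + m 1 ^ 2) := by
      linear_combination hK2 - (d 0 * m 0 + d 1 * m 1) * ht
    have e' := mul_left_cancel₀ hd.ne' e
    constructor <;> linarith
  · rintro ⟨h1, h2⟩
    have ht : d 0 * m 0 + d 1 * m 1 = 0 := by linarith
    refine ⟨?_, ht⟩
    rw [← sq_eq_sq₀ hK.le hd.le, hK2]
    linear_combination (-(1/2) : ℝ) * (d 0 ^ 2 + d 1 ^ 2) * h2 -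
      (d 0 * m 0 + d 1 * m 1 - 2 * (d 0 ^ 2 + d 1 ^ 2)) * ht

end Triangle

theorem exists_frame (A B C : E2) : ∃ d m : E2, B = A + m - d ∧ C = A + m + d :=
  ⟨(2⁻¹ : ℝ) • (C - B), (2⁻¹ : ℝ) • (B + C) - A, by module, by module⟩

section Vertices

variable {A B C : E2} (hT : ¬ Collinear ℝ ({A, B, C} : Set E2))
include hT

/-- Isoperimetric lower bound for the mixed eigenvalue of a triangle. -/
theorem pi_sq_div_area_le_firstMixedEig :
    Real.pi ^ 2 / (volume (convexHull ℝ ({A, B, C} : Set E2))).toReal ≤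
      firstMixedEig (triangleO A B C) (segment ℝ A C ∪ segment ℝ A B) := by
  obtain ⟨d, m, rfl, rfl⟩ := exists_frame A B C
  have h := det_ne_zero_of_not_collinear hT
  rw [volume_triangle h]
  exact pi_sq_div_le_firstMixedEig h

/-- The isoperimetric bound is attained exactly at isosceles right triangles. -/
theorem firstMixedEig_eq_iff :
    firstMixedEig (triangleO A B C) (segment ℝ A C ∪ segment ℝ A B) =
      Real.pi ^ 2 / (volume (convexHull ℝ ({A, B, C} : Set E2))).toReal ↔
    dist A B = dist A C ∧ dist B C ^ 2 = 2 * dist A B ^ 2 := by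
  obtain ⟨d, m, rfl, rfl⟩ := exists_frame A B C
  have h := det_ne_zero_of_not_collinear hT
  rw [volume_triangle h, firstMixedEig_eq_iff_shape h, shape_iff_dist h]

theorem area_of_isosceles_right (h1 : dist A B = dist A C) (h2 : dist B C ^ 2 = 2 * dist A B ^ 2) :
    (volume (convexHull ℝ ({A, B, C} : Set E2))).toReal = dist A B ^ 2 / 2 := by
  obtain ⟨d, m, rfl, rfl⟩ := exists_frame A B C
  have h := det_ne_zero_of_not_collinear hT
  have hs := ((shape_iff_dist h).2 ⟨h1, h2⟩).1
  rw [div_eq_one_iff_eq (base_sq_pos h).ne'] at hs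
  have e3 : dist (A + m - d) (A + m + d) ^ 2 = 4 * (d 0 ^ 2 + d 1 ^ 2) := by
    rw [EuclideanSpace.dist_sq_eq]; simp [Real.dist_eq, sq_abs]; ring
  rw [volume_triangle h, hs]
  linarith

end Vertices

theorem exists_orthonormalBasis_smul {u v : E2} {r : ℝ} (hr : r ≠ 0) (hu : ‖u‖ = r) (hv : ‖v‖ = r)
    (huv : inner ℝ u v = 0) :
    ∃ b : OrthonormalBasis (Fin 2) ℝ E2, u = r • b 0 ∧ v = r • b 1 := by
  have hon : Orthonormal ℝ ![r⁻¹ • u, r⁻¹ • v] := by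
    have hr0 : 0 ≤ r := hu ▸ norm_nonneg u
    refine ⟨fun i => ?_, fun i j hij => ?_⟩
    · fin_cases i <;> simp [norm_smul, hu, hv, abs_of_nonneg hr0, hr]
    · fin_cases i <;> fin_cases j <;>
        simp_all [real_inner_smul_right, real_inner_comm]
  have hc : Fintype.card (Fin 2) = Module.finrank ℝ E2 := by simp
  let b := basisOfOrthonormalOfCardEqFinrank hon hc
  have hb : ⇑b = ![r⁻¹ • u, r⁻¹ • v] := coe_basisOfOrthonormalOfCardEqFinrank hon hc
  refine ⟨b.toOrthonormalBasis (by rw [hb]; exact hon), ?_, ?_⟩ <;> simp [hb, hr]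

theorem inner_sub_sub_eq_zero {A B C : E2} (h1 : dist A B = dist A C)
    (h2 : dist B C ^ 2 = 2 * dist A B ^ 2) : inner ℝ (B - A) (C - A) = 0 := by
  have h := norm_sub_sq_real (B - A) (C - A)
  rw [sub_sub_sub_cancel_right, ← dist_eq_norm, ← dist_eq_norm, ← dist_eq_norm, dist_comm B A,
    dist_comm C A, ← h1, h2] at h
  linarith

/-- Isosceles right triangles with equal legs are congruent. -/
theorem exists_isometryEquiv_of_isosceles_right {A B C A' B' C' : E2} (hAB : A ≠ B)
    (h1 : dist A B = dist A C) (h2 : dist B C ^ 2 = 2 * dist A B ^ 2)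
    (h1' : dist A' B' = dist A' C') (h2' : dist B' C' ^ 2 = 2 * dist A' B' ^ 2)
    (hd : dist A B = dist A' B') :
    ∃ f : E2 ≃ᵢ E2, ⇑f '' ({A, B, C} : Set E2) = ({A', B', C'} : Set E2) := by
  have hr : dist A B ≠ 0 := dist_ne_zero.2 hAB
  obtain ⟨b, hbB, hbC⟩ := exists_orthonormalBasis_smul hr
    (by rw [← dist_eq_norm, dist_comm]) (by rw [← dist_eq_norm, dist_comm, h1])
    (inner_sub_sub_eq_zero h1 h2)
  obtain ⟨b', hbB', hbC'⟩ := exists_orthonormalBasis_smul hr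
    (by rw [← dist_eq_norm, dist_comm, hd]) (by rw [← dist_eq_norm, dist_comm, hd, h1'])
    (inner_sub_sub_eq_zero h1' h2')
  let φ := b.equiv b' (Equiv.refl _)
  have hφ (i) : φ (b i) = b' i := by simp [φ]
  refine ⟨((IsometryEquiv.subRight A).trans φ.toIsometryEquiv).trans (IsometryEquiv.addRight A'),
    ?_⟩
  simp only [image_insert_eq, image_singleton]
  congr 1
  · simp
  · simp [hbB, hbC, hφ, ← hbB', ← hbC']

theorem ne_of_not_collinear {A B C : E2} (hT : ¬ Collinear ℝ ({A, B, C} : Set E2)) :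
    A ≠ B ∧ A ≠ C ∧ B ≠ C := by
  refine ⟨?_, ?_, ?_⟩ <;> rintro rfl <;> exact hT (by simp [collinear_pair])

theorem isosceles_right_of_isometryEquiv {A B C A' B' C' : E2}
    (hT : ¬ Collinear ℝ ({A, B, C} : Set E2))
    (hLM : dist A C ≤ dist B C) (hMS : dist A B ≤ dist A C)
    (h1' : dist A' B' = dist A' C') (h2' : dist B' C' ^ 2 = 2 * dist A' B' ^ 2)
    {f : E2 ≃ᵢ E2} (hf : ⇑f '' ({A, B, C} : Set E2) = ({A', B', C'} : Set E2)) :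
    dist A B = dist A C ∧ dist B C ^ 2 = 2 * dist A B ^ 2 := by
  obtain ⟨hAB, hAC, hBC⟩ := ne_of_not_collinear hT
  have hmem {x} (hx : x ∈ ({A, B, C} : Set E2)) : f x = A' ∨ f x = B' ∨ f x = C' := by
    have := mem_image_of_mem f hx
    rwa [hf] at this
  have hlt : dist A' B' < dist B' C' ∨ dist A' B' = 0 := by
    rcases (dist_nonneg (x := A') (y := B')).eq_or_lt with h | h
    · exact .inr h.symm
    · exact .inl (lt_of_pow_lt_pow_left₀ 2 dist_nonneg (by nlinarith))
  rw [← dist_pos, ← f.dist_eq] at hAB hAC hBC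
  rw [← f.dist_eq A C, ← f.dist_eq B C] at hLM
  rw [← f.dist_eq A C, ← f.dist_eq A B] at hMS
  rw [← f.dist_eq A C, ← f.dist_eq A B, ← f.dist_eq B C]
  have c1 := dist_comm B' A'
  have c2 := dist_comm C' A'
  have c3 := dist_comm C' B'
  rcases hmem (x := A) (by simp) with h | h | h <;>
  rcases hmem (x := B) (by simp) with h' | h' | h' <;>
  rcases hmem (x := C) (by simp) with h'' | h'' | h'' <;>
  rw [h, h'] at hAB hMS ⊢ <;> rw [h, h''] at hAC <;> rw [h', h''] at hBC <;>
  simp only [h, h', h'', dist_self, lt_irrefl, c1, c2, c3] at hAB hAC hBC hMS hLM ⊢ <;>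
  first
    | exact ⟨h1', h2'⟩
    | exact ⟨h1'.symm, h1' ▸ h2'⟩
    | (rcases hlt with hlt | hlt <;> linarith)

theorem dist_sq_eq_of_angle_eq_pi_div_two {A B C : E2} (hright : ∠ B A C = Real.pi / 2)
    (hlegs : dist A B = dist A C) : dist B C ^ 2 = 2 * dist A B ^ 2 := by
  have h := (dist_sq_eq_dist_sq_add_dist_sq_iff_angle_eq_pi_div_two B A C).2 hright
  rw [dist_comm B A, dist_comm C A, ← hlegs] at h
  linarith

/-- Among all triangles of a given area, the isosceles right triangle (with
Dirichlet conditions on the two non-longest sides `M`, `S` and Neumann on the longest side)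
minimizes the first mixed eigenvalue, with equality iff the triangle is congruent to it.
Here the sides of `T = △ABC` satisfy `|AB| ≤ |AC| ≤ |BC|` (so `L = BC`, `M = AC`, `S = AB`),
and `T* = △A'B'C'` is an isosceles right triangle with right angle at `A'` (so `M ∪ S` is the
union of its two legs) of the same area. -/
theorem stmt_0 (A B C A' B' C' : E2)
    (hT : ¬ Collinear ℝ ({A, B, C} : Set E2))
    (hT' : ¬ Collinear ℝ ({A', B', C'} : Set E2))
    (hLM : dist A C ≤ dist B C) (hMS : dist A B ≤ dist A C)
    (hright' : ∠ B' A' C' = Real.pi / 2)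
    (hlegs' : dist A' B' = dist A' C')
    (harea : volume (convexHull ℝ ({A, B, C} : Set E2)) =
      volume (convexHull ℝ ({A', B', C'} : Set E2))) :
    firstMixedEig (triangleO A B C) (segment ℝ A C ∪ segment ℝ A B) ≥
      firstMixedEig (triangleO A' B' C') (segment ℝ A' C' ∪ segment ℝ A' B') ∧
    (firstMixedEig (triangleO A B C) (segment ℝ A C ∪ segment ℝ A B) =
        firstMixedEig (triangleO A' B' C') (segment ℝ A' C' ∪ segment ℝ A' B') ↔
      ∃ f : E2 ≃ᵢ E2, ⇑f '' ({A, B, C} : Set E2) = ({A', B', C'} : Set E2)) := by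
  have hhyp' := dist_sq_eq_of_angle_eq_pi_div_two hright' hlegs'
  rw [(firstMixedEig_eq_iff hT').2 ⟨hlegs', hhyp'⟩, ← harea]
  refine ⟨pi_sq_div_area_le_firstMixedEig hT, (firstMixedEig_eq_iff hT).trans ⟨?_, ?_⟩⟩
  · rintro ⟨h1, h2⟩
    have ha := area_of_isosceles_right hT h1 h2
    rw [harea, area_of_isosceles_right hT' hlegs' hhyp'] at ha
    exact exists_isometryEquiv_of_isosceles_right (ne_of_not_collinear hT).1 h1 h2 hlegs' hhyp'
      ((sq_eq_sq₀ dist_nonneg dist_nonneg).1 (by linarith))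
  · rintro ⟨f, hf⟩
    exact isosceles_right_of_isometryEquiv hT hLM hMS hlegs' hhyp' hf

end
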